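/- arXiv:1511.06093 — 12 statements merged into one kernel-verified Lean document; each statement's English description precedes it below -/
import Mathlib

section
/- Let (x⁰_j, f⁰_j)_{j∈ℕ} and (x¹_j, f¹_j)_{j∈ℕ} be two approximate Schauder frames for a Banach space X such that for every σ : ℕ → {0,1} the weaving (x^{σ(j)}_j, f^{σ(j)}_j)_{j∈ℕ} is an approximate Schauder frame for X. Then for every x ∈ X and every ε > 0 there exists N ∈ ℕ such that ‖∑_{j=m}^{n} f^{σ(j)}_j(x) x^{σ(j)}_j‖ < ε for all σ : ℕ → {0,1} and all n ≥ m ≥ N. -/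
open Filter Topology

variable {X : Type*} [NormedAddCommGroup X] [NormedSpace ℝ X] [CompleteSpace X]

/-- The weaving of two sequences determined by `σ : ℕ → Bool`
(`σ j = false` selects the first sequence, `σ j = true` the second). -/
def weave {α : Type*} (g0 g1 : ℕ → α) (σ : ℕ → Bool) (j : ℕ) : α :=
  if σ j then g1 j else g0 j

/-- `(x, f)` is an approximate Schauder frame for `X` with frame operator `S`:
the partial sums of `∑ f i v • x i` converge to `S v` for every `v`, where `S`
is a bounded operator with bounded inverse (a continuous linear equivalence). -/
def IsASF (x : ℕ → X) (f : ℕ → X →L[ℝ] ℝ) (S : X ≃L[ℝ] X) : Prop :=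
  ∀ v : X, Tendsto (fun n => ∑ i ∈ Finset.range n, f i v • x i) atTop (𝓝 (S v))

theorem stmt0 (x0 x1 : ℕ → X) (f0 f1 : ℕ → X →L[ℝ] ℝ) (S0 S1 : X ≃L[ℝ] X)
    (h0 : IsASF x0 f0 S0) (h1 : IsASF x1 f1 S1)
    (hw : ∀ σ : ℕ → Bool, ∃ S : X ≃L[ℝ] X, IsASF (weave x0 x1 σ) (weave f0 f1 σ) S) :
    ∀ (v : X) (ε : ℝ), 0 < ε → ∃ N : ℕ, ∀ (σ : ℕ → Bool) (m n : ℕ), N ≤ m → m ≤ n →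
      ‖∑ j ∈ Finset.Icc m n, weave f0 f1 σ j v • weave x0 x1 σ j‖ < ε := by
  classical
  intro v ε hε
  by_contra hcon
  push Not at hcon
  choose s m n hm hmn hbig using hcon
  let N : ℕ → ℕ := fun k => Nat.rec 0 (fun _ a => n a + 1) k
  have hN : ∀ k, N (k + 1) = n (N k) + 1 := fun k => rfl
  have hmono : StrictMono N := by
    refine strictMono_nat_of_lt_succ fun k => ?_
    have := hm (N k)
    have := hmn (N k)
    rw [hN]
    omega
  let τ : ℕ → Bool := fun j => decide (∃ k, m (N k) ≤ j ∧ j ≤ n (N k) ∧ s (N k) j = true)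
  have hτ : ∀ k j, m (N k) ≤ j → j ≤ n (N k) → τ j = s (N k) j := by
    intro k j h1 h2
    have key : (∃ k, m (N k) ≤ j ∧ j ≤ n (N k) ∧ s (N k) j = true) ↔ s (N k) j = true := by
      constructor
      · rintro ⟨l, a, b, c⟩
        rcases lt_trichotomy l k with h | h | h
        · have e1 := hmono.monotone (Nat.succ_le_of_lt h)
          have e2 := hN l
          have e3 := hm (N k)
          simp only [Nat.succ_eq_add_one] at e1
          omega
        · rw [← h]; exact c
        · have e1 := hmono.monotone (Nat.succ_le_of_lt h)
          have e2 := hN k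
          have e3 := hm (N l)
          simp only [Nat.succ_eq_add_one] at e1
          omega
      · intro h
        exact ⟨k, h1, h2, h⟩
    simp only [τ, key, Bool.decide_eq_true]
  obtain ⟨S, hS⟩ := hw τ
  obtain ⟨M, hM⟩ := Metric.cauchySeq_iff.1 (hS v).cauchySeq ε hε
  have hk : M ≤ N M := hmono.le_apply
  have a1 := hm (N M)
  have a2 := hmn (N M)
  have hd := hM (n (N M) + 1) (by omega) (m (N M)) (by omega)
  rw [dist_eq_norm, ← Finset.sum_Ico_eq_sub _ (by omega)] at hd
  have hb := hbig (N M)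
  have heq : ∑ j ∈ Finset.Icc (m (N M)) (n (N M)),
        weave f0 f1 (s (N M)) j v • weave x0 x1 (s (N M)) j
      = ∑ j ∈ Finset.Ico (m (N M)) (n (N M) + 1), weave f0 f1 τ j v • weave x0 x1 τ j := by
    refine Finset.sum_congr (by ext; simp) fun j hj => ?_
    rw [Finset.mem_Ico] at hj
    simp only [weave, hτ M j hj.1 (by omega)]
  rw [heq] at hb
  exact absurd hd (not_lt.2 hb)
end

section
/- Let (x⁰_j, f⁰_j)_{j∈ℕ} and (x¹_j, f¹_j)_{j∈ℕ} be two approximate Schauder frames for a Banach space X such that for every σ : ℕ → {0,1} the weaving (x^{σ(j)}_j, f^{σ(j)}_j)_{j∈ℕ} is an approximate Schauder frame for X. Then there exists a constant D > 0 such that for all σ : ℕ → {0,1} and all m ≤ n in ℕ, the operator P_{σ,[m,n]} : X → X defined by P_{σ,[m,n]}(x) = ∑_{j=m}^{n} f^{σ(j)}_j(x) x^{σ(j)}_j satisfies ‖P_{σ,[m,n]}‖ ≤ D. -/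
open Filter Topology

variable {X : Type*} [NormedAddCommGroup X] [NormedSpace ℝ X] [CompleteSpace X]

theorem weave_bdd_aux {E : Type*} [NormedAddCommGroup E] (a b : ℕ → E)
    (h : ∀ σ : ℕ → Bool, ∃ s, Tendsto (fun n => ∑ i ∈ Finset.range n, weave a b σ i) atTop (𝓝 s)) :
    ∃ C : ℝ, ∀ (σ : ℕ → Bool) (n : ℕ), ‖∑ i ∈ Finset.range n, weave a b σ i‖ ≤ C := by
  let F : ℕ → Set (ℕ → Bool) := fun K => {σ | ∀ n, ‖∑ i ∈ Finset.range n, weave a b σ i‖ ≤ K}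
  have hcont : ∀ i, Continuous (fun σ : ℕ → Bool => weave a b σ i) := by
    intro i
    exact (continuous_of_discreteTopology (f := fun t : Bool => if t then b i else a i)).comp
      (continuous_apply i)
  have hF : ∀ K, IsClosed (F K) := by
    intro K
    have : F K = ⋂ n, {σ | ‖∑ i ∈ Finset.range n, weave a b σ i‖ ≤ K} := by
      ext σ; simp [F]
    rw [this]
    refine isClosed_iInter fun n => isClosed_le ?_ continuous_const
    exact (continuous_finsetSum _ fun i _ => hcont i).norm
  have hU : ⋃ K, F K = Set.univ := by
    refine Set.eq_univ_of_forall fun σ => ?_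
    obtain ⟨s, hs⟩ := h σ
    obtain ⟨R, hR⟩ := hs.norm.bddAbove_range
    obtain ⟨K, hK⟩ := exists_nat_ge R
    exact Set.mem_iUnion.2 ⟨K, fun n => (hR ⟨n, rfl⟩).trans hK⟩
  obtain ⟨K, σ0, hσ0⟩ := nonempty_interior_of_iUnion_of_closed hF hU
  obtain ⟨I, u, hu, hsub⟩ := isOpen_pi_iff.1 isOpen_interior σ0 hσ0
  refine ⟨K + ∑ i ∈ I, ‖b i - a i‖, fun σ n => ?_⟩
  let τ : ℕ → Bool := fun j => if j ∈ I then σ0 j else σ j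
  have hτ : τ ∈ F K := by
    refine interior_subset (hsub fun j hj => ?_)
    have hj' : j ∈ I := hj
    simp only [τ, hj', if_true]
    exact (hu j hj').2
  have hd : ‖∑ i ∈ Finset.range n, (weave a b σ i - weave a b τ i)‖ ≤ ∑ i ∈ I, ‖b i - a i‖ := by
    calc _ ≤ ∑ i ∈ Finset.range n, ‖weave a b σ i - weave a b τ i‖ := norm_sum_le _ _
      _ ≤ ∑ i ∈ Finset.range n, if i ∈ I then ‖b i - a i‖ else 0 := by
        refine Finset.sum_le_sum fun i _ => ?_
        by_cases hi : i ∈ I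
        · simp only [weave, τ, hi, if_true]
          cases σ i <;> cases σ0 i <;> simp [norm_sub_rev]
        · simp [weave, τ, hi]
      _ = ∑ i ∈ Finset.range n with i ∈ I, ‖b i - a i‖ := (Finset.sum_filter _ _).symm
      _ ≤ _ := Finset.sum_le_sum_of_subset_of_nonneg
        (fun i hi => (Finset.mem_filter.1 hi).2) (fun _ _ _ => norm_nonneg _)
  have e : ∑ i ∈ Finset.range n, weave a b σ i = ∑ i ∈ Finset.range n, weave a b τ i
      + ∑ i ∈ Finset.range n, (weave a b σ i - weave a b τ i) := by
    rw [← Finset.sum_add_distrib]; simp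
  rw [e]
  exact (norm_add_le _ _).trans (add_le_add (hτ n) hd)

theorem stmt1 (x0 x1 : ℕ → X) (f0 f1 : ℕ → X →L[ℝ] ℝ) (S0 S1 : X ≃L[ℝ] X)
    (h0 : IsASF x0 f0 S0) (h1 : IsASF x1 f1 S1)
    (hw : ∀ σ : ℕ → Bool, ∃ S : X ≃L[ℝ] X, IsASF (weave x0 x1 σ) (weave f0 f1 σ) S) :
    ∃ D > (0 : ℝ), ∀ (σ : ℕ → Bool) (m n : ℕ), m ≤ n →
      ‖∑ j ∈ Finset.Icc m n, (weave f0 f1 σ j).smulRight (weave x0 x1 σ j)‖ ≤ D := by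
  have key : ∃ C, ∀ p : (ℕ → Bool) × ℕ,
      ‖∑ j ∈ Finset.range p.2, (weave f0 f1 p.1 j).smulRight (weave x0 x1 p.1 j)‖ ≤ C := by
    refine banach_steinhaus (g := fun p : (ℕ → Bool) × ℕ =>
      ∑ j ∈ Finset.range p.2, (weave f0 f1 p.1 j).smulRight (weave x0 x1 p.1 j)) fun v => ?_
    have hv : ∀ (σ : ℕ → Bool) i, weave (fun i => f0 i v • x0 i) (fun i => f1 i v • x1 i) σ i
        = weave f0 f1 σ i v • weave x0 x1 σ i := by
      intro σ i
      cases hs : σ i <;> simp [weave, hs]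
    obtain ⟨C, hC⟩ := weave_bdd_aux (fun i => f0 i v • x0 i) (fun i => f1 i v • x1 i) (by
      intro σ
      obtain ⟨S, hS⟩ := hw σ
      refine ⟨S v, ?_⟩
      simp only [hv]
      exact hS v)
    refine ⟨C, fun p => ?_⟩
    have := hC p.1 p.2
    simp only [hv] at this
    simpa [ContinuousLinearMap.sum_apply] using this
  obtain ⟨C, hC⟩ := key
  have hC0 : 0 ≤ C := (norm_nonneg _).trans (hC (fun _ => true, 0))
  refine ⟨C + C + 1, by linarith, fun σ m n hmn => ?_⟩
  have e : Finset.Icc m n = Finset.Ico m (n + 1) := by ext; simp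
  rw [e, Finset.sum_Ico_eq_sub _ (by omega : m ≤ n + 1)]
  refine (norm_sub_le _ _).trans ?_
  have h2 := hC (σ, n + 1)
  have h3 := hC (σ, m)
  simp only at h2 h3
  linarith
end

section
/- Let (x⁰_j, f⁰_j)_{j∈ℕ} and (x¹_j, f¹_j)_{j∈ℕ} be two approximate Schauder frames for a Banach space X such that for every σ : ℕ → {0,1} the weaving (x^{σ(j)}_j, f^{σ(j)}_j)_{j∈ℕ} is an approximate Schauder frame for X. Then for every x ∈ X there exists δ > 0 such that for all σ : ℕ → {0,1}, the frame operator S_σ of the weaving satisfies ‖S_σ x‖ ≥ δ‖x‖. -/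
open Filter Topology

variable {X : Type*} [NormedAddCommGroup X] [NormedSpace ℝ X] [CompleteSpace X]

theorem summable_of_subseries {E : Type*} [NormedAddCommGroup E] [CompleteSpace E] (d : ℕ → E)
    (h : ∀ σ : ℕ → Bool, ∃ l : E,
      Tendsto (fun n => ∑ i ∈ Finset.range n, if σ i then d i else 0) atTop (𝓝 l)) :
    Summable d := by
  classical
  rw [summable_iff_vanishing_norm]
  by_contra hc
  push Not at hc
  obtain ⟨ε, hε, hc⟩ := hc
  choose F hF hFn using fun N : ℕ => hc (Finset.range N)
  let g : ℕ → ℕ := fun N => max (N + 1) ((F N).sup id + 1)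
  let N : ℕ → ℕ := fun k => g^[k] 0
  have hNs : ∀ k, N (k + 1) = g (N k) := fun k => Function.iterate_succ_apply' g k 0
  have hNm : StrictMono N := strictMono_nat_of_lt_succ fun k => by
    rw [hNs]; exact lt_of_lt_of_le (Nat.lt_succ_self _) (le_max_left _ _)
  have hFlo : ∀ n, ∀ j ∈ F n, n ≤ j := fun n j hj => by
    have := Finset.disjoint_left.1 (hF n) hj
    simpa using this
  have hFhi : ∀ n, ∀ j ∈ F n, j < g n := fun n j hj => by
    have : j ≤ (F n).sup id := Finset.le_sup (f := id) hj
    exact lt_of_lt_of_le (Nat.lt_succ_of_le this) (le_max_right _ _)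
  let σ : ℕ → Bool := fun j => decide (∃ k, j ∈ F (N k))
  obtain ⟨l, hl⟩ := h σ
  have hC := hl.cauchySeq
  rw [Metric.cauchySeq_iff] at hC
  obtain ⟨M, hM⟩ := hC ε hε
  have h1 := hM (N (M + 1)) (by have := hNm.le_apply (x := M + 1); omega) (N M) (hNm.le_apply)
  rw [dist_eq_norm, ← Finset.sum_Ico_eq_sub _ (hNm.monotone (Nat.le_succ M)),
    ← Finset.sum_filter] at h1
  have h2 : (Finset.Ico (N M) (N (M + 1))).filter (fun j => σ j = true) = F (N M) := by
    ext j
    simp only [Finset.mem_filter, Finset.mem_Ico, σ, decide_eq_true_eq]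
    constructor
    · rintro ⟨⟨ha, hb⟩, k, hk⟩
      have h3 := hFlo _ _ hk
      have h4 := hFhi _ _ hk
      rw [← hNs] at h4
      have h5 : k < M + 1 := hNm.lt_iff_lt.1 (lt_of_le_of_lt h3 hb)
      have h6 : M < k + 1 := hNm.lt_iff_lt.1 (lt_of_le_of_lt ha h4)
      have : k = M := by omega
      rwa [← this]
    · intro hj
      exact ⟨⟨hFlo _ _ hj, by rw [hNs]; exact hFhi _ _ hj⟩, M, hj⟩
  rw [h2] at h1
  exact absurd h1 (not_lt.2 (hFn _))

theorem continuous_subseries {E : Type*} [NormedAddCommGroup E] [CompleteSpace E] (d : ℕ → E)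
    (φ : (ℕ → Bool) → E)
    (h : ∀ σ : ℕ → Bool,
      Tendsto (fun n => ∑ i ∈ Finset.range n, if σ i then d i else 0) atTop (𝓝 (φ σ))) :
    Continuous φ := by
  classical
  have hs := summable_of_subseries d fun σ => ⟨_, h σ⟩
  rw [summable_iff_vanishing_norm] at hs
  have hU : TendstoUniformly (fun (n : ℕ) (σ : ℕ → Bool) =>
      ∑ i ∈ Finset.range n, if σ i then d i else 0) φ atTop := by
    rw [Metric.tendstoUniformly_iff]
    intro ε hε
    obtain ⟨s, hs⟩ := hs (ε / 2) (half_pos hε)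
    filter_upwards [eventually_ge_atTop (s.sup id + 1)] with n hn σ
    have : dist (φ σ) (∑ i ∈ Finset.range n, if σ i then d i else 0) ≤ ε / 2 := by
      refine le_of_tendsto ((h σ).dist tendsto_const_nhds) ?_
      filter_upwards [eventually_ge_atTop n] with m hm
      rw [dist_eq_norm, ← Finset.sum_Ico_eq_sub _ hm, ← Finset.sum_filter]
      refine (hs _ ?_).le
      rw [Finset.disjoint_left]
      intro j hj hjs
      have h1 : j ≤ s.sup id := Finset.le_sup (f := id) hjs
      simp only [Finset.mem_filter, Finset.mem_Ico] at hj
      omega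
    linarith
  refine hU.continuous (Frequently.of_forall fun n => ?_)
  refine continuous_finsetSum _ fun i _ => ?_
  exact (continuous_of_discreteTopology (f := fun b : Bool => if b then d i else 0)).comp
    (continuous_apply i)

theorem stmt2 (x0 x1 : ℕ → X) (f0 f1 : ℕ → X →L[ℝ] ℝ) (S0 S1 : X ≃L[ℝ] X)
    (h0 : IsASF x0 f0 S0) (h1 : IsASF x1 f1 S1)
    (hw : ∀ σ : ℕ → Bool, ∃ S : X ≃L[ℝ] X, IsASF (weave x0 x1 σ) (weave f0 f1 σ) S) :
    ∀ v : X, ∃ δ > (0 : ℝ), ∀ (σ : ℕ → Bool) (S : X ≃L[ℝ] X),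
      IsASF (weave x0 x1 σ) (weave f0 f1 σ) S → δ * ‖v‖ ≤ ‖S v‖ := by
  intro v
  by_cases hv : v = 0
  · exact ⟨1, one_pos, fun σ S _ => by simp [hv]⟩
  choose T hT using hw
  have hc : Continuous (fun σ => T σ v - S0 v) := by
    refine continuous_subseries (fun i => f1 i v • x1 i - f0 i v • x0 i) _ fun σ => ?_
    refine ((hT σ v).sub (h0 v)).congr fun n => ?_
    rw [← Finset.sum_sub_distrib]
    refine Finset.sum_congr rfl fun i _ => ?_
    cases hσ : σ i <;> simp [weave, hσ]
  have hc2 : Continuous (fun σ => ‖T σ v‖) := by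
    have := (hc.add (continuous_const (y := S0 v))).norm
    simpa using this
  obtain ⟨τ, -, hτ⟩ := isCompact_univ.exists_isMinOn (Set.univ_nonempty) hc2.continuousOn
  have hv' : 0 < ‖v‖ := norm_pos_iff.2 hv
  have hp : 0 < ‖T τ v‖ := norm_pos_iff.2 (by simpa using hv)
  refine ⟨‖T τ v‖ / ‖v‖, div_pos hp hv', fun σ S hS => ?_⟩
  rw [div_mul_cancel₀ _ hv'.ne', tendsto_nhds_unique (hS v) (hT σ v)]
  exact hτ (Set.mem_univ σ)
end

section
/- Let (x⁰_j, f⁰_j)_{j∈ℕ} and (x¹_j, f¹_j)_{j∈ℕ} be two approximate Schauder frames for a Banach space X. If for every σ : ℕ → {0,1} the weaving (x^{σ(j)}_j, f^{σ(j)}_j)_{j∈ℕ} is an approximate Schauder frame for X, then there exists a uniform constant C ≥ 1 such that every weaving is a C-approximate Schauder frame, i.e., for every σ : ℕ → {0,1} the weaving frame operator S_σ satisfies ‖S_σ‖ ≤ C and ‖S_σ⁻¹‖ ≤ C. -/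
open Filter Topology

variable {X : Type*} [NormedAddCommGroup X] [NormedSpace ℝ X] [CompleteSpace X]

theorem baire_aux (A : ℕ → Set (ℕ → Bool)) (hc : ∀ k, IsClosed (A k))
    (hU : ⋃ k, A k = Set.univ) :
    ∃ (k M : ℕ) (τ : ℕ → Bool), ∀ σ : ℕ → Bool, (fun j => if j < M then τ j else σ j) ∈ A k := by
  obtain ⟨k, τ, hτ⟩ := nonempty_interior_of_iUnion_of_closed hc hU
  obtain ⟨I, u, hu, hI⟩ := isOpen_pi_iff.1 isOpen_interior τ hτ
  refine ⟨k, I.sup id + 1, τ, fun σ => interior_subset (hI ?_)⟩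
  intro j hj
  have : j < I.sup id + 1 := Nat.lt_succ_of_le (Finset.le_sup (f := id) hj)
  simp only [this, if_true]
  exact (hu j hj).2

theorem cont_aux {X : Type*} [NormedAddCommGroup X] (w : ℕ → Bool → X) (L : (ℕ → Bool) → X)
    (h : ∀ σ : ℕ → Bool, Tendsto (fun n => ∑ i ∈ Finset.range n, w i (σ i)) atTop (𝓝 (L σ))) :
    Continuous L := by
  have hP : ∀ n, Continuous (fun σ : ℕ → Bool => ∑ i ∈ Finset.range n, w i (σ i)) := fun n =>
    continuous_finsetSum _ fun i _ => (continuous_of_discreteTopology (f := w i)).comp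
      (continuous_apply i)
  have hu : TendstoUniformly (fun n (σ : ℕ → Bool) => ∑ i ∈ Finset.range n, w i (σ i)) L atTop := by
    rw [Metric.tendstoUniformly_iff]
    intro ε hε
    obtain ⟨N, M, τ, hτ⟩ := baire_aux
      (fun N => {σ : ℕ → Bool | ∀ n m, N ≤ n → N ≤ m →
        dist (∑ i ∈ Finset.range m, w i (σ i)) (∑ i ∈ Finset.range n, w i (σ i)) ≤ ε / 2})
      (fun N => by
        simp only [Set.ofPred_forall]
        refine isClosed_iInter fun n => isClosed_iInter fun m => isClosed_iInter fun _ =>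
          isClosed_iInter fun _ => isClosed_le ((hP m).dist (hP n)) continuous_const)
      (by
        refine Set.eq_univ_of_forall fun σ => Set.mem_iUnion.2 ?_
        obtain ⟨N, hN⟩ := Metric.cauchySeq_iff.1 (h σ).cauchySeq (ε / 2) (by positivity)
        exact ⟨N, fun n m hn hm => (hN m hm n hn).le⟩)
    have key : ∀ (σ : ℕ → Bool) (n m : ℕ), max N M ≤ n → n ≤ m →
        dist (∑ i ∈ Finset.range m, w i (σ i)) (∑ i ∈ Finset.range n, w i (σ i)) ≤ ε / 2 := by
      intro σ n m hn hm
      have h1 := hτ σ n m (by omega) (by omega)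
      rw [dist_eq_norm, ← Finset.sum_Ico_eq_sub _ hm] at h1 ⊢
      convert h1 using 2
      refine Finset.sum_congr rfl fun i hi => ?_
      have : ¬ i < M := by have := (Finset.mem_Ico.1 hi).1; omega
      simp [this]
    filter_upwards [eventually_ge_atTop (max N M)] with n hn σ
    have : dist (L σ) (∑ i ∈ Finset.range n, w i (σ i)) ≤ ε / 2 :=
      le_of_tendsto ((h σ).dist tendsto_const_nhds)
        ((eventually_ge_atTop n).mono fun m hm => key σ n m hn hm)
    linarith
  exact hu.continuous (Frequently.of_forall hP)

theorem stmt3 (x0 x1 : ℕ → X) (f0 f1 : ℕ → X →L[ℝ] ℝ) (S0 S1 : X ≃L[ℝ] X)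
    (h0 : IsASF x0 f0 S0) (h1 : IsASF x1 f1 S1)
    (hw : ∀ σ : ℕ → Bool, ∃ S : X ≃L[ℝ] X, IsASF (weave x0 x1 σ) (weave f0 f1 σ) S) :
    ∃ C : ℝ, 1 ≤ C ∧ ∀ (σ : ℕ → Bool) (S : X ≃L[ℝ] X),
      IsASF (weave x0 x1 σ) (weave f0 f1 σ) S →
        ‖(S : X →L[ℝ] X)‖ ≤ C ∧ ‖(S.symm : X →L[ℝ] X)‖ ≤ C := by
  choose S hS using hw
  let W : ℕ → Bool → X →L[ℝ] X := fun j b =>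
    (if b then f1 j else f0 j).smulRight (if b then x1 j else x0 j)
  have hS' : ∀ σ v, Tendsto (fun n => ∑ i ∈ Finset.range n, W i (σ i) v) atTop (𝓝 (S σ v)) :=
    fun σ v => hS σ v
  have hcont : ∀ v, Continuous fun σ => S σ v := fun v =>
    cont_aux (fun i b => W i b v) _ (fun σ => hS' σ v)
  obtain ⟨C1, hC1⟩ := banach_steinhaus (g := fun σ => (S σ : X →L[ℝ] X)) (fun v => by
    obtain ⟨C, hC⟩ := isCompact_univ.exists_bound_of_continuousOn (hcont v).continuousOn
    exact ⟨C, fun σ => hC σ trivial⟩)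
  have hlow : ∃ n : ℕ, ∀ σ v, ‖v‖ = 1 → 1 ≤ n * ‖S σ v‖ := by
    obtain ⟨k, M, τ, hτ⟩ := baire_aux (fun k => {σ | ∀ v, ‖v‖ ≤ k * ‖S σ v‖})
      (fun k => by
        simp only [Set.ofPred_forall]
        exact isClosed_iInter fun v => isClosed_le continuous_const
          (continuous_const.mul (hcont v).norm))
      (by
        refine Set.eq_univ_of_forall fun σ => Set.mem_iUnion.2 ?_
        obtain ⟨k, hk⟩ := exists_nat_ge ‖((S σ).symm : X →L[ℝ] X)‖
        refine ⟨k, fun v => ?_⟩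
        have := ((S σ).symm : X →L[ℝ] X).le_of_opNorm_le hk (S σ v)
        simpa using this)
    let φ : (ℕ → Bool) → ℕ → Bool := fun σ j => if j < M then τ j else σ j
    have hφ : Continuous φ := continuous_pi fun j => by
      by_cases hj : j < M
      · simp only [φ, hj, if_true]; exact continuous_const
      · simp only [φ, hj, if_false]; exact continuous_apply j
    have hτ' : ∀ σ v, ‖v‖ ≤ k * ‖S (φ σ) v‖ := fun σ => hτ σ
    let F : (ℕ → Bool) → X →L[ℝ] X := fun σ => ∑ j ∈ Finset.range M, (W j (σ j) - W j (τ j))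
    have hF : ∀ σ v, S σ v = S (φ σ) v + F σ v := by
      intro σ v
      have ht : Tendsto (fun n => ∑ i ∈ Finset.range n, W i (σ i) v) atTop
          (𝓝 (S (φ σ) v + F σ v)) := by
        refine ((hS' (φ σ) v).add_const (F σ v)).congr' ?_
        filter_upwards [eventually_ge_atTop M] with n hn
        simp only [F, ContinuousLinearMap.sum_apply, sub_apply]
        rw [← Finset.sum_range_add_sum_Ico _ hn, ← Finset.sum_range_add_sum_Ico _ hn]
        have e1 : ∑ i ∈ Finset.range M, W i (φ σ i) v = ∑ i ∈ Finset.range M, W i (τ i) v :=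
          Finset.sum_congr rfl fun i hi => by simp [φ, Finset.mem_range.1 hi]
        have e2 : ∑ i ∈ Finset.Ico M n, W i (φ σ i) v = ∑ i ∈ Finset.Ico M n, W i (σ i) v :=
          Finset.sum_congr rfl fun i hi => by
            simp [φ, not_lt.2 (Finset.mem_Ico.1 hi).1]
        rw [e1, e2, Finset.sum_sub_distrib]
        abel
      exact tendsto_nhds_unique (hS' σ v) ht
    have hWc : ∀ j b, IsCompactOperator (W j b) := by
      intro j b
      have : IsCompactOperator ⇑(if b then f1 j else f0 j : X →L[ℝ] ℝ) :=
        isCompactOperator_of_locallyCompactSpace_dom (if b then f1 j else f0 j : X →L[ℝ] ℝ)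
      exact this.clm_comp (ContinuousLinearMap.toSpanSingleton ℝ (if b then x1 j else x0 j))
    have hFc : ∀ σ, IsCompactOperator (F σ) := fun σ =>
      Submodule.sum_mem (compactOperator (RingHom.id ℝ) X X)
        fun j _ => (hWc j (σ j)).sub (hWc j (τ j))
    by_contra! hcon
    choose s v hv1 hv using hcon
    have hle : (hyperfilter ℕ : Filter ℕ) ≤ atTop := Nat.hyperfilter_le_atTop
    obtain ⟨σ, -, hσ⟩ := isCompact_univ.ultrafilter_le_nhds ((hyperfilter ℕ).map s) (by simp)
    have hσ : Tendsto s (hyperfilter ℕ) (𝓝 σ) := hσ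
    obtain ⟨K, hK, hKs⟩ := (hFc σ).image_closedBall_subset_compact 1
    obtain ⟨y, -, hy⟩ := hK.ultrafilter_le_nhds ((hyperfilter ℕ).map fun n => F σ (v n)) (by
      rw [le_principal_iff]
      refine Filter.mem_map.2 (Filter.univ_mem' fun n => hKs ⟨v n, ?_, rfl⟩)
      simp [hv1])
    have hy : Tendsto (fun n => F σ (v n)) (hyperfilter ℕ) (𝓝 y) := hy
    have hFe : ∀ᶠ n in (hyperfilter ℕ : Filter ℕ), F (s n) = F σ := by
      have : ∀ᶠ n in (hyperfilter ℕ : Filter ℕ), ∀ j ∈ Finset.range M, s n j = σ j := by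
        rw [Filter.eventually_all_finset]
        intro j _
        have := (tendsto_pi_nhds.1 hσ) j
        rw [nhds_discrete, tendsto_pure] at this
        exact this
      filter_upwards [this] with n hn
      exact Finset.sum_congr rfl fun j hj => by rw [hn j hj]
    have hS0 : Tendsto (fun n => S (s n) (v n)) (hyperfilter ℕ) (𝓝 0) := by
      refine squeeze_zero_norm' ?_ ((tendsto_inv_atTop_nhds_zero_nat (𝕜 := ℝ)).mono_left hle)
      filter_upwards [hle (eventually_gt_atTop 0)] with n hn
      have hn' : (0 : ℝ) < n := Nat.cast_pos.2 hn
      rw [← one_div, le_div_iff₀ hn', mul_comm]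
      exact (hv n).le
    have hR : Tendsto (fun n => S (φ (s n)) (v n)) (hyperfilter ℕ) (𝓝 (-y)) := by
      have := hS0.sub hy
      rw [zero_sub] at this
      refine this.congr' ?_
      filter_upwards [hFe] with n hn
      rw [hF (s n), hn, add_sub_cancel_right]
    set z := (S (φ σ)).symm (-y) with hz
    have hRz : Tendsto (fun n => S (φ (s n)) z) (hyperfilter ℕ) (𝓝 (-y)) := by
      have := (((hcont z).comp hφ).tendsto σ).comp hσ
      simpa [hz, Function.comp_def] using this
    have hvz : Tendsto v (hyperfilter ℕ) (𝓝 z) := by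
      rw [tendsto_iff_norm_sub_tendsto_zero]
      have h3 := ((hR.sub hRz).norm).const_mul (k : ℝ)
      rw [sub_self, norm_zero, mul_zero] at h3
      refine squeeze_zero (fun _ => norm_nonneg _) (fun n => ?_) h3
      rw [← map_sub]
      exact hτ' _ _
    have hz1 : ‖z‖ = 1 := tendsto_nhds_unique hvz.norm (by simp only [hv1]; exact tendsto_const_nhds)
    have hFz : F σ z = y := tendsto_nhds_unique (((F σ).continuous.tendsto z).comp hvz) hy
    have : S σ z = 0 := by
      rw [hF, hFz, hz]; simp
    have : z = 0 := by simpa using this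
    rw [this] at hz1
    simp at hz1
  obtain ⟨n, hn⟩ := hlow
  refine ⟨max 1 (max C1 n), le_max_left _ _, fun σ S' hS'' => ?_⟩
  have hE : S' = S σ := by
    ext v
    exact tendsto_nhds_unique (hS'' v) (hS σ v)
  subst hE
  refine ⟨(hC1 σ).trans (by simp), ?_⟩
  refine le_trans (b := (n : ℝ)) ?_ (by simp)
  refine ContinuousLinearMap.opNorm_le_bound _ (Nat.cast_nonneg n) fun u => ?_
  set v := (S σ).symm u with hv
  have hu : u = S σ v := by simp [hv]
  change ‖v‖ ≤ n * ‖u‖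
  rw [hu]
  by_cases hv0 : v = 0
  · simp [hv0]
  have hp : 0 < ‖v‖ := norm_pos_iff.2 hv0
  have := hn σ (‖v‖⁻¹ • v) (by rw [norm_smul, norm_inv, norm_norm, inv_mul_cancel₀ hp.ne'])
  rw [map_smul, norm_smul, norm_inv, norm_norm] at this
  field_simp at this
  exact this
end

section
/- Let (x⁰_j, f⁰_j)_{j∈ℕ} and (x¹_j, f¹_j)_{j∈ℕ} be two approximate Schauder frames for a Banach space X. If for every σ : ℕ → {0,1} the weaving (x^{σ(j)}_j, f^{σ(j)}_j)_{j∈ℕ} is an unconditional approximate Schauder frame for X, then there exists a constant D ≥ 1 such that every weaving is a D-suppression unconditional approximate Schauder frame. -/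
open Filter Topology

variable {X : Type*} [NormedAddCommGroup X] [NormedSpace ℝ X] [CompleteSpace X]

/-- `(x, f)` is an unconditional approximate Schauder frame for `X` with frame
operator `S`: the series `∑ f i v • x i` converges unconditionally to `S v`. -/
def IsUncondASF (x : ℕ → X) (f : ℕ → X →L[ℝ] ℝ) (S : X ≃L[ℝ] X) : Prop :=
  ∀ v : X, HasSum (fun i => f i v • x i) (S v)

/-- `(x, f)` with frame operator `S` is `K`-suppression unconditional. -/
def IsSuppUncondASF (x : ℕ → X) (f : ℕ → X →L[ℝ] ℝ) (S : X ≃L[ℝ] X) (K : ℝ) : Prop :=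
  ∀ (v : X) (Γ : Set ℕ), ‖∑' i : Γ, f (i : ℕ) v • x (i : ℕ)‖ ≤ K * ‖S v‖

lemma aux_tail {E : Type*} [NormedAddCommGroup E] {g : ℕ → E}
    (hg : Summable g) (ε : ℝ) (hε : 0 < ε) :
    ∃ s : Finset ℕ, ∀ t : Finset ℕ, Disjoint t s → ‖∑ i ∈ t, g i‖ < ε := by
  have := hg.vanishing (Metric.ball_mem_nhds (0 : E) hε)
  obtain ⟨s, hs⟩ := this
  exact ⟨s, fun t ht => by simpa using hs t ht⟩

lemma aux_cont {E : Type*} [NormedAddCommGroup E] [CompleteSpace E] {g : ℕ → E}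
    (hg : Summable g) (b : Bool) :
    Continuous (fun y : ℕ → Bool => ∑' i, if y i = b then g i else 0) := by
  have hsum : ∀ y : ℕ → Bool, Summable (fun i => if y i = b then g i else 0) := by
    intro y
    have := hg.indicator {i | y i = b}
    refine this.congr ?_
    intro i
    simp [Set.indicator]
  apply continuous_of_uniform_approx_of_continuous
  intro U hU
  obtain ⟨ε, hε, hεU⟩ := Metric.mem_uniformity_dist.1 hU
  obtain ⟨s, hs⟩ := aux_tail hg (ε / 2) (by linarith)
  refine ⟨fun y => ∑ i ∈ s, if y i = b then g i else 0, ?_, ?_⟩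
  · refine continuous_finsetSum _ fun i _ => ?_
    exact (continuous_of_discreteTopology (f := fun c : Bool => if c = b then g i else 0)).comp
      (continuous_apply i)
  · intro y
    have h1 := ((hsum y).hasSum).sub_const (∑ i ∈ s, if y i = b then g i else 0)
    apply hεU
    rw [dist_eq_norm]
    refine lt_of_le_of_lt (b := ε / 2) ?_ (by linarith)
    refine le_of_tendsto h1.norm ?_
    filter_upwards [eventually_ge_atTop s] with t ht
    rw [← Finset.sum_sdiff (show s ⊆ t from ht), add_sub_cancel_right, ← Finset.sum_filter]
    apply (hs _ _).le
    exact Finset.disjoint_of_subset_left (Finset.filter_subset _ _) Finset.sdiff_disjoint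

lemma aux_bdd {X : Type*} [NormedAddCommGroup X] [NormedSpace ℝ X] [CompleteSpace X]
    (x : ℕ → X) (f : ℕ → X →L[ℝ] ℝ) (h : ∀ v, Summable (fun i => f i v • x i)) :
    ∃ C, 0 ≤ C ∧ ∀ (t : Finset ℕ) (v : X), ‖∑ i ∈ t, f i v • x i‖ ≤ C * ‖v‖ := by
  obtain ⟨C, hC⟩ := banach_steinhaus
    (g := fun t : Finset ℕ => ∑ i ∈ t, (f i).smulRight (x i)) (by
      intro v
      obtain ⟨s, hs⟩ := aux_tail (h v) 1 one_pos
      refine ⟨∑ i ∈ s, ‖f i v • x i‖ + 1, fun t => ?_⟩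
      simp only [sum_apply, ContinuousLinearMap.smulRight_apply]
      rw [← Finset.sum_inter_add_sum_sdiff t s]
      refine (norm_add_le _ _).trans (add_le_add ?_ (hs _ Finset.sdiff_disjoint).le)
      refine (norm_sum_le _ _).trans ?_
      exact Finset.sum_le_sum_of_subset_of_nonneg Finset.inter_subset_right
        (fun _ _ _ => norm_nonneg _))
  refine ⟨C, (norm_nonneg _).trans (hC ∅), fun t v => ?_⟩
  have := ContinuousLinearMap.le_of_opNorm_le _ (hC t) v
  simpa using this

/-- Perturbation lemma. -/
lemma aux_pert {X Y ι : Type*} [NormedAddCommGroup X] [NormedSpace ℝ X]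
    [TopologicalSpace Y] (T : Y → X ≃L[ℝ] X) (hT : ∀ v, Continuous (fun y => T y v))
    (c : ℝ) (hc : 0 < c) (hb : ∀ y v, ‖v‖ ≤ c * ‖T y v‖)
    (s : Finset ι) (a : ι → X →L[ℝ] ℝ) (p : ι → X) (y0 : Y) (Q : X ≃L[ℝ] X)
    (hQ : ∀ v, Q v = T y0 v + ∑ i ∈ s, a i v • p i) :
    ∃ c', ∀ᶠ y in 𝓝 y0, ∀ v, ‖v‖ ≤ c' * ‖T y v + ∑ i ∈ s, a i v • p i‖ := by
  obtain ⟨M, hM, hQM⟩ : ∃ M > 0, ∀ v, ‖v‖ ≤ M * ‖Q v‖ := by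
    refine ⟨‖(Q.symm : X →L[ℝ] X)‖ + 1, by positivity, fun v => ?_⟩
    have := (Q.symm : X →L[ℝ] X).le_opNorm (Q v)
    simp only [ContinuousLinearEquiv.coe_coe, ContinuousLinearEquiv.symm_apply_apply] at this
    nlinarith [norm_nonneg (Q v)]
  obtain ⟨N, hN, hTN⟩ : ∃ N > 0, ∀ v, ‖T y0 v‖ ≤ N * ‖v‖ := by
    refine ⟨‖(T y0 : X →L[ℝ] X)‖ + 1, by positivity, fun v => ?_⟩
    have := (T y0 : X →L[ℝ] X).le_opNorm v
    simp only [ContinuousLinearEquiv.coe_coe] at this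
    nlinarith [norm_nonneg v]
  let R := (T y0).symm
  have hcont : Continuous (fun y => ∑ i ∈ s, ‖a i‖ * ‖p i - T y (R (p i))‖) := by
    refine continuous_finsetSum _ fun i _ => ?_
    exact continuous_const.mul (continuous_const.sub (hT _)).norm
  have h0 : ∑ i ∈ s, ‖a i‖ * ‖p i - T y0 (R (p i))‖ = 0 := by
    simp [R]
  set δ := 1 / (2 * (M * N * c)) with hδ
  have hδ0 : 0 < δ := by positivity
  refine ⟨2 * (M * N * c), ?_⟩
  have hev : ∀ᶠ y in 𝓝 y0, ∑ i ∈ s, ‖a i‖ * ‖p i - T y (R (p i))‖ < δ :=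
    hcont.continuousAt.eventually_lt continuousAt_const (by rw [h0]; exact hδ0)
  filter_upwards [hev] with y hy v
  set F := ∑ i ∈ s, a i v • p i with hF
  have e1 : ‖F - T y (R F)‖ ≤ δ * ‖v‖ := by
    have : F - T y (R F) = ∑ i ∈ s, a i v • (p i - T y (R (p i))) := by
      simp [hF, map_sum, smul_sub]
    rw [this]
    refine (norm_sum_le _ _).trans ?_
    refine le_trans ?_ (mul_le_mul_of_nonneg_right hy.le (norm_nonneg v))
    rw [Finset.sum_mul]
    refine Finset.sum_le_sum fun i _ => ?_
    rw [norm_smul]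
    have := (a i).le_opNorm v
    calc _ ≤ (‖a i‖ * ‖v‖) * ‖p i - T y (R (p i))‖ := by gcongr
      _ = _ := by ring
  have e2 : T y v + F = T y (v + R F) + (F - T y (R F)) := by
    rw [map_add]; abel
  have e3 : Q v = T y0 (v + R F) := by
    rw [hQ, map_add]; simp [R, hF]
  have e4 : ‖v‖ ≤ M * N * c * ‖T y (v + R F)‖ := by
    calc ‖v‖ ≤ M * ‖Q v‖ := hQM v
      _ ≤ M * (N * ‖v + R F‖) := by rw [e3]; gcongr; exact hTN _
      _ ≤ M * (N * (c * ‖T y (v + R F)‖)) := by gcongr; exact hb _ _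
      _ = _ := by ring
  have e5 : ‖T y (v + R F)‖ ≤ ‖T y v + F‖ + δ * ‖v‖ := by
    have : T y (v + R F) = (T y v + F) - (F - T y (R F)) := by rw [e2]; abel
    rw [this]
    exact (norm_sub_le _ _).trans (by gcongr)
  have hK : 0 < M * N * c := by positivity
  have e6 : M * N * c * δ = 1 / 2 := by rw [hδ]; field_simp
  have e7 := mul_le_mul_of_nonneg_left e5 hK.le
  have e8 : M * N * c * (δ * ‖v‖) = 1 / 2 * ‖v‖ := by rw [← mul_assoc, e6]
  rw [mul_add, e8] at e7
  linarith

theorem stmt4 (x0 x1 : ℕ → X) (f0 f1 : ℕ → X →L[ℝ] ℝ) (S0 S1 : X ≃L[ℝ] X)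
    (h0 : IsASF x0 f0 S0) (h1 : IsASF x1 f1 S1)
    (hw : ∀ σ : ℕ → Bool, ∃ S : X ≃L[ℝ] X, IsUncondASF (weave x0 x1 σ) (weave f0 f1 σ) S) :
    ∃ D : ℝ, 1 ≤ D ∧ ∀ (σ : ℕ → Bool) (S : X ≃L[ℝ] X),
      IsUncondASF (weave x0 x1 σ) (weave f0 f1 σ) S →
        IsSuppUncondASF (weave x0 x1 σ) (weave f0 f1 σ) S D := by
  classical
  have hs0 : ∀ v, Summable (fun i => f0 i v • x0 i) := by
    obtain ⟨S, hS⟩ := hw (fun _ => false)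
    intro v
    simpa [weave] using (hS v).summable
  have hs1 : ∀ v, Summable (fun i => f1 i v • x1 i) := by
    obtain ⟨S, hS⟩ := hw (fun _ => true)
    intro v
    simpa [weave] using (hS v).summable
  choose S hS using hw
  -- the terms
  have hterm : ∀ (y : ℕ → Bool) (v : X) (i : ℕ), weave f0 f1 y i v • weave x0 x1 y i =
      (if y i = true then f1 i v • x1 i else 0) + (if y i = false then f0 i v • x0 i else 0) := by
    intro y v i
    cases h : y i <;> simp [weave, h]
  -- strong continuity
  have hcont : ∀ v, Continuous (fun y => S y v) := by
    intro v
    have := (aux_cont (hs1 v) true).add (aux_cont (hs0 v) false)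
    refine this.congr fun y => ?_
    have a1 : Summable (fun i => if y i = true then f1 i v • x1 i else 0) :=
      ((hs1 v).indicator {i | y i = true}).congr fun i => by simp [Set.indicator]
    have a0 : Summable (fun i => if y i = false then f0 i v • x0 i else 0) :=
      ((hs0 v).indicator {i | y i = false}).congr fun i => by simp [Set.indicator]
    rw [← (hS y v).tsum_eq, Pi.add_apply, ← a1.tsum_add a0]
    exact tsum_congr fun i => (hterm y v i).symm
  -- Baire
  obtain ⟨c, hc, I, τ, hI⟩ : ∃ c : ℝ, 0 < c ∧ ∃ (I : Finset ℕ) (τ : ℕ → Bool),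
      ∀ y : ℕ → Bool, (∀ i ∈ I, y i = τ i) → ∀ v, ‖v‖ ≤ c * ‖S y v‖ := by
    have hne := nonempty_interior_of_iUnion_of_closed
      (f := fun n : ℕ => {y : ℕ → Bool | ∀ v, ‖v‖ ≤ ((n : ℝ) + 1) * ‖S y v‖}) (by
        intro n
        simp only [Set.ofPred_forall]
        exact isClosed_iInter fun v =>
          isClosed_le continuous_const (continuous_const.mul (hcont v).norm)) (by
        rw [Set.eq_univ_iff_forall]
        intro y
        obtain ⟨n, hn⟩ := exists_nat_ge ‖((S y).symm : X →L[ℝ] X)‖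
        refine Set.mem_iUnion.2 ⟨n, fun v => ?_⟩
        have := ((S y).symm : X →L[ℝ] X).le_opNorm (S y v)
        simp only [ContinuousLinearEquiv.coe_coe, ContinuousLinearEquiv.symm_apply_apply] at this
        nlinarith [norm_nonneg (S y v)])
    obtain ⟨n, τ, hτ⟩ := hne
    obtain ⟨I, u, hu, hsub⟩ := isOpen_pi_iff.1 isOpen_interior τ hτ
    refine ⟨n + 1, by positivity, I, τ, fun y hy => ?_⟩
    have : y ∈ (I : Set ℕ).pi u := by
      intro i hi
      rw [hy i hi]
      exact (hu i hi).2
    exact interior_subset (hsub this)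
  -- local bounds
  have hloc : ∀ σ : ℕ → Bool, ∃ c', ∀ᶠ y in 𝓝 σ, ∀ v, ‖v‖ ≤ c' * ‖S y v‖ := by
    intro σ
    let m : (ℕ → Bool) → (ℕ → Bool) := fun y i => if i ∈ I then τ i else y i
    have hm : Continuous m := by
      refine continuous_pi fun i => ?_
      by_cases hi : i ∈ I
      · simp only [m, hi, if_true]; exact continuous_const
      · simp only [m, hi, if_false]; exact continuous_apply i
    have hrel : ∀ y : ℕ → Bool, (∀ i ∈ I, y i = σ i) → ∀ v, S y v = S (m y) v +
        ∑ i ∈ I.disjSum I, (Sum.elim (weave f0 f1 σ) (fun i => - weave f0 f1 τ i) i) v •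
          (Sum.elim (weave x0 x1 σ) (weave x0 x1 τ) i) := by
      intro y hy v
      have d := (hS y v).sub (hS (m y) v)
      have d' := hasSum_sum_of_ne_finset_zero (L := SummationFilter.unconditional ℕ) (s := I)
        (f := fun i => weave f0 f1 y i v • weave x0 x1 y i -
          weave f0 f1 (m y) i v • weave x0 x1 (m y) i) (by
          intro i hi
          simp [weave, m, hi])
      have e := d.unique d'
      rw [Finset.sum_disjSum, ← Finset.sum_add_distrib]
      rw [← sub_eq_iff_eq_add', e]
      refine Finset.sum_congr rfl fun i hi => ?_
      cases hτ : τ i <;> simp [weave, m, hi, hy i hi, sub_eq_add_neg, hτ]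
    obtain ⟨c', hc'⟩ := aux_pert (fun y => S (m y)) (fun v => (hcont v).comp hm) c hc
      (fun y v => hI (m y) (fun i hi => by simp [m, hi]) v) (I.disjSum I) _ _ σ (S σ)
      (hrel σ (fun _ _ => rfl))
    refine ⟨c', ?_⟩
    have hnear : ∀ᶠ y in 𝓝 σ, ∀ i ∈ I, y i = σ i := by
      rw [Filter.eventually_all_finset]
      intro i _
      have hca : Tendsto (fun y : ℕ → Bool => y i) (𝓝 σ) (𝓝 (σ i)) :=
        (continuous_apply i).tendsto σ
      rw [nhds_discrete Bool] at hca
      exact hca (show {b | b = σ i} ∈ pure (σ i) from rfl)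
    filter_upwards [hc', hnear] with y hy hy' v
    rw [hrel y hy' v]
    exact hy v
  -- global lower bound
  obtain ⟨c, hc⟩ : ∃ c : ℝ, ∀ y ∈ (Set.univ : Set (ℕ → Bool)), ∀ v, ‖v‖ ≤ c * ‖S y v‖ := by
    refine isCompact_univ.induction_on
      (p := fun s : Set (ℕ → Bool) => ∃ c : ℝ, ∀ y ∈ s, ∀ v, ‖v‖ ≤ c * ‖S y v‖) ?_ ?_ ?_ ?_
    · exact ⟨0, by simp⟩
    · rintro s t hst ⟨c, hc⟩
      exact ⟨c, fun y hy => hc y (hst hy)⟩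
    · rintro s t ⟨c, hc⟩ ⟨d, hd⟩
      refine ⟨max c d, ?_⟩
      rintro y (hy | hy) v
      · exact (hc y hy v).trans (by gcongr; exact le_max_left _ _)
      · exact (hd y hy v).trans (by gcongr; exact le_max_right _ _)
    · intro σ _
      obtain ⟨c', hc'⟩ := hloc σ
      exact ⟨_, mem_nhdsWithin_of_mem_nhds hc', c', fun y hy => hy⟩
  -- upper bounds
  obtain ⟨C0, hC0, hb0⟩ := aux_bdd x0 f0 hs0
  obtain ⟨C1, hC1, hb1⟩ := aux_bdd x1 f1 hs1
  refine ⟨max 1 ((C1 + C0) * c), le_max_left _ _, fun σ S' hS' v Γ => ?_⟩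
  have hSS : S' v = S σ v := (hS' v).unique (hS σ v)
  have hfin : ∀ t : Finset ℕ, ‖∑ i ∈ t, weave f0 f1 σ i v • weave x0 x1 σ i‖ ≤
      (C1 + C0) * ‖v‖ := by
    intro t
    simp only [hterm]
    rw [Finset.sum_add_distrib, ← Finset.sum_filter, ← Finset.sum_filter, add_mul]
    exact (norm_add_le _ _).trans (add_le_add (hb1 _ _) (hb0 _ _))
  have hup : ‖∑' i : Γ, weave f0 f1 σ (i : ℕ) v • weave x0 x1 σ (i : ℕ)‖ ≤ (C1 + C0) * ‖v‖ := by
    have hsm : Summable (fun i : Γ => weave f0 f1 σ (i : ℕ) v • weave x0 x1 σ (i : ℕ)) :=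
      (hS σ v).summable.subtype Γ
    refine le_of_tendsto hsm.hasSum.norm (Eventually.of_forall fun t => ?_)
    have := hfin (t.map (Function.Embedding.subtype _))
    rwa [Finset.sum_map] at this
  rw [hSS]
  calc _ ≤ (C1 + C0) * ‖v‖ := hup
    _ ≤ (C1 + C0) * (c * ‖S σ v‖) := by gcongr; exact hc σ trivial v
    _ = (C1 + C0) * c * ‖S σ v‖ := by ring
    _ ≤ _ := by gcongr; exact le_max_right _ _
end

section
/- Let (x⁰_i)_{i∈ℕ} and (x¹_i)_{i∈ℕ} be two basic sequences in a Banach space X. If for every σ : ℕ → {0,1} the weaving (x^{σ(i)}_i)_{i∈ℕ} is an unconditional basic sequence, then there is a uniform constant D ≥ 1 such that for every σ : ℕ → {0,1} the weaving (x^{σ(i)}_i)_{i∈ℕ} is a D-suppression unconditional basic sequence. -/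
open Filter Topology

variable {X : Type*} [NormedAddCommGroup X] [NormedSpace ℝ X] [CompleteSpace X]

/-- A sequence of nonzero vectors is `C`-basic. -/
def IsBasicWith (x : ℕ → X) (C : ℝ) : Prop :=
  (∀ j, x j ≠ 0) ∧ ∀ (a : ℕ → ℝ) (n N : ℕ), n ≤ N →
    ‖∑ j ∈ Finset.range n, a j • x j‖ ≤ C * ‖∑ j ∈ Finset.range N, a j • x j‖

/-- A basic sequence: `C`-basic for some `C ≥ 1`. -/
def IsBasicSeq (x : ℕ → X) : Prop :=
  ∃ C : ℝ, 1 ≤ C ∧ IsBasicWith x C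

/-- A sequence of nonzero vectors is a `D`-suppression unconditional basic sequence. -/
def IsSuppUncondBasicWith (x : ℕ → X) (D : ℝ) : Prop :=
  (∀ j, x j ≠ 0) ∧ ∀ (a : ℕ → ℝ) (N : ℕ) (E : Finset ℕ), E ⊆ Finset.range N →
    ‖∑ j ∈ E, a j • x j‖ ≤ D * ‖∑ j ∈ Finset.range N, a j • x j‖

/-- An unconditional basic sequence: `D`-suppression unconditional for some `D ≥ 1`. -/
def IsUncondBasicSeq (x : ℕ → X) : Prop :=
  ∃ D : ℝ, 1 ≤ D ∧ IsSuppUncondBasicWith x D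

def Adm (x0 x1 : ℕ → X) (y : ℕ → X) : Prop :=
  ∀ i, (∃ a : ℝ, y i = a • x0 i) ∨ (∃ a : ℝ, y i = a • x1 i)

def UB (x0 x1 : ℕ → X) (n : ℕ) (D : ℝ) : Prop :=
  ∀ y, Adm x0 x1 y → ∀ E F : Finset ℕ, E ⊆ F → (∀ i ∈ F, n ≤ i) →
    ‖∑ i ∈ E, y i‖ ≤ D * ‖∑ i ∈ F, y i‖

lemma adm_rep {x0 x1 y : ℕ → X} (hy : Adm x0 x1 y) :
    ∃ (σ : ℕ → Bool) (a : ℕ → ℝ), ∀ i, y i = a i • weave x0 x1 σ i := by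
  have : ∀ i, ∃ (b : Bool) (a : ℝ), y i = a • (if b then x1 i else x0 i) := by
    intro i
    rcases hy i with ⟨a, h⟩ | ⟨a, h⟩
    · exact ⟨false, a, by simpa using h⟩
    · exact ⟨true, a, by simpa using h⟩
  choose σ a h using this
  exact ⟨σ, a, h⟩

lemma adm_smul {x0 x1 y : ℕ → X} (hy : Adm x0 x1 y) (c : ℕ → ℝ) :
    Adm x0 x1 (fun i => c i • y i) := by
  intro i
  rcases hy i with ⟨a, h⟩ | ⟨a, h⟩
  · exact Or.inl ⟨c i * a, by simp [h, mul_smul]⟩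
  · exact Or.inr ⟨c i * a, by simp [h, mul_smul]⟩

lemma adm_ite {x0 x1 y z : ℕ → X} (hy : Adm x0 x1 y) (hz : Adm x0 x1 z) (p : ℕ → Prop)
    [DecidablePred p] : Adm x0 x1 (fun i => if p i then y i else z i) := by
  intro i
  by_cases h : p i
  · simpa [h] using hy i
  · simpa [h] using hz i

lemma supp_finset {x : ℕ → X} {D : ℝ} (h : IsSuppUncondBasicWith x D) (c : ℕ → ℝ)
    (E F : Finset ℕ) (hEF : E ⊆ F) :
    ‖∑ i ∈ E, c i • x i‖ ≤ D * ‖∑ i ∈ F, c i • x i‖ := by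
  classical
  obtain ⟨N, hN⟩ := F.exists_nat_subset_range
  have := h.2 (fun i => if i ∈ F then c i else 0) N E (hEF.trans hN)
  have e1 : ∑ i ∈ E, (if i ∈ F then c i else 0) • x i = ∑ i ∈ E, c i • x i :=
    Finset.sum_congr rfl fun i hi => by simp [hEF hi]
  have e2 : ∑ i ∈ Finset.range N, (if i ∈ F then c i else 0) • x i = ∑ i ∈ F, c i • x i := by
    rw [← Finset.sum_subset hN]
    · exact Finset.sum_congr rfl fun i hi => by simp [hi]
    · intro i _ hi; simp [hi]
  rwa [e1, e2] at this

lemma adm_const {x0 x1 y : ℕ → X} (hw : ∀ σ : ℕ → Bool, IsUncondBasicSeq (weave x0 x1 σ))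
    (hy : Adm x0 x1 y) : ∃ C : ℝ, 1 ≤ C ∧ ∀ (c : ℕ → ℝ) (E F : Finset ℕ), E ⊆ F →
      ‖∑ i ∈ E, c i • y i‖ ≤ C * ‖∑ i ∈ F, c i • y i‖ := by
  obtain ⟨σ, a, h⟩ := adm_rep hy
  obtain ⟨C, hC, hs⟩ := hw σ
  refine ⟨C, hC, fun c E F hEF => ?_⟩
  have := supp_finset hs (fun i => c i * a i) E F hEF
  simpa [h, mul_smul] using this

lemma baire_step {x0 x1 : ℕ → X} (hw : ∀ σ : ℕ → Bool, IsUncondBasicSeq (weave x0 x1 σ)) :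
    ∃ (n : ℕ) (D : ℝ), 1 ≤ D ∧ UB x0 x1 n D := by
  classical
  let S : ℕ → Set (ℕ → Bool) := fun k => {σ | ∀ (a : ℕ → ℝ) (N : ℕ) (E : Finset ℕ),
    E ⊆ Finset.range N → ‖∑ j ∈ E, a j • weave x0 x1 σ j‖ ≤
      ((k : ℝ) + 1) * ‖∑ j ∈ Finset.range N, a j • weave x0 x1 σ j‖}
  have hcont : ∀ j, Continuous (fun σ : ℕ → Bool => weave x0 x1 σ j) := by
    intro j
    exact (continuous_of_discreteTopology (f := fun b : Bool => if b then x1 j else x0 j)).comp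
      (continuous_apply j)
  have hclosed : ∀ k, IsClosed (S k) := by
    intro k
    simp only [S, Set.setOf_forall]
    refine isClosed_iInter fun a => isClosed_iInter fun N => isClosed_iInter fun E =>
      isClosed_iInter fun _ => ?_
    apply isClosed_le
    · exact (continuous_finsetSum _ fun j _ => (hcont j).const_smul (a j)).norm
    · exact continuous_const.mul
        (continuous_finsetSum _ fun j _ => (hcont j).const_smul (a j)).norm
  have hU : ⋃ k, S k = Set.univ := by
    rw [Set.eq_univ_iff_forall]
    intro σ
    obtain ⟨D, hD, h⟩ := hw σ
    obtain ⟨k, hk⟩ := exists_nat_ge D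
    rw [Set.mem_iUnion]
    refine ⟨k, fun a N E hE => (h.2 a N E hE).trans ?_⟩
    gcongr
    linarith
  obtain ⟨k, σ0, hσ0⟩ := nonempty_interior_of_iUnion_of_closed hclosed hU
  obtain ⟨I, u, hu, hsub⟩ := isOpen_pi_iff.1 isOpen_interior σ0 hσ0
  obtain ⟨n, hn⟩ := I.exists_nat_subset_range
  refine ⟨n, k + 1, by linarith [(Nat.cast_nonneg k : (0:ℝ) ≤ k)], ?_⟩
  intro y hy E F hEF hF
  obtain ⟨σ, a, h⟩ := adm_rep hy
  let τ : ℕ → Bool := fun i => if i < n then σ0 i else σ i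
  have hτ : τ ∈ S k := by
    apply interior_subset
    apply hsub
    intro i hi
    have : i < n := by simpa using hn hi
    simpa [τ, this] using (hu i hi).2
  have hτ' : IsSuppUncondBasicWith (weave x0 x1 τ) (k + 1) := by
    obtain ⟨_, _, h⟩ := hw τ
    exact ⟨h.1, hτ⟩
  have key := supp_finset hτ' a E F hEF
  have e : ∀ i ∈ F, a i • weave x0 x1 τ i = y i := by
    intro i hi
    have : ¬ i < n := not_lt.2 (hF i hi)
    rw [h i]; simp [weave, τ, this]
  rwa [Finset.sum_congr rfl e, Finset.sum_congr rfl fun i hi => e i (hEF hi)] at key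

/-- gliding hump contradiction -/
lemma hump {x0 x1 : ℕ → X} {p : ℕ} {D : ℝ} (hD : 1 ≤ D) (hub : UB x0 x1 p D)
    {y : ℕ → X} (hy : Adm x0 x1 y) {e : X} (he : e ≠ 0) {C : ℝ} (hC : 1 ≤ C)
    (hCe : ∀ (t : ℝ) (c : ℕ → ℝ) (M : ℕ),
      ‖t • e‖ ≤ C * ‖t • e - ∑ i ∈ Finset.Ico p M, c i • y i‖)
    (hstep : ∀ m, p ≤ m → ∀ ε > 0, ∃ z, Adm x0 x1 z ∧ ∃ m', m ≤ m' ∧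
      ‖∑ i ∈ Finset.Ico m m', z i + ∑ i ∈ Finset.Ico p m, y i - e‖ ≤ ε) : False := by
  have hepos : 0 < ‖e‖ := norm_pos_iff.2 he
  -- boundedness
  have hB : ∀ m, p ≤ m → ‖∑ i ∈ Finset.Ico p m, y i‖ ≤ D * (‖e‖ + 1) := by
    intro m hm
    obtain ⟨z, hz, m', hm', hle⟩ := hstep m hm 1 one_pos
    have := hub _ (adm_ite hy hz (fun i => i < m)) (Finset.Ico p m) (Finset.Ico p m')
      (Finset.Ico_subset_Ico_right hm') (fun i hi => (Finset.mem_Ico.1 hi).1)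
    rw [← Finset.sum_Ico_consecutive _ hm hm'] at this
    have e1 : ∑ i ∈ Finset.Ico p m, (if i < m then y i else z i) = ∑ i ∈ Finset.Ico p m, y i :=
      Finset.sum_congr rfl fun i hi => by simp [(Finset.mem_Ico.1 hi).2]
    have e2 : ∑ i ∈ Finset.Ico m m', (if i < m then y i else z i) = ∑ i ∈ Finset.Ico m m', z i :=
      Finset.sum_congr rfl fun i hi => by simp [(Finset.mem_Ico.1 hi).1]
    rw [e1, e2] at this
    refine this.trans ?_
    gcongr
    have h2 := norm_add_le (∑ i ∈ Finset.Ico m m', z i + ∑ i ∈ Finset.Ico p m, y i - e) e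
    rw [sub_add_cancel] at h2
    rw [add_comm (∑ i ∈ Finset.Ico p m, y i)]
    linarith
  obtain ⟨ε, hε, hε'⟩ : ∃ ε : ℝ, 0 < ε ∧ C * (2 * D + 1) * ε = ‖e‖ / 2 :=
    ⟨‖e‖ / (2 * (C * (2 * D + 1))), by positivity, by field_simp⟩
  have main : ∀ N : ℕ, ∃ (M : ℕ) (Z : ℕ → X) (E F : Finset ℕ) (c : ℕ → ℝ), p ≤ M ∧
      Adm x0 x1 Z ∧ E ⊆ Finset.Ico p M ∧ F ⊆ Finset.Ico p M ∧
      ‖∑ i ∈ E, Z i + ∑ i ∈ Finset.Ico p M, c i • y i - (N : ℝ) • e‖ ≤ N * ε ∧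
      ‖∑ i ∈ Finset.Ico p M, Z i - ∑ i ∈ F, y i‖ ≤ N * (2 * ε) := by
    intro N
    induction N with
    | zero => exact ⟨p, y, ∅, ∅, 0, le_rfl, hy, by simp, by simp, by simp, by simp⟩
    | succ N ih =>
      obtain ⟨M, Z, E, F, c, hM, hZ, hE, hF, h1, h2⟩ := ih
      obtain ⟨z, hz, m', hm', hle⟩ := hstep M hM ε hε
      obtain ⟨w, hwA, m'', hm'', hle'⟩ := hstep m' (hM.trans hm') ε hε
      have hneg : Adm x0 x1 (fun i => -w i) := by
        simpa using adm_smul hwA (fun _ => -1)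
      refine ⟨m'', fun i => if i < M then Z i else if i < m' then z i else -w i,
        E ∪ Finset.Ico M m', F ∪ Finset.Ico M m', fun i => if i < M then c i + 1 else 0,
        by omega, adm_ite hZ (adm_ite hz hneg _) _, ?_, ?_, ?_, ?_⟩
      · intro i hi
        rcases Finset.mem_union.1 hi with h | h
        · have := Finset.mem_Ico.1 (hE h); simp; omega
        · have := Finset.mem_Ico.1 h; simp; omega
      · intro i hi
        rcases Finset.mem_union.1 hi with h | h
        · have := Finset.mem_Ico.1 (hF h); simp; omega
        · have := Finset.mem_Ico.1 h; simp; omega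
      · have d : Disjoint E (Finset.Ico M m') := by
          rw [Finset.disjoint_left]; intro i hi hi'
          have := Finset.mem_Ico.1 (hE hi); have := Finset.mem_Ico.1 hi'; omega
        rw [Finset.sum_union d]
        have e1 : ∑ i ∈ E, (if i < M then Z i else if i < m' then z i else -w i)
            = ∑ i ∈ E, Z i :=
          Finset.sum_congr rfl fun i hi => by simp [(Finset.mem_Ico.1 (hE hi)).2]
        have e2 : ∑ i ∈ Finset.Ico M m', (if i < M then Z i else if i < m' then z i else -w i)
            = ∑ i ∈ Finset.Ico M m', z i :=
          Finset.sum_congr rfl fun i hi => by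
            have := Finset.mem_Ico.1 hi
            simp [this.1, this.2]
        have e3 : ∑ i ∈ Finset.Ico p m'', (if i < M then c i + 1 else 0) • y i
            = ∑ i ∈ Finset.Ico p M, c i • y i + ∑ i ∈ Finset.Ico p M, y i := by
          rw [← Finset.sum_Ico_consecutive _ hM (hm'.trans hm''), ← Finset.sum_add_distrib]
          rw [Finset.sum_eq_zero (s := Finset.Ico M m''), add_zero]
          · exact Finset.sum_congr rfl fun i hi => by
              simp [(Finset.mem_Ico.1 hi).2, add_smul]
          · intro i hi; simp [(Finset.mem_Ico.1 hi).1]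
        rw [e1, e2, e3]
        have := norm_add_le_of_le h1 hle
        push_cast
        refine le_trans (le_of_eq ?_) (this.trans (le_of_eq (by ring)))
        congr 1
        rw [add_smul, one_smul]; abel
      · have d : Disjoint F (Finset.Ico M m') := by
          rw [Finset.disjoint_left]; intro i hi hi'
          have := Finset.mem_Ico.1 (hF hi); have := Finset.mem_Ico.1 hi'; omega
        rw [Finset.sum_union d, ← Finset.sum_Ico_consecutive _ hM (hm'.trans hm''),
          ← Finset.sum_Ico_consecutive _ hm' hm'']
        have e1 : ∑ i ∈ Finset.Ico p M, (if i < M then Z i else if i < m' then z i else -w i)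
            = ∑ i ∈ Finset.Ico p M, Z i :=
          Finset.sum_congr rfl fun i hi => by simp [(Finset.mem_Ico.1 hi).2]
        have e2 : ∑ i ∈ Finset.Ico M m', (if i < M then Z i else if i < m' then z i else -w i)
            = ∑ i ∈ Finset.Ico M m', z i :=
          Finset.sum_congr rfl fun i hi => by
            have := Finset.mem_Ico.1 hi
            simp [this.1, this.2]
        have e3 : ∑ i ∈ Finset.Ico m' m'', (if i < M then Z i else if i < m' then z i else -w i)
            = - ∑ i ∈ Finset.Ico m' m'', w i := by
          rw [← Finset.sum_neg_distrib]
          exact Finset.sum_congr rfl fun i hi => by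
            have := Finset.mem_Ico.1 hi
            rw [if_neg (by omega), if_neg (by omega)]
        rw [e1, e2, e3]
        rw [← Finset.sum_Ico_consecutive _ hM hm'] at hle'
        have := norm_add_le_of_le h2 (norm_sub_le_of_le hle hle')
        push_cast
        refine le_trans (le_of_eq ?_) (this.trans (le_of_eq (by ring)))
        congr 1
        abel
  obtain ⟨N, hN⟩ := exists_nat_gt (C * (D * (D * (D * (‖e‖ + 1)))) / (‖e‖ / 2))
  rw [div_lt_iff₀ (by positivity)] at hN
  obtain ⟨M, Z, E, F, c, hM, hZ, hE, hF, h1, h2⟩ := main N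
  have hmem : ∀ i ∈ Finset.Ico p M, p ≤ i := fun i hi => (Finset.mem_Ico.1 hi).1
  have a1 := hub Z hZ E _ hE hmem
  have a2 := hub y hy F _ hF hmem
  have a3 := hB M hM
  have a4 := hCe N c M
  have a5 : ‖∑ i ∈ Finset.Ico p M, Z i‖ ≤ N * (2 * ε) + ‖∑ i ∈ F, y i‖ := by
    have := norm_add_le (∑ i ∈ Finset.Ico p M, Z i - ∑ i ∈ F, y i) (∑ i ∈ F, y i)
    rw [sub_add_cancel] at this
    linarith
  have a6 : ‖(N : ℝ) • e - ∑ i ∈ Finset.Ico p M, c i • y i‖ ≤ ‖∑ i ∈ E, Z i‖ + N * ε := by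
    have := norm_sub_le_of_le (le_refl ‖∑ i ∈ E, Z i‖) h1
    refine le_trans (le_of_eq ?_) this
    congr 1
    abel
  rw [norm_smul, Real.norm_natCast] at a4
  have b1 : ‖∑ i ∈ F, y i‖ ≤ D * (D * (‖e‖ + 1)) := a2.trans (by gcongr)
  have b2 : ‖∑ i ∈ E, Z i‖ ≤ D * (N * (2 * ε) + D * (D * (‖e‖ + 1))) :=
    a1.trans (by gcongr; linarith)
  have b3 : N * ‖e‖ ≤ C * (D * (N * (2 * ε) + D * (D * (‖e‖ + 1))) + N * ε) :=
    a4.trans (by gcongr; linarith)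
  have b4 : C * (D * (N * (2 * ε) + D * (D * (‖e‖ + 1))) + N * ε)
    = N * (C * (2 * D + 1) * ε) + C * (D * (D * (D * (‖e‖ + 1)))) := by ring
  rw [b4, hε'] at b3
  linarith

lemma sum_restrict (y : ℕ → X) (F G : Finset ℕ) (h : F ⊆ G) :
    ∑ i ∈ G, (if i ∈ F then y i else 0) = ∑ i ∈ F, y i := by
  rw [← Finset.sum_filter]
  congr 1
  ext i; simp; exact fun hi => h hi

lemma line_compact (x : X) (R : ℝ) : IsCompact {v : X | (∃ a : ℝ, v = a • x) ∧ ‖v‖ ≤ R} := by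
  have : {v : X | (∃ a : ℝ, v = a • x) ∧ ‖v‖ ≤ R}
      = Subtype.val '' (Metric.closedBall (0 : Submodule.span ℝ {x}) R) := by
    ext v
    simp only [Set.mem_setOf_eq, Set.mem_image, Metric.mem_closedBall, dist_zero_right]
    constructor
    · rintro ⟨⟨a, rfl⟩, h⟩
      exact ⟨⟨a • x, Submodule.mem_span_singleton.2 ⟨a, rfl⟩⟩, h, rfl⟩
    · rintro ⟨⟨w, hw⟩, h, rfl⟩
      obtain ⟨a, rfl⟩ := Submodule.mem_span_singleton.1 hw
      exact ⟨⟨a, rfl⟩, h⟩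
  rw [this]
  haveI : ProperSpace (Submodule.span ℝ {x}) := FiniteDimensional.proper ℝ _
  exact (isCompact_closedBall _ _).image continuous_subtype_val

lemma head_dist_pos {x0 x1 : ℕ → X} (hw : ∀ σ : ℕ → Bool, IsUncondBasicSeq (weave x0 x1 σ))
    {n : ℕ} {D : ℝ} (hD : 1 ≤ D) (hub : UB x0 x1 (n + 1) D) (h : X) (hh : h ≠ 0)
    (hx : h = x0 n ∨ h = x1 n) :
    ∃ δ > 0, ∀ y, Adm x0 x1 y → ∀ F : Finset ℕ, (∀ i ∈ F, n + 1 ≤ i) →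
      δ ≤ ‖h + ∑ i ∈ F, y i‖ := by
  classical
  by_contra hcon
  push Not at hcon
  have hk : ∀ k : ℕ, ∃ y, Adm x0 x1 y ∧ ∃ F : Finset ℕ, (∀ i ∈ F, n + 1 ≤ i) ∧
      (∀ i ∉ F, y i = 0) ∧ ‖h + ∑ i ∈ F, y i‖ < 1 / ((k : ℝ) + 1) := by
    intro k
    obtain ⟨y, hy, F, hF, hlt⟩ := hcon (1 / ((k : ℝ) + 1)) (by positivity)
    refine ⟨fun i => if i ∈ F then y i else 0, ?_, F, hF, fun i hi => by simp [hi], ?_⟩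
    · intro i
      by_cases hi : i ∈ F
      · simpa [hi] using hy i
      · exact Or.inl ⟨0, by simp [hi]⟩
    · rwa [sum_restrict y F F subset_rfl]
  choose y hy F hF hsupp hlt using hk
  let R := D * (‖h‖ + 1)
  let K : ℕ → Set X := fun i =>
    {v | (∃ a : ℝ, v = a • x0 i) ∧ ‖v‖ ≤ R} ∪ {v | (∃ a : ℝ, v = a • x1 i) ∧ ‖v‖ ≤ R}
  have hKc : IsCompact (Set.pi Set.univ K) :=
    isCompact_univ_pi fun i => (line_compact _ _).union (line_compact _ _)
  have hyK : ∀ k, y k ∈ Set.pi Set.univ K := by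
    intro k i _
    have hn : ‖y k i‖ ≤ R := by
      by_cases hi : i ∈ F k
      · have h1 := hub (y k) (hy k) {i} (F k) (by simpa using hi) (hF k)
        rw [Finset.sum_singleton] at h1
        refine h1.trans ?_
        have h2 := norm_sub_le (h + ∑ i ∈ F k, y k i) h
        rw [add_sub_cancel_left] at h2
        have h3 : 1 / ((k : ℝ) + 1) ≤ 1 := by
          rw [div_le_one (by positivity)]; linarith [(Nat.cast_nonneg k : (0:ℝ) ≤ k)]
        have := hlt k
        simp only [R]
        gcongr
        linarith
      · rw [hsupp k i hi, norm_zero]; positivity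
    rcases hy k i with ha | ha
    · exact Or.inl ⟨ha, hn⟩
    · exact Or.inr ⟨ha, hn⟩
  obtain ⟨y', hy', φ, hφ, hlim⟩ := hKc.tendsto_subseq hyK
  have hA : Adm x0 x1 y' := by
    intro i
    rcases hy' i trivial with ha | ha
    · exact Or.inl ha.1
    · exact Or.inr ha.1
  have hA2 : Adm x0 x1 (Function.update y' n h) := by
    intro i
    by_cases hi : i = n
    · subst hi
      rcases hx with rfl | rfl
      · exact Or.inl ⟨1, by simp⟩
      · exact Or.inr ⟨1, by simp⟩
    · simpa [hi] using hA i
  obtain ⟨C, hC, hCC⟩ := adm_const hw hA2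
  refine hump (e := -h) hD hub hA (neg_ne_zero.2 hh) hC ?_ ?_
  · intro t c M
    have hn : n ∉ Finset.Ico (n + 1) M := by simp
    have := hCC (fun i => if i = n then -t else - c i) {n} (insert n (Finset.Ico (n + 1) M))
      (by simp)
    rw [Finset.sum_insert hn, Finset.sum_singleton] at this
    have e1 : ∑ i ∈ Finset.Ico (n + 1) M, (if i = n then -t else - c i) •
        Function.update y' n h i = - ∑ i ∈ Finset.Ico (n + 1) M, c i • y' i := by
      rw [← Finset.sum_neg_distrib]
      refine Finset.sum_congr rfl fun i hi => ?_
      have : i ≠ n := by rintro rfl; exact hn hi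
      simp [this]
    rw [e1] at this
    simpa [sub_eq_add_neg] using this
  · intro m hm ε hε
    have hp : Tendsto (fun k => ∑ i ∈ Finset.Ico (n + 1) m, y (φ k) i) atTop
        (𝓝 (∑ i ∈ Finset.Ico (n + 1) m, y' i)) :=
      tendsto_finsetSum _ fun i _ => (tendsto_pi_nhds.1 hlim i)
    have h1 := (tendsto_iff_norm_sub_tendsto_zero.1 hp).eventually (gt_mem_nhds (half_pos hε))
    have h2 : ∀ᶠ k : ℕ in atTop, 1 / ((φ k : ℝ) + 1) < ε / 2 :=
      (tendsto_one_div_add_atTop_nhds_zero_nat.comp hφ.tendsto_atTop).eventually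
        (gt_mem_nhds (half_pos hε))
    obtain ⟨k, hk1, hk2⟩ := (h1.and h2).exists
    obtain ⟨N, hN⟩ := (F (φ k)).exists_nat_subset_range
    refine ⟨y (φ k), hy _, max m N, le_max_left _ _, ?_⟩
    have e1 : ∑ i ∈ F (φ k), y (φ k) i = ∑ i ∈ Finset.Ico (n + 1) (max m N), y (φ k) i := by
      apply Finset.sum_subset
      · intro i hi
        have := hF _ i hi
        have := Finset.mem_range.1 (hN hi)
        simp; omega
      · intro i _ hi; exact hsupp _ i hi
    have h3 := hlt (φ k)
    rw [e1, ← Finset.sum_Ico_consecutive _ hm (le_max_left m N)] at h3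
    have := norm_sub_le_of_le h3.le hk1.le
    refine le_trans (le_of_eq ?_) (this.trans (by linarith))
    congr 1
    abel

lemma ub_step {x0 x1 : ℕ → X} (hw : ∀ σ : ℕ → Bool, IsUncondBasicSeq (weave x0 x1 σ))
    (hx0 : ∀ i, x0 i ≠ 0) (hx1 : ∀ i, x1 i ≠ 0)
    {n : ℕ} {D : ℝ} (hD : 1 ≤ D) (hub : UB x0 x1 (n + 1) D) :
    ∃ D' : ℝ, 1 ≤ D' ∧ UB x0 x1 n D' := by
  classical
  have hone : ∀ h : X, h ≠ 0 → (h = x0 n ∨ h = x1 n) → ∃ K : ℝ, 0 ≤ K ∧ ∀ y, Adm x0 x1 y →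
      ∀ F : Finset ℕ, (∀ i ∈ F, n + 1 ≤ i) → ∀ a : ℝ,
        ‖a • h‖ ≤ K * ‖a • h + ∑ i ∈ F, y i‖ := by
    intro h hh hx
    obtain ⟨δ, hδ, H⟩ := head_dist_pos hw hD hub h hh hx
    refine ⟨‖h‖ / δ, by positivity, fun y hy F hF a => ?_⟩
    by_cases ha : a = 0
    · subst ha; simp; positivity
    have h1 := H _ (adm_smul hy fun _ => a⁻¹) F hF
    have e1 : a • h + ∑ i ∈ F, y i = a • (h + ∑ i ∈ F, a⁻¹ • y i) := by
      rw [smul_add, ← Finset.smul_sum, smul_smul, mul_inv_cancel₀ ha, one_smul]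
    rw [e1, norm_smul, norm_smul, div_mul_eq_mul_div, le_div_iff₀ hδ]
    have : 0 ≤ |a| * ‖h‖ := by positivity
    calc ‖a‖ * ‖h‖ * δ ≤ ‖a‖ * ‖h‖ * ‖h + ∑ i ∈ F, a⁻¹ • y i‖ := by gcongr
      _ = _ := by ring
  obtain ⟨K0, hK0, H0⟩ := hone _ (hx0 n) (Or.inl rfl)
  obtain ⟨K1, hK1, H1⟩ := hone _ (hx1 n) (Or.inr rfl)
  obtain ⟨K, hK, H⟩ : ∃ K : ℝ, 0 ≤ K ∧ ∀ y, Adm x0 x1 y →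
      ∀ F : Finset ℕ, (∀ i ∈ F, n + 1 ≤ i) → ‖y n‖ ≤ K * ‖y n + ∑ i ∈ F, y i‖ := by
    refine ⟨K0 + K1, by positivity, fun y hy F hF => ?_⟩
    rcases hy n with ⟨a, ha⟩ | ⟨a, ha⟩
    · rw [ha]; refine (H0 y hy F hF a).trans ?_
      gcongr; linarith
    · rw [ha]; refine (H1 y hy F hF a).trans ?_
      gcongr; linarith
  refine ⟨K + D * (1 + K), by nlinarith, ?_⟩
  intro y hy E F hEF hF
  have hF' : ∀ i ∈ F.erase n, n + 1 ≤ i := by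
    intro i hi
    have := hF i (Finset.mem_of_mem_erase hi)
    have := Finset.ne_of_mem_erase hi
    omega
  by_cases hn : n ∈ F
  · have h1 := H y hy _ hF'
    have h2 := hub y hy (E.erase n) (F.erase n) (Finset.erase_subset_erase n hEF) hF'
    rw [Finset.add_sum_erase F y hn] at h1
    have h3 : ‖∑ i ∈ F.erase n, y i‖ ≤ (1 + K) * ‖∑ i ∈ F, y i‖ := by
      have := norm_sub_le_of_le (le_refl ‖∑ i ∈ F, y i‖) h1
      rw [← Finset.add_sum_erase F y hn, add_sub_cancel_left, Finset.add_sum_erase F y hn] at this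
      linarith
    have h4 : ‖∑ i ∈ E, y i‖ ≤ ‖y n‖ + ‖∑ i ∈ E.erase n, y i‖ := by
      by_cases hE : n ∈ E
      · rw [← Finset.add_sum_erase E y hE]; exact norm_add_le _ _
      · rw [Finset.erase_eq_of_notMem hE]; linarith [norm_nonneg (y n)]
    have h5 : D * ‖∑ i ∈ F.erase n, y i‖ ≤ D * ((1 + K) * ‖∑ i ∈ F, y i‖) := by gcongr
    linarith
  · rw [Finset.erase_eq_of_notMem hn] at hF'
    refine (hub y hy E F hEF hF').trans ?_
    gcongr
    nlinarith

theorem stmt6 (x0 x1 : ℕ → X) (h0 : IsBasicSeq x0) (h1 : IsBasicSeq x1)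
    (hw : ∀ σ : ℕ → Bool, IsUncondBasicSeq (weave x0 x1 σ)) :
    ∃ D : ℝ, 1 ≤ D ∧ ∀ σ : ℕ → Bool, IsSuppUncondBasicWith (weave x0 x1 σ) D := by
  obtain ⟨_, _, hx0, _⟩ := h0
  obtain ⟨_, _, hx1, _⟩ := h1
  have key : ∀ n, (∃ D : ℝ, 1 ≤ D ∧ UB x0 x1 n D) → ∃ D : ℝ, 1 ≤ D ∧ UB x0 x1 0 D := by
    intro n
    induction n with
    | zero => exact id
    | succ n ih =>
      rintro ⟨D, hD, h⟩
      exact ih (ub_step hw hx0 hx1 hD h)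
  obtain ⟨n, hn⟩ := baire_step hw
  obtain ⟨D, hD, h⟩ := key n hn
  refine ⟨D, hD, fun σ => ?_⟩
  obtain ⟨_, _, hs⟩ := hw σ
  refine ⟨hs.1, fun a N E hE => ?_⟩
  refine h (fun i => a i • weave x0 x1 σ i) ?_ E _ hE (fun i _ => Nat.zero_le i)
  intro i
  by_cases hi : σ i
  · exact Or.inr ⟨a i, by simp [weave, hi]⟩
  · exact Or.inl ⟨a i, by simp [weave, hi]⟩
end

section
/- Let (x⁰_j, f⁰_j)_{j∈ℕ} and (x¹_j, f¹_j)_{j∈ℕ} be C-approximate Schauder frames for a Banach space X with frame operators S₀ and S₁ respectively, and let K ≥ 1 and D > 0. Suppose (x⁰_j, f⁰_j) is K-suppression unconditional, (x¹_j, f¹_j) is unconditional, and there exist x ∈ X and a subset A ⊆ ℕ with ‖∑_{j∈A} f¹_j(x) x¹_j‖ > D‖S₁ x‖. Then, letting σ : ℕ → {0,1} be the indicator function of A (σ(j)=1 iff j ∈ A), the weaving frame operator S_σ y = ∑_{j=1}^∞ f^{σ(j)}_j(y) x^{σ(j)}_j is well defined and satisfies ‖S_σ‖ > D C⁻¹ −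 K C; in particular (x⁰_j, f⁰_j) and (x¹_j, f¹_j) are not (D C⁻¹ − K C)-woven. -/
open Filter Topology

variable {X : Type*} [NormedAddCommGroup X] [NormedSpace ℝ X] [CompleteSpace X]

theorem stmt7 (x0 x1 : ℕ → X) (f0 f1 : ℕ → X →L[ℝ] ℝ) (S0 S1 : X ≃L[ℝ] X)
    (C K D : ℝ) (hC : 1 ≤ C) (hK : 1 ≤ K) (hD : 0 < D)
    -- `(x0, f0)` and `(x1, f1)` are `C`-approximate Schauder frames:
    (h0 : IsASF x0 f0 S0) (h1 : IsASF x1 f1 S1)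
    (hS0 : ‖(S0 : X →L[ℝ] X)‖ ≤ C) (hS0' : ‖(S0.symm : X →L[ℝ] X)‖ ≤ C)
    (hS1 : ‖(S1 : X →L[ℝ] X)‖ ≤ C) (hS1' : ‖(S1.symm : X →L[ℝ] X)‖ ≤ C)
    -- `(x0, f0)` is `K`-suppression unconditional:
    (hu0 : IsUncondASF x0 f0 S0) (hsupp0 : IsSuppUncondASF x0 f0 S0 K)
    -- `(x1, f1)` is unconditional:
    (hu1 : IsUncondASF x1 f1 S1)
    -- there are `v` and `A ⊆ ℕ` with `‖∑_{j ∈ A} f1 j (v) • x1 j‖ > D ‖S1 v‖`: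
    (v : X) (A : Set ℕ)
    (hA : D * ‖S1 v‖ < ‖∑' j : A, f1 (j : ℕ) v • x1 (j : ℕ)‖)
    -- `σ` is the indicator function of `A`:
    (σ : ℕ → Bool) (hσ : ∀ j, σ j = true ↔ j ∈ A) :
    ∃ T : X →L[ℝ] X,
      (∀ u : X, HasSum (fun j => weave f0 f1 σ j u • weave x0 x1 σ j) (T u)) ∧
      D * C⁻¹ - K * C < ‖T‖ := by
  classical
  have a1 : ∀ u, HasSum (fun j : A => f1 (j : ℕ) u • x1 (j : ℕ))
      (∑' j : A, f1 (j : ℕ) u • x1 (j : ℕ)) := fun u =>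
    ((hu1 u).summable.subtype A).hasSum
  have a0 : ∀ u, HasSum (fun j : (Aᶜ : Set ℕ) => f0 (j : ℕ) u • x0 (j : ℕ))
      (∑' j : (Aᶜ : Set ℕ), f0 (j : ℕ) u • x0 (j : ℕ)) := fun u =>
    ((hu0 u).summable.subtype Aᶜ).hasSum
  have hs : ∀ u, HasSum (fun j => weave f0 f1 σ j u • weave x0 x1 σ j)
      ((∑' j : A, f1 (j : ℕ) u • x1 (j : ℕ)) +
        ∑' j : (Aᶜ : Set ℕ), f0 (j : ℕ) u • x0 (j : ℕ)) := by
    intro u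
    refine HasSum.add_compl (s := A) ?_ ?_
    · convert a1 u using 1
      funext j
      have := (hσ j).2 j.2
      simp [weave, this]
    · convert a0 u using 1
      funext j
      have : ¬ σ j = true := fun h => j.2 ((hσ j).1 h)
      simp [weave, this]
  let g : ℕ → X →L[ℝ] X := fun n =>
    ∑ i ∈ Finset.range n, (weave f0 f1 σ i).smulRight (weave x0 x1 σ i)
  have hg : Tendsto (fun n u => g n u) atTop (𝓝 (fun u =>
      ((∑' j : A, f1 (j : ℕ) u • x1 (j : ℕ)) +
        ∑' j : (Aᶜ : Set ℕ), f0 (j : ℕ) u • x0 (j : ℕ)))) := by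
    rw [tendsto_pi_nhds]
    intro u
    simpa [g, ContinuousLinearMap.sum_apply] using (hs u).tendsto_sum_nat
  refine ⟨continuousLinearMapOfTendsto g hg, hs, ?_⟩
  set T := continuousLinearMapOfTendsto g hg
  have hT : T v = (∑' j : A, f1 (j : ℕ) v • x1 (j : ℕ)) +
        ∑' j : (Aᶜ : Set ℕ), f0 (j : ℕ) v • x0 (j : ℕ) := rfl
  have hv : 0 < ‖v‖ := by
    rw [norm_pos_iff]
    rintro rfl
    simp at hA
  have hCpos : 0 < C := by linarith
  have e1 : C⁻¹ * ‖v‖ ≤ ‖S1 v‖ := by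
    rw [inv_mul_le_iff₀ hCpos]
    have := (S1.symm : X →L[ℝ] X).le_of_opNorm_le hS1' (S1 v)
    simpa using this
  have e0 : ‖S0 v‖ ≤ C * ‖v‖ := (S0 : X →L[ℝ] X).le_of_opNorm_le hS0 v
  have e2 := hsupp0 v Aᶜ
  have e3 := norm_sub_le (T v) (∑' j : (Aᶜ : Set ℕ), f0 (j : ℕ) v • x0 (j : ℕ))
  rw [hT, add_sub_cancel_right, ← hT] at e3
  have e4 := T.le_opNorm v
  have e5 : D * (C⁻¹ * ‖v‖) ≤ D * ‖S1 v‖ := by gcongr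
  have e6 : K * ‖S0 v‖ ≤ K * (C * ‖v‖) := by gcongr
  refine lt_of_mul_lt_mul_right ?_ hv.le
  nlinarith
end

section
/- Let (x⁰_i)_{i∈ℕ} and (x¹_i)_{i∈ℕ} be two semi-normalized unconditional Schauder bases for a Banach space X, i.e., there are constants 0 < a ≤ b with a ≤ ‖x⁰_i‖ ≤ b and a ≤ ‖x¹_i‖ ≤ b for all i. If for every σ : ℕ → {0,1} the weaving (x^{σ(i)}_i)_{i∈ℕ} is a basic sequence, then (x⁰_i) and (x¹_i) are equivalent: there exist constants c, C > 0 such that c‖∑_j a_j x⁰_j‖ ≤ ‖∑_j a_j x¹_j‖ ≤ C‖∑_j a_j x⁰_j‖ for every finitely supported scalar sequence (a_j). -/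
open Filter Topology

variable {X : Type*} [NormedAddCommGroup X] [NormedSpace ℝ X] [CompleteSpace X]

/-- `x` is a Schauder basis for `X`: every vector has a unique expansion. -/
def IsSchauderBasis (x : ℕ → X) : Prop :=
  ∀ v : X, ∃! a : ℕ → ℝ,
    Tendsto (fun N => ∑ j ∈ Finset.range N, a j • x j) atTop (𝓝 v)

/-- `x` is an unconditional Schauder basis for `X`: it is a Schauder basis and
every expansion converges unconditionally. -/
def IsUncondSchauderBasis (x : ℕ → X) : Prop :=
  IsSchauderBasis x ∧ ∀ (v : X) (a : ℕ → ℝ),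
    Tendsto (fun N => ∑ j ∈ Finset.range N, a j • x j) atTop (𝓝 v) →
    HasSum (fun j => a j • x j) v

theorem aux_coord {x : ℕ → X} {C : ℝ} (hb : IsBasicWith x C) (a : ℕ → ℝ) (n N : ℕ) (h : n < N) :
    ‖a n • x n‖ ≤ 2 * C * ‖∑ j ∈ Finset.range N, a j • x j‖ := by
  have h1 := hb.2 a n N h.le
  have h2 := hb.2 a (n+1) N h
  have h3 : a n • x n = ∑ j ∈ Finset.range (n+1), a j • x j - ∑ j ∈ Finset.range n, a j • x j := by
    rw [Finset.sum_range_succ]; abel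
  rw [h3]
  refine (norm_sub_le _ _).trans ?_
  linarith

theorem aux_funct {x : ℕ → X} (hs : IsSchauderBasis x) (hb : IsBasicSeq x) :
    ∃ f : ℕ → (X →L[ℝ] ℝ),
      (∀ v, Tendsto (fun N => ∑ j ∈ Finset.range N, f j v • x j) atTop (𝓝 v)) ∧
      (∀ v (a : ℕ → ℝ), Tendsto (fun N => ∑ j ∈ Finset.range N, a j • x j) atTop (𝓝 v) →
        ∀ j, f j v = a j) := by
  obtain ⟨C, hC1, hC⟩ := hb
  choose g hg hu using hs
  have hu' : ∀ v (a : ℕ → ℝ), Tendsto (fun N => ∑ j ∈ Finset.range N, a j • x j) atTop (𝓝 v) →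
        a = g v := fun v a h => hu v a h
  have hadd : ∀ u v, g (u + v) = g u + g v := by
    intro u v
    refine (hu' _ _ ?_).symm
    refine ((hg u).add (hg v)).congr fun N => ?_
    simp [add_smul, Finset.sum_add_distrib]
  have hsmul : ∀ (c : ℝ) v, g (c • v) = c • g v := by
    intro c v
    refine (hu' _ _ ?_).symm
    refine ((hg v).const_smul c).congr fun N => ?_
    simp [Finset.smul_sum, mul_smul]
  have hbd : ∀ j v, ‖g v j‖ ≤ (2 * C / ‖x j‖) * ‖v‖ := by
    intro j v
    have hx : 0 < ‖x j‖ := norm_pos_iff.2 (hC.1 j)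
    have h1 : ‖g v j • x j‖ ≤ 2 * C * ‖v‖ := by
      refine ge_of_tendsto ((hg v).norm.const_mul (2 * C)) ?_
      filter_upwards [eventually_gt_atTop j] with N hN
      exact aux_coord hC (g v) j N hN
    rw [norm_smul] at h1
    rw [div_mul_eq_mul_div, le_div_iff₀ hx]
    exact h1
  refine ⟨fun j => LinearMap.mkContinuous
    { toFun := fun v => g v j
      map_add' := fun u v => by simp [hadd]
      map_smul' := fun c v => by simp [hsmul] } (2 * C / ‖x j‖) (hbd j), hg, ?_⟩
  intro v a h j
  rw [hu' v a h]
  rfl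

theorem aux_fin {x : ℕ → X} {f : ℕ → (X →L[ℝ] ℝ)}
    (hf : ∀ v (a : ℕ → ℝ), Tendsto (fun N => ∑ j ∈ Finset.range N, a j • x j) atTop (𝓝 v) →
        ∀ j, f j v = a j) (a : ℕ → ℝ) (N j : ℕ) (hj : j ∈ Finset.range N) :
    f j (∑ i ∈ Finset.range N, a i • x i) = a j := by
  rw [hf _ (fun i => if i ∈ Finset.range N then a i else 0) ?_ j, if_pos hj]
  refine tendsto_const_nhds.congr' ?_
  filter_upwards [eventually_ge_atTop N] with M hM
  have : ∀ i, (if i ∈ Finset.range N then a i else 0) • x i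
      = if i ∈ Finset.range N then a i • x i else 0 := by
    intro i; split_ifs <;> simp
  simp_rw [this]
  rw [← Finset.sum_filter]
  congr 1
  ext i
  simp
  omega

theorem aux_uncond {x : ℕ → X} {f : ℕ → (X →L[ℝ] ℝ)}
    (hf : ∀ v, HasSum (fun j => f j v • x j) v) :
    ∃ K > (0:ℝ), ∀ (A : Finset ℕ) (v : X) (θ : ℕ → ℝ) (M : ℝ), 0 ≤ M → (∀ j ∈ A, |θ j| ≤ M) →
      ‖∑ j ∈ A, (θ j * f j v) • x j‖ ≤ M * (K * ‖v‖) := by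
  have h1 : ∃ C', ∀ A : Finset ℕ, ‖∑ j ∈ A, (f j).smulRight (x j)‖ ≤ C' := by
    apply banach_steinhaus
    intro v
    have hs := (hf v).summable
    obtain ⟨s, hs⟩ := summable_iff_vanishing_norm.1 hs 1 one_pos
    refine ⟨1 + ∑ j ∈ s, ‖f j v • x j‖, fun A => ?_⟩
    have e : (∑ j ∈ A, (f j).smulRight (x j)) v = ∑ j ∈ A, f j v • x j := by
      simp [ContinuousLinearMap.sum_apply]
    rw [e, ← Finset.sum_sdiff (Finset.inter_subset_left : A ∩ s ⊆ A), Finset.sdiff_inter_self_left]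
    refine (norm_add_le _ _).trans (add_le_add (hs _ Finset.sdiff_disjoint).le ?_)
    refine (norm_sum_le _ _).trans ?_
    exact Finset.sum_le_sum_of_subset_of_nonneg Finset.inter_subset_right
      fun _ _ _ => norm_nonneg _
  obtain ⟨C', hC'⟩ := h1
  have hC0 : 0 ≤ C' := (norm_nonneg _).trans (hC' ∅)
  have hC : ∀ (A : Finset ℕ) v, ‖∑ j ∈ A, f j v • x j‖ ≤ C' * ‖v‖ := by
    intro A v
    have := ContinuousLinearMap.le_of_opNorm_le _ (hC' A) v
    simpa [ContinuousLinearMap.sum_apply] using this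
  refine ⟨2 * C' + 1, by positivity, fun A v θ M hM hθ => ?_⟩
  obtain ⟨φ, hφ, hφv⟩ := exists_dual_vector'' ℝ (∑ j ∈ A, (θ j * f j v) • x j)
  have hφv' : φ (∑ j ∈ A, (θ j * f j v) • x j) = ‖∑ j ∈ A, (θ j * f j v) • x j‖ := by
    simpa using hφv
  rw [← hφv', map_sum]
  have hB : ∀ B : Finset ℕ, |∑ j ∈ B, φ (f j v • x j)| ≤ C' * ‖v‖ := by
    intro B
    rw [← map_sum]
    calc _ ≤ ‖φ‖ * ‖∑ j ∈ B, f j v • x j‖ := φ.le_opNorm _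
      _ ≤ 1 * (C' * ‖v‖) := mul_le_mul hφ (hC B v) (norm_nonneg _) zero_le_one
      _ = _ := one_mul _
  have habs : ∑ j ∈ A, |φ (f j v • x j)| ≤ 2 * (C' * ‖v‖) := by
    rw [← Finset.sum_filter_add_sum_filter_not A (fun j => 0 ≤ φ (f j v • x j))]
    have e1 : ∑ j ∈ A with 0 ≤ φ (f j v • x j), |φ (f j v • x j)| =
        ∑ j ∈ A with 0 ≤ φ (f j v • x j), φ (f j v • x j) :=
      Finset.sum_congr rfl fun j hj => abs_of_nonneg (Finset.mem_filter.1 hj).2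
    have e2 : ∑ j ∈ A with ¬ 0 ≤ φ (f j v • x j), |φ (f j v • x j)| =
        - ∑ j ∈ A with ¬ 0 ≤ φ (f j v • x j), φ (f j v • x j) := by
      rw [← Finset.sum_neg_distrib]
      exact Finset.sum_congr rfl fun j hj => abs_of_neg (not_le.1 (Finset.mem_filter.1 hj).2)
    rw [e1, e2]
    have := hB {j ∈ A | 0 ≤ φ (f j v • x j)}
    have h2 := hB {j ∈ A | ¬ 0 ≤ φ (f j v • x j)}
    rw [abs_le] at this h2
    linarith [this.2, h2.1]
  calc ∑ j ∈ A, φ ((θ j * f j v) • x j) ≤ ∑ j ∈ A, M * |φ (f j v • x j)| := by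
        refine Finset.sum_le_sum fun j hj => ?_
        rw [mul_smul, map_smul, smul_eq_mul]
        refine (le_abs_self _).trans ?_
        rw [abs_mul]
        exact mul_le_mul_of_nonneg_right (hθ j hj) (abs_nonneg _)
    _ = M * ∑ j ∈ A, |φ (f j v • x j)| := by rw [Finset.mul_sum]
    _ ≤ M * ((2 * C' + 1) * ‖v‖) := by
        refine mul_le_mul_of_nonneg_left ?_ hM
        nlinarith [norm_nonneg v]

theorem aux_signs (s : Finset ℕ) (B : ℕ → ℕ → ℝ) :
    ∃ ε : ℕ → ℝ, (∀ i, ε i = 1 ∨ ε i = -1) ∧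
      ∑ i ∈ s, B i i ≤ ∑ i ∈ s, ∑ j ∈ s, ε i * ε j * B i j := by
  induction s using Finset.induction_on with
  | empty => exact ⟨fun _ => 1, fun _ => Or.inl rfl, by simp⟩
  | insert k s hk ih =>
    obtain ⟨ε, h1, h2⟩ := ih
    set L : ℝ := ∑ j ∈ s, ε j * B k j + ∑ i ∈ s, ε i * B i k with hL
    have key : ∀ t : ℝ, (t = 1 ∨ t = -1) → 0 ≤ t * L →
        ∃ ε : ℕ → ℝ, (∀ i, ε i = 1 ∨ ε i = -1) ∧
        ∑ i ∈ insert k s, B i i ≤ ∑ i ∈ insert k s, ∑ j ∈ insert k s, ε i * ε j * B i j := by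
      intro t ht htL
      refine ⟨Function.update ε k t, ?_, ?_⟩
      · intro i
        by_cases hi : i = k
        · subst hi; simpa using ht
        · simpa [hi] using h1 i
      · have hne : ∀ i ∈ s, Function.update ε k t i = ε i := by
          intro i hi
          have : i ≠ k := fun h => hk (h ▸ hi)
          simp [this]
        have htt : t * t = 1 := by rcases ht with h | h <;> simp [h]
        rw [Finset.sum_insert hk, Finset.sum_insert hk, Finset.sum_insert hk]
        have e1 : ∑ j ∈ s, Function.update ε k t k * Function.update ε k t j * B k j
            = t * ∑ j ∈ s, ε j * B k j := by
          rw [Finset.mul_sum]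
          refine Finset.sum_congr rfl fun j hj => ?_
          rw [hne j hj]; simp [mul_assoc]
        have e2 : ∑ i ∈ s, ∑ j ∈ insert k s, Function.update ε k t i * Function.update ε k t j * B i j
            = t * ∑ i ∈ s, ε i * B i k + ∑ i ∈ s, ∑ j ∈ s, ε i * ε j * B i j := by
          rw [Finset.mul_sum, ← Finset.sum_add_distrib]
          refine Finset.sum_congr rfl fun i hi => ?_
          rw [Finset.sum_insert hk, hne i hi]
          congr 1
          · simp; ring
          · refine Finset.sum_congr rfl fun j hj => ?_
            rw [hne j hj]
        rw [e1, e2]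
        simp only [Function.update_self, htt, one_mul]
        rw [hL, mul_add] at htL
        linarith
    rcases le_total 0 L with h | h
    · exact key 1 (Or.inl rfl) (by simpa using h)
    · exact key (-1) (Or.inr rfl) (by linarith)

theorem aux_baire (x0 x1 : ℕ → X) (hw : ∀ σ : ℕ → Bool, IsBasicSeq (weave x0 x1 σ)) :
    ∃ (τ : ℕ → Bool) (m : ℕ) (C : ℝ), 1 ≤ C ∧ (∀ j, m ≤ j → τ j = false) ∧
      ∀ σ : ℕ → Bool, (∀ j < m, σ j = τ j) → IsBasicWith (weave x0 x1 σ) C := by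
  let F : ℕ → Set (ℕ → Bool) := fun k => {σ | ∀ (a : ℕ → ℝ) (n N : ℕ), n ≤ N →
    ‖∑ j ∈ Finset.range n, a j • weave x0 x1 σ j‖ ≤
      (k:ℝ) * ‖∑ j ∈ Finset.range N, a j • weave x0 x1 σ j‖}
  have hcont : ∀ j, Continuous (fun σ : ℕ → Bool => weave x0 x1 σ j) := by
    intro j
    exact (continuous_of_discreteTopology (f := fun b : Bool => if b then x1 j else x0 j)).comp
      (continuous_apply j)
  have hcl : ∀ k, IsClosed (F k) := by
    intro k
    simp only [F, Set.setOf_forall]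
    refine isClosed_iInter fun a => isClosed_iInter fun n => isClosed_iInter fun N =>
      isClosed_iInter fun _ => isClosed_le ?_ ?_
    · exact (continuous_finset_sum _ fun j _ => (hcont j).const_smul (a j)).norm
    · exact continuous_const.mul
        (continuous_finset_sum _ fun j _ => (hcont j).const_smul (a j)).norm
  have hU : ⋃ k, F k = Set.univ := by
    refine Set.eq_univ_of_forall fun σ => ?_
    obtain ⟨C, -, hC⟩ := hw σ
    obtain ⟨k, hk⟩ := exists_nat_ge C
    refine Set.mem_iUnion.2 ⟨k, fun a n N h => (hC.2 a n N h).trans ?_⟩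
    exact mul_le_mul_of_nonneg_right hk (norm_nonneg _)
  obtain ⟨k, τ, hτ⟩ := nonempty_interior_of_iUnion_of_closed hcl hU
  obtain ⟨I, u, hu, hsub⟩ := isOpen_pi_iff.1 isOpen_interior τ hτ
  refine ⟨fun j => if j < I.sup id + 1 then τ j else false, I.sup id + 1, max 1 k, le_max_left _ _,
    fun j hj => if_neg (by omega), fun σ hσ => ⟨?_, ?_⟩⟩
  · obtain ⟨_, _, h⟩ := hw σ
    exact h.1
  · have : σ ∈ F k := by
      apply interior_subset
      apply hsub
      intro i hi
      have hi' : i < I.sup id + 1 := Nat.lt_succ_of_le (Finset.le_sup (f := id) hi)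
      have h3 : σ i = τ i := (hσ i hi').trans (if_pos hi')
      rw [h3]
      exact (hu i hi).2
    intro a n N h
    exact (this a n N h).trans
      (mul_le_mul_of_nonneg_right (le_max_right _ _) (norm_nonneg _))

theorem aux_half (x0 x1 : ℕ → X) (a b : ℝ) (ha : 0 < a)
    (hsn0 : ∀ i, a ≤ ‖x0 i‖ ∧ ‖x0 i‖ ≤ b) (hsn1 : ∀ i, a ≤ ‖x1 i‖ ∧ ‖x1 i‖ ≤ b)
    (hb0 : IsUncondSchauderBasis x0) (hb1 : IsUncondSchauderBasis x1)
    (hw : ∀ σ : ℕ → Bool, IsBasicSeq (weave x0 x1 σ)) :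
    ∃ C > (0 : ℝ), ∀ (coef : ℕ → ℝ) (N : ℕ),
      ‖∑ j ∈ Finset.range N, coef j • x0 j‖ ≤ C * ‖∑ j ∈ Finset.range N, coef j • x1 j‖ := by
  have hbpos : 0 < b := ha.trans_le ((hsn0 0).1.trans (hsn0 0).2)
  have hbs0 : IsBasicSeq x0 := by
    have := hw (fun _ => false)
    have e : weave x0 x1 (fun _ => false) = x0 := by funext j; simp [weave]
    rwa [e] at this
  have hbs1 : IsBasicSeq x1 := by
    have := hw (fun _ => true)
    have e : weave x0 x1 (fun _ => true) = x1 := by funext j; simp [weave]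
    rwa [e] at this
  obtain ⟨f, hf, hfu⟩ := aux_funct hb0.1 hbs0
  obtain ⟨g, hg, hgu⟩ := aux_funct hb1.1 hbs1
  obtain ⟨K0, hK0, hU0⟩ := aux_uncond (fun v => hb0.2 v _ (hf v))
  obtain ⟨K1, hK1, hU1⟩ := aux_uncond (fun v => hb1.2 v _ (hg v))
  obtain ⟨τ, m, C, hC1, hτ, hC⟩ := aux_baire x0 x1 hw
  set z : ℕ → X := weave x0 x1 τ with hz
  have hzm : ∀ j, m ≤ j → z j = x0 j := by
    intro j hj; simp [hz, weave, hτ j hj]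
  have hzC : IsBasicWith z C := hC τ fun _ _ => rfl
  let T : X →L[ℝ] X := ContinuousLinearMap.id ℝ X +
    ∑ i ∈ Finset.range m, (f i).smulRight (z i - x0 i)
  have hTv : ∀ v, T v = v + ∑ i ∈ Finset.range m, f i v • (z i - x0 i) := by
    intro v; simp [T, ContinuousLinearMap.sum_apply]
  have hTlim : ∀ v, Tendsto (fun N => ∑ j ∈ Finset.range N, f j v • z j) atTop (𝓝 (T v)) := by
    intro v
    rw [hTv]
    refine ((hf v).add_const _).congr' ?_
    filter_upwards [eventually_ge_atTop m] with N hN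
    have : ∑ i ∈ Finset.range m, f i v • (z i - x0 i)
        = ∑ i ∈ Finset.range N, f i v • (z i - x0 i) := by
      refine Finset.sum_subset (Finset.range_mono hN) fun i _ hi => ?_
      rw [hzm i (by simpa using hi)]; simp
    rw [this, ← Finset.sum_add_distrib]
    refine Finset.sum_congr rfl fun i _ => ?_
    rw [← smul_add]; simp
  have hTinj : ∀ v, T v = 0 → v = 0 := by
    intro v hv
    have hc : ∀ n, f n v = 0 := by
      intro n
      have h1 : ‖f n v • z n‖ ≤ 2 * C * ‖T v‖ := by
        refine ge_of_tendsto ((hTlim v).norm.const_mul (2 * C)) ?_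
        filter_upwards [eventually_gt_atTop n] with N hN
        exact aux_coord hzC (fun j => f j v) n N hN
      rw [hv, norm_zero, mul_zero] at h1
      have := norm_le_zero_iff.1 h1
      exact (smul_eq_zero.1 this).resolve_right (hzC.1 n)
    have := hf v
    simp only [hc, zero_smul, Finset.sum_const_zero] at this
    exact (tendsto_nhds_unique this tendsto_const_nhds)
  have hinj : Function.Injective T := by
    rw [injective_iff_map_eq_zero]; exact hTinj
  have hsurj : Function.Surjective T := by
    classical
    let G : Submodule ℝ X := Submodule.span ℝ
      ((Finset.range m).image (fun i => z i - x0 i) : Set X)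
    have hG : ∀ v, T v - v ∈ G := by
      intro v
      rw [hTv, add_sub_cancel_left]
      refine Submodule.sum_mem _ fun i hi => Submodule.smul_mem _ _ (Submodule.subset_span ?_)
      exact_mod_cast Finset.mem_image_of_mem (fun i => z i - x0 i) hi
    have hTG : ∀ v ∈ G, (T : X →ₗ[ℝ] X) v ∈ G := by
      intro v hv
      have := G.add_mem (hG v) hv
      simpa using this
    haveI : FiniteDimensional ℝ G := FiniteDimensional.span_of_finite ℝ (Finset.finite_toSet _)
    let R : G →ₗ[ℝ] G := (T : X →ₗ[ℝ] X).restrict hTG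
    have hRi : Function.Injective R := by
      intro p q hpq
      have := congrArg Subtype.val hpq
      exact Subtype.ext (hinj this)
    have hRs : Function.Surjective R := LinearMap.injective_iff_surjective.1 hRi
    intro v
    obtain ⟨w, hw'⟩ := hRs ⟨T v - v, hG v⟩
    have h2 : T w = T v - v := congrArg Subtype.val hw'
    exact ⟨v - w, by rw [map_sub, h2]; abel⟩
  let E : X ≃L[ℝ] X := ContinuousLinearEquiv.ofBijective T
    (LinearMap.ker_eq_bot.2 hinj) (LinearMap.range_eq_top.2 hsurj)
  let S : X →L[ℝ] X := (E.symm : X →L[ℝ] X)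
  have hTS : ∀ v, T (S v) = v := fun v => E.apply_symm_apply v
  -- diagonal lower bound
  have hd : ∀ n, m ≤ n → a ≤ 2 * C * b * |f n (S (x1 n))| := by
    intro n hn
    set u := S (x1 n) with hu
    have hb' := hC (Function.update τ n true) (by
      intro j hj; rw [Function.update_of_ne (by omega)])
    have hl : Tendsto (fun N => x1 n - ∑ j ∈ Finset.range N, f j u • z j + f n u • x0 n) atTop
        (𝓝 (f n u • x0 n)) := by
      have := ((hTlim u).const_sub (x1 n)).add_const (f n u • x0 n)
      rw [hu, hTS, sub_self, zero_add] at this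
      exact this
    have h1 : ‖x1 n‖ ≤ 2 * C * ‖f n u • x0 n‖ := by
      refine ge_of_tendsto (hl.norm.const_mul (2 * C)) ?_
      filter_upwards [eventually_gt_atTop n] with N hN
      have h2 := aux_coord hb' (fun j => if j = n then 1 else - f j u) n N hN
      have e1 : weave x0 x1 (Function.update τ n true) n = x1 n := by simp [weave]
      have e2 : ∑ j ∈ Finset.range N, (if j = n then 1 else - f j u) •
          weave x0 x1 (Function.update τ n true) j =
          x1 n - ∑ j ∈ Finset.range N, f j u • z j + f n u • x0 n := by
        have hmem : n ∈ Finset.range N := Finset.mem_range.2 hN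
        rw [← Finset.add_sum_erase _ _ hmem, ← Finset.add_sum_erase _ (fun j => f j u • z j) hmem,
          e1, hzm n hn]
        have : ∑ j ∈ (Finset.range N).erase n, (if j = n then (1:ℝ) else - f j u) •
          weave x0 x1 (Function.update τ n true) j
            = - ∑ j ∈ (Finset.range N).erase n, f j u • z j := by
          rw [← Finset.sum_neg_distrib]
          refine Finset.sum_congr rfl fun j hj => ?_
          have hjn : j ≠ n := Finset.ne_of_mem_erase hj
          simp only [hjn, hz, weave, Function.update_of_ne hjn, if_false, neg_smul]
        rw [this]
        simp
        abel
      rw [e2, e1] at h2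
      simpa using h2
    rw [norm_smul, Real.norm_eq_abs] at h1
    calc a ≤ ‖x1 n‖ := (hsn1 n).1
      _ ≤ 2 * C * (|f n u| * ‖x0 n‖) := h1
      _ ≤ 2 * C * (|f n u| * b) := by
          gcongr
          exact (hsn0 n).2
      _ = _ := by ring
  -- diagonal operator
  have hdiag : ∀ (c : ℕ → ℝ) (N : ℕ),
      ‖∑ j ∈ Finset.range N, (c j * f j (S (x1 j))) • x0 j‖ ≤
        K0 * (‖S‖ * (K1 * ‖∑ j ∈ Finset.range N, c j • x1 j‖)) := by
    intro c N
    obtain ⟨φ, hφ, hφv⟩ := exists_dual_vector'' ℝ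
      (∑ j ∈ Finset.range N, (c j * f j (S (x1 j))) • x0 j)
    have hφv' : φ (∑ j ∈ Finset.range N, (c j * f j (S (x1 j))) • x0 j) =
      ‖∑ j ∈ Finset.range N, (c j * f j (S (x1 j))) • x0 j‖ := by simpa using hφv
    obtain ⟨ε, hε, hle⟩ := aux_signs (Finset.range N)
      (fun j n => c n * f j (S (x1 n)) * φ (x0 j))
    have hε1 : ∀ j, |ε j| ≤ 1 := by
      intro j; rcases hε j with h | h <;> simp [h]
    set w := ∑ n ∈ Finset.range N, (ε n * c n) • x1 n with hwdef
    have hwn : ‖w‖ ≤ K1 * ‖∑ j ∈ Finset.range N, c j • x1 j‖ := by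
      have := hU1 (Finset.range N) (∑ j ∈ Finset.range N, c j • x1 j) ε 1 zero_le_one
        (fun j _ => hε1 j)
      rw [one_mul] at this
      refine le_trans (le_of_eq ?_) this
      rw [hwdef]
      congr 1
      refine Finset.sum_congr rfl fun j hj => ?_
      rw [aux_fin hgu c N j hj]
    have e : ∑ j ∈ Finset.range N, ∑ n ∈ Finset.range N,
        ε j * ε n * (c n * f j (S (x1 n)) * φ (x0 j)) =
        φ (∑ j ∈ Finset.range N, (ε j * f j (S w)) • x0 j) := by
      rw [map_sum]
      refine Finset.sum_congr rfl fun j _ => ?_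
      rw [map_smul, hwdef, map_sum, map_sum, smul_eq_mul, Finset.mul_sum, Finset.sum_mul]
      refine Finset.sum_congr rfl fun n _ => ?_
      simp only [map_smul, smul_eq_mul]
      ring
    calc _ = ∑ j ∈ Finset.range N, c j * f j (S (x1 j)) * φ (x0 j) := by
          rw [← hφv', map_sum]; simp
      _ ≤ φ (∑ j ∈ Finset.range N, (ε j * f j (S w)) • x0 j) := e ▸ hle
      _ ≤ ‖φ‖ * ‖∑ j ∈ Finset.range N, (ε j * f j (S w)) • x0 j‖ :=
          (le_abs_self _).trans (φ.le_opNorm _)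
      _ ≤ 1 * (1 * (K0 * ‖S w‖)) := mul_le_mul hφ
          (hU0 _ _ _ 1 zero_le_one fun j _ => hε1 j) (norm_nonneg _) zero_le_one
      _ = K0 * ‖S w‖ := by ring
      _ ≤ K0 * (‖S‖ * ‖w‖) := by gcongr; exact S.le_opNorm w
      _ ≤ _ := by gcongr
  set δ : ℝ := a / (2 * C * b) with hδ
  have hδpos : 0 < δ := by positivity
  have hdδ : ∀ n, m ≤ n → δ ≤ |f n (S (x1 n))| := by
    intro n hn
    rw [hδ, div_le_iff₀ (by positivity), mul_comm]
    exact hd n hn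
  refine ⟨δ⁻¹ * (K0 * (K0 * (‖S‖ * K1))) + m * (K1 / a * b) + 1, by positivity, fun c N => ?_⟩
  set V := ‖∑ j ∈ Finset.range N, c j • x1 j‖ with hV
  have hV0 : 0 ≤ V := norm_nonneg _
  have hci : ∀ i ∈ Finset.range N, |c i| ≤ K1 / a * V := by
    intro i hi
    have h := hU1 {i} (∑ j ∈ Finset.range N, c j • x1 j) (fun _ => 1) 1 zero_le_one (by simp)
    rw [Finset.sum_singleton, aux_fin hgu c N i hi, one_mul, one_mul, norm_smul,
      Real.norm_eq_abs] at h
    rw [div_mul_eq_mul_div, le_div_iff₀ ha]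
    exact (mul_le_mul_of_nonneg_left (hsn1 i).1 (abs_nonneg _)).trans h
  rw [← Finset.sum_filter_add_sum_filter_not (Finset.range N) (fun j => m ≤ j)]
  have hA : ‖∑ j ∈ Finset.range N with m ≤ j, c j • x0 j‖ ≤
      δ⁻¹ * (K0 * (K0 * (‖S‖ * K1))) * V := by
    have h := hU0 {j ∈ Finset.range N | m ≤ j}
      (∑ j ∈ Finset.range N, (c j * f j (S (x1 j))) • x0 j)
      (fun j => (f j (S (x1 j)))⁻¹) δ⁻¹ (by positivity) (by
        intro j hj
        rw [abs_inv]
        exact inv_anti₀ hδpos (hdδ j (Finset.mem_filter.1 hj).2))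
    have e : ∑ j ∈ Finset.range N with m ≤ j, ((f j (S (x1 j)))⁻¹ *
        f j (∑ j ∈ Finset.range N, (c j * f j (S (x1 j))) • x0 j)) • x0 j =
        ∑ j ∈ Finset.range N with m ≤ j, c j • x0 j := by
      refine Finset.sum_congr rfl fun j hj => ?_
      obtain ⟨hj1, hj2⟩ := Finset.mem_filter.1 hj
      rw [aux_fin hfu (fun j => c j * f j (S (x1 j))) N j hj1]
      have : f j (S (x1 j)) ≠ 0 := abs_pos.1 (hδpos.trans_le (hdδ j hj2))
      congr 1
      field_simp
    rw [e] at h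
    refine h.trans ?_
    calc _ ≤ δ⁻¹ * (K0 * (K0 * (‖S‖ * (K1 * V)))) := by
          gcongr
          exact hdiag c N
      _ = _ := by ring
  have hB : ‖∑ j ∈ Finset.range N with ¬ m ≤ j, c j • x0 j‖ ≤ m * (K1 / a * b) * V := by
    have hcard : ({j ∈ Finset.range N | ¬ m ≤ j}).card ≤ m := by
      have : {j ∈ Finset.range N | ¬ m ≤ j} ⊆ Finset.range m := by
        intro j hj
        have := (Finset.mem_filter.1 hj).2
        exact Finset.mem_range.2 (by omega)
      simpa using Finset.card_le_card this
    calc _ ≤ ∑ j ∈ Finset.range N with ¬ m ≤ j, (K1 / a * V * b) := by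
          refine norm_sum_le_of_le _ fun j hj => ?_
          rw [norm_smul, Real.norm_eq_abs]
          exact mul_le_mul (hci j (Finset.mem_filter.1 hj).1) (hsn0 j).2 (norm_nonneg _)
            (by positivity)
      _ = ({j ∈ Finset.range N | ¬ m ≤ j}).card * (K1 / a * V * b) := by
          rw [Finset.sum_const, nsmul_eq_mul]
      _ ≤ m * (K1 / a * V * b) := by gcongr
      _ = _ := by ring
  refine (norm_add_le _ _).trans ((add_le_add hA hB).trans ?_)
  nlinarith

theorem stmt8 (x0 x1 : ℕ → X) (a b : ℝ) (ha : 0 < a) (hab : a ≤ b)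
    (hsn0 : ∀ i, a ≤ ‖x0 i‖ ∧ ‖x0 i‖ ≤ b) (hsn1 : ∀ i, a ≤ ‖x1 i‖ ∧ ‖x1 i‖ ≤ b)
    (hb0 : IsUncondSchauderBasis x0) (hb1 : IsUncondSchauderBasis x1)
    (hw : ∀ σ : ℕ → Bool, IsBasicSeq (weave x0 x1 σ)) :
    ∃ c > (0 : ℝ), ∃ C > (0 : ℝ), ∀ (coef : ℕ → ℝ) (N : ℕ),
      c * ‖∑ j ∈ Finset.range N, coef j • x0 j‖ ≤ ‖∑ j ∈ Finset.range N, coef j • x1 j‖ ∧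
      ‖∑ j ∈ Finset.range N, coef j • x1 j‖ ≤ C * ‖∑ j ∈ Finset.range N, coef j • x0 j‖ := by
  obtain ⟨C, hC, h⟩ := aux_half x0 x1 a b ha hsn0 hsn1 hb0 hb1 hw
  have hw' : ∀ σ : ℕ → Bool, IsBasicSeq (weave x1 x0 σ) := by
    intro σ
    have := hw (fun j => !σ j)
    have e : weave x0 x1 (fun j => !σ j) = weave x1 x0 σ := by
      funext j
      cases hσ : σ j <;> simp [weave, hσ]
    rwa [e] at this
  obtain ⟨C', hC', h'⟩ := aux_half x1 x0 a b ha hsn1 hsn0 hb1 hb0 hw'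
  refine ⟨C⁻¹, by positivity, C', hC', fun c N => ⟨?_, h' c N⟩⟩
  rw [inv_mul_le_iff₀ hC]
  exact h c N
end

section
/- Suppose X is a Banach space with closed subspaces X₁, X₂, Y₁, Y₂ such that X = X₁ ⊕ X₂ and X = Y₁ ⊕ Y₂. Let P be the bounded projection onto X₁ with I−P the projection onto X₂, and let Q be the bounded projection onto Y₁ with I−Q the projection onto Y₂. Assume the restrictions Q|_{X₁} : X₁ → Y₁ and (I−P)|_{Y₂} : Y₂ → X₂ are bijective with bounded inverses, and that d(X₁, Y₂) > 0. Then X = X₁ ⊕ Y₂, i.e., X₁ ∩ Y₂ = {0} and X₁ + Y₂ = X. -/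
open Filter Topology

/-- Lemma 3.3: if `X = X₁ ⊕ X₂ = Y₁ ⊕ Y₂` with projections `P` (onto `X₁` along
`X₂`) and `Q` (onto `Y₁` along `Y₂`), the restrictions `Q|_{X₁} : X₁ → Y₁` and
`(I−P)|_{Y₂} : Y₂ → X₂` are bijective with bounded inverses, and `d(X₁, Y₂) > 0`,
then `X = X₁ ⊕ Y₂`. -/
theorem stmt10 {X : Type*} [NormedAddCommGroup X] [NormedSpace ℝ X] [CompleteSpace X]
    (X1 X2 Y1 Y2 : Submodule ℝ X)
    (hX1 : IsClosed (X1 : Set X)) (hX2 : IsClosed (X2 : Set X))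
    (hY1 : IsClosed (Y1 : Set X)) (hY2 : IsClosed (Y2 : Set X))
    -- `X = X₁ ⊕ X₂` and `X = Y₁ ⊕ Y₂`:
    (hXc : X1 ⊓ X2 = ⊥) (hXs : X1 ⊔ X2 = ⊤)
    (hYc : Y1 ⊓ Y2 = ⊥) (hYs : Y1 ⊔ Y2 = ⊤)
    -- `P` is the bounded projection onto `X₁` along `X₂`:
    (P : X →L[ℝ] X)
    (hPX1 : ∀ v : X, P v ∈ X1) (hPid : ∀ u ∈ X1, P u = u) (hPker : ∀ w ∈ X2, P w = 0)
    -- `Q` is the bounded projection onto `Y₁` along `Y₂`: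
    (Q : X →L[ℝ] X)
    (hQY1 : ∀ v : X, Q v ∈ Y1) (hQid : ∀ u ∈ Y1, Q u = u) (hQker : ∀ w ∈ Y2, Q w = 0)
    -- `Q|_{X₁} : X₁ → Y₁` is bijective with bounded inverse:
    (hQinj : ∃ c > (0 : ℝ), ∀ u ∈ X1, c * ‖u‖ ≤ ‖Q u‖)
    (hQsurj : ∀ y ∈ Y1, ∃ u ∈ X1, Q u = y)
    -- `(I−P)|_{Y₂} : Y₂ → X₂` is bijective with bounded inverse:
    (hPinj : ∃ c > (0 : ℝ), ∀ w ∈ Y2, c * ‖w‖ ≤ ‖w - P w‖)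
    (hPsurj : ∀ z ∈ X2, ∃ w ∈ Y2, w - P w = z)
    -- `d(X₁, Y₂) > 0`:
    (hd : ∃ D > (0 : ℝ), ∀ u ∈ X1, ∀ w ∈ Y2, (‖u‖ = 1 ∨ ‖w‖ = 1) → D ≤ ‖u - w‖) :
    X1 ⊓ Y2 = ⊥ ∧ X1 ⊔ Y2 = ⊤ := by
  constructor
  · rw [eq_bot_iff]
    rintro v ⟨h1, h2⟩
    obtain ⟨c, hc, h⟩ := hQinj
    have h3 := h v h1
    rw [hQker v h2, norm_zero] at h3
    have h4 : ‖v‖ ≤ 0 := by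
      by_contra hn
      push Not at hn
      have := mul_pos hc hn
      linarith
    rw [Submodule.mem_bot]
    exact norm_le_zero_iff.mp h4
  · rw [eq_top_iff, ← hXs]
    refine sup_le le_sup_left ?_
    intro z hz
    obtain ⟨w, hw, rfl⟩ := hPsurj z hz
    exact Submodule.sub_mem _ (Submodule.mem_sup_right hw) (Submodule.mem_sup_left (hPX1 w))
end

section
/- Let (x⁰_i)_{i∈ℕ} and (x¹_i)_{i∈ℕ} be two C-unconditional Schauder bases for a Banach space X with biorthogonal functionals (x⁰*_i) and (x¹*_i). If for every σ : ℕ → {0,1} the weaving (x^{σ(i)}_i)_{i∈ℕ} is an unconditional basic sequence, then there exists D > 0 such that for every σ : ℕ → {0,1}, d([x⁰_i]_{i∈σ⁻¹(0)}, [x¹_i]_{i∈σ⁻¹(1)}) ≥ D⁻¹. -/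
open Filter Topology

variable {X : Type*} [NormedAddCommGroup X] [NormedSpace ℝ X] [CompleteSpace X]

/-- `x` is a `C`-unconditional Schauder basis of `X` with biorthogonal
functionals `xs`: the system is biorthogonal, every vector has an
unconditionally convergent expansion, and all set-projections of the
expansion are bounded by `C`. -/
def IsUncondBasisWith (x : ℕ → X) (xs : ℕ → X →L[ℝ] ℝ) (C : ℝ) : Prop :=
  (∀ i j, xs i (x j) = if i = j then 1 else 0) ∧
  (∀ v : X, HasSum (fun j => xs j v • x j) v) ∧
  (∀ (v : X) (E : Set ℕ), ‖∑' j : E, xs (j : ℕ) v • x (j : ℕ)‖ ≤ C * ‖v‖)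

/-- `[x_i]_{i ∈ Γ}`, the closed linear span of `{x i : i ∈ Γ}`. -/
def sspan (x : ℕ → X) (Γ : Set ℕ) : Submodule ℝ X :=
  (Submodule.span ℝ (x '' Γ)).topologicalClosure

/-- The basis projection onto `[x_i]_{i ∈ Γ}`, given pointwise by
`v ↦ ∑_{i ∈ Γ} xs i (v) • x i`. -/
noncomputable def bproj (x : ℕ → X) (xs : ℕ → X →L[ℝ] ℝ) (Γ : Set ℕ) (v : X) : X :=
  ∑' i : Γ, xs (i : ℕ) v • x (i : ℕ)

/-- For a given `σ`, with `Γ = σ⁻¹(0)`, `P` the basis projection of `(x0, xs0)` onto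
`[x0_i]_{i ∈ Γ}` and `Q` the basis projection of `(x1, xs1)` onto `[x1_i]_{i ∈ Γ}`,
the restrictions `P|_{[x1_i]_{i ∈ Γ}} : [x1_i]_{i ∈ Γ} → [x0_i]_{i ∈ Γ}` and
`Q|_{[x0_i]_{i ∈ Γ}} : [x0_i]_{i ∈ Γ} → [x1_i]_{i ∈ Γ}` are bijective with
inverses of norm at most `E`. -/
def RestrictionsInvertible (x0 x1 : ℕ → X) (xs0 xs1 : ℕ → X →L[ℝ] ℝ)
    (σ : ℕ → Bool) (E : ℝ) : Prop :=
  (∀ u ∈ sspan x1 {i | σ i = false},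
      bproj x0 xs0 {i | σ i = false} u ∈ sspan x0 {i | σ i = false} ∧
      ‖u‖ ≤ E * ‖bproj x0 xs0 {i | σ i = false} u‖) ∧
  (∀ y ∈ sspan x0 {i | σ i = false},
      ∃ u ∈ sspan x1 {i | σ i = false}, bproj x0 xs0 {i | σ i = false} u = y) ∧
  (∀ u ∈ sspan x0 {i | σ i = false},
      bproj x1 xs1 {i | σ i = false} u ∈ sspan x1 {i | σ i = false} ∧
      ‖u‖ ≤ E * ‖bproj x1 xs1 {i | σ i = false} u‖) ∧
  (∀ y ∈ sspan x1 {i | σ i = false},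
      ∃ u ∈ sspan x0 {i | σ i = false}, bproj x1 xs1 {i | σ i = false} u = y)

section helpers
open Finset

theorem w11_blocks {Y : Type*} [AddCommGroup Y] (F : ℕ → Y) (M : ℕ → ℕ) (h0 : M 0 = 0) (hM : Monotone M) (n : ℕ) :
    ∑ j ∈ range (M n), F j = ∑ i ∈ range n, ∑ j ∈ Ico (M i) (M (i+1)), F j := by
  induction n with
  | zero => simp [h0]
  | succ n ih =>
    rw [sum_range_succ, ← ih, range_eq_Ico, range_eq_Ico, sum_Ico_consecutive _ (Nat.zero_le _) (hM (Nat.le_succ n))]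

theorem w11_alt {Y : Type*} [NormedAddCommGroup Y] [NormedSpace ℝ Y] (H : ℕ → Y) (m : ℕ) :
    ∑ i ∈ range (2*m), (-1:ℝ)^i • H i = - ∑ i ∈ range (2*m), (if Even i then H (i+1) - H i else 0) := by
  induction m with
  | zero => simp
  | succ n ih =>
    rw [show 2*(n+1) = 2*n+1+1 by ring, sum_range_succ, sum_range_succ, ih, sum_range_succ, sum_range_succ]
    have h1 : Even (2*n) := even_two_mul n
    have h2 : ¬ Even (2*n+1) := by simp
    rw [if_pos h1, if_neg h2, pow_succ, h1.neg_one_pow]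
    simp only [one_mul, one_smul, neg_smul]
    abel

theorem w11_idx (M : ℕ → ℕ) (h0 : M 0 = 0) (hM : StrictMono M) :
    ∃ q : ℕ → ℕ, ∀ i j, M i ≤ j → j < M (i+1) → q j = i := by
  refine ⟨fun j => Nat.findGreatest (fun i => M i ≤ j) j, fun i j h1 h2 => ?_⟩
  rw [Nat.findGreatest_eq_iff]
  refine ⟨(hM.le_apply).trans h1, fun _ => h1, fun n hn _ h => ?_⟩
  have := hM.monotone (show i+1 ≤ n from hn)
  omega

theorem w11_core (x0 x1 : ℕ → X)
    (hw : ∀ σ : ℕ → Bool, ∃ D : ℝ, 1 ≤ D ∧ IsSuppUncondBasicWith (weave x0 x1 σ) D)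
    (K : ℝ) (s : ℕ → ℕ → Bool) (α : ℕ → ℕ → ℝ) (L : ℕ → ℕ) (σ : ℕ → Bool) (c : ℕ → ℝ)
    (hlim : ∀ j, Tendsto (fun k => α k j • weave x0 x1 (s k) j) atTop (𝓝 (c j • weave x0 x1 σ j)))
    (hL : ∀ k j, L k ≤ j → α k j = 0)
    (hK : ∀ k (E : Finset ℕ), ‖∑ j ∈ E, α k j • weave x0 x1 (s k) j‖ ≤ K)
    (hd : Tendsto (fun k => ∑ j ∈ range (L k), α k j • weave x0 x1 (s k) j) atTop (𝓝 0))
    (hu : ∀ k, (1/2:ℝ) ≤ ‖∑ j ∈ (range (L k)).filter (fun j => s k j = false), α k j • weave x0 x1 (s k) j‖) :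
    False := by
  set y : ℕ → ℕ → X := fun k j => α k j • weave x0 x1 (s k) j with hy
  set z : ℕ → X := fun j => c j • weave x0 x1 σ j with hz
  have hKz : ∀ E : Finset ℕ, ‖∑ j ∈ E, z j‖ ≤ K := by
    intro E
    have : Tendsto (fun k => ‖∑ j ∈ E, y k j‖) atTop (𝓝 ‖∑ j ∈ E, z j‖) :=
      (tendsto_finsetSum E (fun j _ => hlim j)).norm
    exact le_of_tendsto' this (fun k => hK k E)
  -- choice of indices
  have hch : ∀ M : ℕ, ∃ k, ∑ j ∈ range M, ‖y k j - z j‖ ≤ (1/2:ℝ)^M ∧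
      ‖∑ j ∈ range (L k), y k j‖ ≤ (1/2:ℝ)^M := by
    intro M
    have e : (0:ℝ) < (1/2)^M := by positivity
    have t1 : Tendsto (fun k => ∑ j ∈ range M, ‖y k j - z j‖) atTop (𝓝 0) := by
      have := tendsto_finsetSum (range M) (fun j (_ : j ∈ range M) => ((hlim j).sub_const (z j)).norm)
      simpa [hz] using this
    have t2 := hd.norm
    rw [norm_zero] at t2
    exact ((t1.eventually_le_const e).and (t2.eventually_le_const e)).exists
  choose κ hκ1 hκ2 using hch
  let nx : ℕ → ℕ := fun M => max (M+1) (L (κ M))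
  let M : ℕ → ℕ := fun i => nx^[i] 0
  have hM0 : M 0 = 0 := rfl
  have hMs : ∀ i, M (i+1) = max (M i + 1) (L (κ (M i))) := fun i => Function.iterate_succ_apply' nx i 0
  have hM : StrictMono M := strictMono_nat_of_lt_succ (fun i => by rw [hMs]; omega)
  obtain ⟨q, hq⟩ := w11_idx M hM0 hM
  let t : ℕ → Bool := fun j => s (κ (M (q j))) j
  let b : ℕ → ℝ := fun j => α (κ (M (q j))) j
  let g : ℕ → X := fun i => ∑ j ∈ Ico (M i) (M (i+1)), y (κ (M i)) j
  let H : ℕ → X := fun i => ∑ j ∈ range (M i), z j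
  have hbt : ∀ i, ∀ j ∈ Ico (M i) (M (i+1)), q j = i ∧ b j • weave x0 x1 t j = y (κ (M i)) j := by
    intro i j hj
    rw [mem_Ico] at hj
    have := hq i j hj.1 hj.2
    refine ⟨this, ?_⟩
    simp only [b, t, hy, weave, this]
  have hepow : ∀ i, (1/2:ℝ)^(M i) ≤ (1/2)^i := fun i =>
    pow_le_pow_of_le_one (by norm_num) (by norm_num) hM.le_apply
  have hgH : ∀ i, ‖g i + H i‖ ≤ 2 * (1/2:ℝ)^i := by
    intro i
    have e1 : ∑ j ∈ range (M (i+1)), y (κ (M i)) j = ∑ j ∈ range (L (κ (M i))), y (κ (M i)) j := by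
      symm
      apply sum_subset
      · intro j; simp only [mem_range, hMs]; omega
      · intro j _ hj
        simp only [mem_range, not_lt] at hj
        simp [hy, hL _ _ hj]
    have e2 : g i = ∑ j ∈ range (L (κ (M i))), y (κ (M i)) j - ∑ j ∈ range (M i), y (κ (M i)) j := by
      rw [← e1, range_eq_Ico, range_eq_Ico, ← sum_Ico_consecutive _ (Nat.zero_le _) (hM.monotone (Nat.le_succ i))]
      simp [g]
    have e3 : g i + H i = ∑ j ∈ range (L (κ (M i))), y (κ (M i)) j - ∑ j ∈ range (M i), (y (κ (M i)) j - z j) := by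
      rw [e2, sum_sub_distrib]; simp only [H]; abel
    rw [e3]
    have n1 := hκ2 (M i)
    have n2 := (norm_sum_le (range (M i)) (fun j => y (κ (M i)) j - z j)).trans (hκ1 (M i))
    have := norm_sub_le (∑ j ∈ range (L (κ (M i))), y (κ (M i)) j) (∑ j ∈ range (M i), (y (κ (M i)) j - z j))
    have := hepow i
    linarith
  have hgeo : ∀ n, ∑ i ∈ range n, 2 * (1/2:ℝ)^i ≤ 4 := by
    intro n
    have : ∑ i ∈ range n, 2 * (1/2:ℝ)^i = 4 - 4 * (1/2)^n := by
      induction n with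
      | zero => simp
      | succ n ih => rw [sum_range_succ, ih, pow_succ]; ring
    have h : (0:ℝ) < (1/2)^n := by positivity
    linarith
  -- general weaving sums
  have hblk : ∀ (f : ℕ → ℝ) (n : ℕ), ∑ j ∈ range (M n), (f (q j) * b j) • weave x0 x1 t j
      = ∑ i ∈ range n, f i • g i := by
    intro f n
    rw [w11_blocks _ M hM0 hM.monotone]
    refine sum_congr rfl fun i _ => ?_
    simp only [g, smul_sum]
    refine sum_congr rfl fun j hj => ?_
    rw [mul_smul, (hbt i j hj).1, (hbt i j hj).2]
  have hHalt : ∀ m, ‖∑ i ∈ range (2*m), (-1:ℝ)^i • H i‖ ≤ K := by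
    intro m
    rw [w11_alt, norm_neg]
    have : ∑ i ∈ range (2*m), (if Even i then H (i+1) - H i else 0)
        = ∑ j ∈ (range (M (2*m))).filter (fun j => Even (q j)), z j := by
      rw [sum_filter, w11_blocks _ M hM0 hM.monotone]
      refine sum_congr rfl fun i _ => ?_
      have : ∑ j ∈ Ico (M i) (M (i+1)), (if Even (q j) then z j else 0)
          = ∑ j ∈ Ico (M i) (M (i+1)), (if Even i then z j else 0) :=
        sum_congr rfl fun j hj => by rw [(hbt i j hj).1]
      rw [this]
      split_ifs
      · rw [sum_Ico_eq_sub _ (hM.monotone (Nat.le_succ i))]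
      · simp
    rw [this]
    exact hKz _
  have hgalt : ∀ m, ‖∑ i ∈ range (2*m), (-1:ℝ)^i • g i‖ ≤ 4 + K := by
    intro m
    have : ∑ i ∈ range (2*m), (-1:ℝ)^i • g i = ∑ i ∈ range (2*m), (-1:ℝ)^i • (g i + H i)
        - ∑ i ∈ range (2*m), (-1:ℝ)^i • H i := by
      simp [smul_add, sum_add_distrib]
    rw [this]
    refine (norm_sub_le _ _).trans (add_le_add ?_ (hHalt m))
    refine (norm_sum_le _ _).trans (le_trans (sum_le_sum fun i _ => ?_) (hgeo (2*m)))
    rw [norm_smul]; simpa using hgH i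
  obtain ⟨D, hD1, -, hD⟩ := hw t
  have hgsum : ∀ m, ‖∑ i ∈ range (2*m), g i‖ ≤ 2 * (D * (4+K)) := by
    intro m
    have key : ∀ p : ℕ → Prop, [DecidablePred p] →
        ‖∑ i ∈ range (2*m), (if p i then (-1:ℝ)^i else 0) • g i‖ ≤ D * (4+K) := by
      intro p _
      have h1 := hD (fun j => (-1:ℝ)^(q j) * b j) (M (2*m)) ((range (M (2*m))).filter (fun j => p (q j)))
        (filter_subset _ _)
      rw [hblk (fun i => (-1:ℝ)^i)] at h1
      have h2 : ∑ j ∈ (range (M (2*m))).filter (fun j => p (q j)), ((-1:ℝ)^(q j) * b j) • weave x0 x1 t j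
          = ∑ i ∈ range (2*m), (if p i then (-1:ℝ)^i else 0) • g i := by
        rw [← hblk (fun i => if p i then (-1:ℝ)^i else 0), sum_filter]
        refine sum_congr rfl fun j _ => ?_
        split_ifs <;> simp
      rw [h2] at h1
      exact h1.trans (mul_le_mul_of_nonneg_left (hgalt m) (by linarith))
    have e : ∑ i ∈ range (2*m), g i = ∑ i ∈ range (2*m), (if Even i then (-1:ℝ)^i else 0) • g i
        - ∑ i ∈ range (2*m), (if ¬ Even i then (-1:ℝ)^i else 0) • g i := by
      rw [← sum_sub_distrib]
      refine sum_congr rfl fun i _ => ?_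
      by_cases h : Even i
      · simp [h]
      · simp [h, (Nat.not_even_iff_odd.1 h).neg_one_pow]
    rw [e]
    refine (norm_sub_le _ _).trans ?_
    have := key (fun i => Even i)
    have := key (fun i => ¬ Even i)
    linarith
  have hHsum : ∀ m, ‖∑ i ∈ range (2*m), H i‖ ≤ 4 + 2 * (D * (4+K)) := by
    intro m
    have : ∑ i ∈ range (2*m), H i = ∑ i ∈ range (2*m), (g i + H i) - ∑ i ∈ range (2*m), g i := by
      simp [sum_add_distrib]
    rw [this]
    refine (norm_sub_le _ _).trans (add_le_add ?_ (hgsum m))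
    exact (norm_sum_le _ _).trans (le_trans (sum_le_sum fun i _ => hgH i) (hgeo (2*m)))
  obtain ⟨D', hD1', hne, hD'⟩ := hw σ
  have hz0 : ∀ j, z j = 0 := by
    intro j
    by_contra hj
    have hpos : 0 < ‖z j‖ := norm_pos_iff.2 hj
    obtain ⟨n, hn⟩ := exists_nat_gt (D' * (4 + 2 * (D * (4+K))) / ‖z j‖)
    rw [div_lt_iff₀ hpos] at hn
    let m := n + j + 1
    have hs : ∑ i ∈ range (2*m), H i
        = ∑ l ∈ range (M (2*m)), ((∑ i ∈ range (2*m), if l < M i then (1:ℝ) else 0) * c l) • weave x0 x1 σ l := by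
      simp only [sum_mul, sum_smul]
      rw [sum_comm]
      refine sum_congr rfl fun i hi => ?_
      have hsub : range (M i) ⊆ range (M (2*m)) := by
        apply range_subset_range.2
        exact hM.monotone (by simp at hi; omega)
      simp only [H]
      rw [← sum_subset hsub (f := fun l => ((if l < M i then (1:ℝ) else 0) * c l) • weave x0 x1 σ l)]
      · refine sum_congr rfl fun l hl => ?_
        simp [mem_range.1 hl, hz]
      · intro l _ hl
        rw [mem_range] at hl
        simp [hl]
    have hjm : {j} ⊆ range (M (2*m)) := by
      have : 2*m ≤ M (2*m) := hM.le_apply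
      simp only [singleton_subset_iff, mem_range]; omega
    have h1 := hD' (fun l => (∑ i ∈ range (2*m), if l < M i then (1:ℝ) else 0) * c l) (M (2*m)) {j} hjm
    rw [← hs, sum_singleton, mul_smul, norm_smul] at h1
    have h2 : (n:ℝ) ≤ ‖∑ i ∈ range (2*m), if j < M i then (1:ℝ) else 0‖ := by
      refine le_trans ?_ (le_abs_self _)
      have : Ico (j+1) (j+1+n) ⊆ range (2*m) := by
        intro i; simp only [mem_Ico, mem_range]; omega
      refine le_trans ?_ (sum_le_sum_of_subset_of_nonneg this (fun i _ _ => by split_ifs <;> norm_num))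
      rw [sum_congr rfl (g := fun _ => (1:ℝ))]
      · simp
      · intro i hi
        rw [mem_Ico] at hi
        have : i ≤ M i := hM.le_apply
        rw [if_pos (by omega)]
    have h3 : (n:ℝ) * ‖z j‖ ≤ D' * (4 + 2 * (D * (4+K))) :=
      (mul_le_mul_of_nonneg_right h2 hpos.le).trans
        (h1.trans (mul_le_mul_of_nonneg_left (hHsum m) (by linarith)))
    linarith
  have hHz : ∀ i, H i = 0 := fun i => sum_eq_zero fun j _ => hz0 j
  have hfin : ∀ i, (1/2:ℝ) ≤ (1 + 2 * D) * (1/2)^i := by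
    intro i
    set k := κ (M i) with hk
    have h1 := hu k
    have e1 : ∑ j ∈ (range (L k)).filter (fun j => s k j = false), y k j
        = ∑ j ∈ (range (M i)).filter (fun j => s k j = false), y k j
        + ∑ j ∈ (Ico (M i) (M (i+1))).filter (fun j => s k j = false), y k j := by
      rw [sum_filter, sum_filter, sum_filter, range_eq_Ico, range_eq_Ico,
        sum_Ico_consecutive _ (Nat.zero_le _) (hM.monotone (Nat.le_succ i))]
      apply sum_subset
      · intro j; simp only [mem_Ico, hMs, ← hk]; omega
      · intro j _ hj
        simp only [mem_Ico, not_and, not_lt] at hj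
        simp [hy, hL _ _ (hj (Nat.zero_le _))]
    have n1 : ‖∑ j ∈ (range (M i)).filter (fun j => s k j = false), y k j‖ ≤ (1/2)^i := by
      refine (norm_sum_le _ _).trans (le_trans ?_ ((hκ1 (M i)).trans (hepow i)))
      simp only [hz0, sub_zero]
      exact sum_le_sum_of_subset_of_nonneg (filter_subset _ _) (fun _ _ _ => norm_nonneg _)
    have n2 : ‖∑ j ∈ (Ico (M i) (M (i+1))).filter (fun j => s k j = false), y k j‖ ≤ D * (2 * (1/2)^i) := by
      have hI : Ico (M i) (M (i+1)) ⊆ range (M (i+1)) := by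
        intro j; simp only [mem_Ico, mem_range]; omega
      have h := hD (fun j => if j ∈ Ico (M i) (M (i+1)) then b j else 0) (M (i+1))
        ((Ico (M i) (M (i+1))).filter (fun j => s k j = false)) ((filter_subset _ _).trans hI)
      have a1 : ∑ j ∈ (Ico (M i) (M (i+1))).filter (fun j => s k j = false),
          (if j ∈ Ico (M i) (M (i+1)) then b j else 0) • weave x0 x1 t j
          = ∑ j ∈ (Ico (M i) (M (i+1))).filter (fun j => s k j = false), y k j := by
        refine sum_congr rfl fun j hj => ?_
        rw [if_pos (mem_filter.1 hj).1, (hbt i j (mem_filter.1 hj).1).2]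
      have a2 : ∑ j ∈ range (M (i+1)),
          (if j ∈ Ico (M i) (M (i+1)) then b j else 0) • weave x0 x1 t j = g i := by
        rw [← sum_subset hI]
        · refine sum_congr rfl fun j hj => ?_
          rw [if_pos hj, (hbt i j hj).2]
        · intro j _ hj
          rw [if_neg hj, zero_smul]
      rw [a1, a2] at h
      have h3 := hgH i
      rw [hHz, add_zero] at h3
      exact h.trans (mul_le_mul_of_nonneg_left h3 (by linarith))
    have e2 : (1/2:ℝ) ≤ ‖∑ j ∈ (range (L k)).filter (fun j => s k j = false), y k j‖ := h1
    rw [e1] at e2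
    have := norm_add_le (∑ j ∈ (range (M i)).filter (fun j => s k j = false), y k j)
      (∑ j ∈ (Ico (M i) (M (i+1))).filter (fun j => s k j = false), y k j)
    linarith
  have hl : Tendsto (fun i : ℕ => (1 + 2 * D) * (1/2:ℝ)^i) atTop (𝓝 ((1 + 2*D) * 0)) :=
    (tendsto_pow_atTop_nhds_zero_of_lt_one (by norm_num) (by norm_num)).const_mul _
  have := ge_of_tendsto' hl hfin
  norm_num at this

theorem w11_span (x : ℕ → X) (xs : ℕ → X →L[ℝ] ℝ) (C : ℝ) (hb : IsUncondBasisWith x xs C)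
    (Γ : Set ℕ) (u : X) (hu : u ∈ Submodule.span ℝ (x '' Γ)) :
    (∃ L, ∀ j, L ≤ j → xs j u = 0) ∧ ∀ j, j ∉ Γ → xs j u = 0 := by
  induction hu using Submodule.span_induction with
  | mem v hv =>
    obtain ⟨i, hi, rfl⟩ := hv
    refine ⟨⟨i+1, fun j hj => ?_⟩, fun j hj => ?_⟩
    · rw [hb.1, if_neg (by omega)]
    · rw [hb.1, if_neg (by rintro rfl; exact hj hi)]
  | zero => simp
  | add v w _ _ h1 h2 =>
    obtain ⟨⟨L1, a1⟩, b1⟩ := h1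
    obtain ⟨⟨L2, a2⟩, b2⟩ := h2
    refine ⟨⟨max L1 L2, fun j hj => ?_⟩, fun j hj => ?_⟩
    · rw [map_add, a1 j (by omega), a2 j (by omega), add_zero]
    · rw [map_add, b1 j hj, b2 j hj, add_zero]
  | smul r v _ h =>
    obtain ⟨⟨L1, a1⟩, b1⟩ := h
    refine ⟨⟨L1, fun j hj => ?_⟩, fun j hj => ?_⟩
    · rw [map_smul, a1 j hj, smul_zero]
    · rw [map_smul, b1 j hj, smul_zero]

theorem w11_eq (x : ℕ → X) (xs : ℕ → X →L[ℝ] ℝ) (C : ℝ) (hb : IsUncondBasisWith x xs C)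
    (u : X) (L : ℕ) (hL : ∀ j, L ≤ j → xs j u = 0) : ∑ j ∈ range L, xs j u • x j = u := by
  refine (hasSum_sum_of_ne_finset_zero (s := range L) ?_).unique (hb.2.1 u)
  intro j hj
  rw [hL j (by simpa using hj), zero_smul]

theorem w11_bd (x : ℕ → X) (xs : ℕ → X →L[ℝ] ℝ) (C : ℝ) (hb : IsUncondBasisWith x xs C)
    (u : X) (E : Finset ℕ) : ‖∑ j ∈ E, xs j u • x j‖ ≤ C * ‖u‖ := by
  have := hb.2.2 u (E : Set ℕ)
  rwa [Finset.tsum_subtype' E (fun j => xs j u • x j)] at this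

/-- one approximating step -/
theorem w11_step (x0 x1 : ℕ → X) (xs0 xs1 : ℕ → X →L[ℝ] ℝ) (C : ℝ) (hC : 1 ≤ C)
    (hb0 : IsUncondBasisWith x0 xs0 C) (hb1 : IsUncondBasisWith x1 xs1 C)
    (σ : ℕ → Bool) (u w : X) (hu : u ∈ sspan x0 {i | σ i = false}) (hw : w ∈ sspan x1 {i | σ i = true})
    (h1 : ‖u‖ = 1 ∨ ‖w‖ = 1) (δ : ℝ) (hδ0 : 0 < δ) (hδ : δ ≤ 1/4) (huw : ‖u - w‖ < δ) :
    ∃ (α : ℕ → ℝ) (L : ℕ), (∀ j, L ≤ j → α j = 0) ∧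
      (∀ E : Finset ℕ, ‖∑ j ∈ E, α j • weave x0 x1 σ j‖ ≤ 4 * C) ∧
      ‖∑ j ∈ range L, α j • weave x0 x1 σ j‖ ≤ 3 * δ ∧
      1/2 ≤ ‖∑ j ∈ (range L).filter (fun j => σ j = false), α j • weave x0 x1 σ j‖ := by
  have hu' : u ∈ closure (Submodule.span ℝ (x0 '' {i | σ i = false}) : Set X) := hu
  have hw' : w ∈ closure (Submodule.span ℝ (x1 '' {i | σ i = true}) : Set X) := hw
  obtain ⟨u', hu1, hu2⟩ := Metric.mem_closure_iff.1 hu' δ hδ0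
  obtain ⟨w', hw1, hw2⟩ := Metric.mem_closure_iff.1 hw' δ hδ0
  rw [dist_eq_norm] at hu2 hw2
  obtain ⟨⟨L0, a0⟩, c0⟩ := w11_span x0 xs0 C hb0 _ u' hu1
  obtain ⟨⟨L1, a1⟩, c1⟩ := w11_span x1 xs1 C hb1 _ w' hw1
  have nu := abs_norm_sub_norm_le u w
  have nu1 := abs_norm_sub_norm_le u u'
  have nw1 := abs_norm_sub_norm_le w w'
  rw [abs_le] at nu nu1 nw1
  have hu1' : 1/2 ≤ ‖u'‖ := by rcases h1 with h | h <;> linarith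
  have hu2' : ‖u'‖ ≤ 2 := by rcases h1 with h | h <;> linarith
  have hw2' : ‖w'‖ ≤ 2 := by rcases h1 with h | h <;> linarith
  have split : ∀ E : Finset ℕ,
      ∑ j ∈ E, (if σ j then - xs1 j w' else xs0 j u') • weave x0 x1 σ j
      = ∑ j ∈ E, xs0 j u' • x0 j - ∑ j ∈ E, xs1 j w' • x1 j := by
    intro E
    rw [← sum_sub_distrib]
    refine sum_congr rfl fun j _ => ?_
    by_cases h : σ j = true
    · simp [weave, h, c0 j (by simp [h])]
    · simp [weave, h, c1 j (by simpa using h)]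
  refine ⟨fun j => if σ j then - xs1 j w' else xs0 j u', max L0 L1, ?_, ?_, ?_, ?_⟩
  · intro j hj
    simp [a0 j (by omega), a1 j (by omega)]
  · intro E
    rw [split]
    have p1 := w11_bd x0 xs0 C hb0 u' E
    have p2 := w11_bd x1 xs1 C hb1 w' E
    have p3 := norm_sub_le (∑ j ∈ E, xs0 j u' • x0 j) (∑ j ∈ E, xs1 j w' • x1 j)
    nlinarith
  · rw [split, w11_eq x0 xs0 C hb0 u' _ (fun j hj => a0 j (by omega)),
      w11_eq x1 xs1 C hb1 w' _ (fun j hj => a1 j (by omega))]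
    have : u' - w' = -(u - u') + (u - w) + (w - w') := by abel
    rw [this]
    have q1 := norm_add_le (-(u - u') + (u - w)) (w - w')
    have q2 := norm_add_le (-(u - u')) (u - w)
    rw [norm_neg] at q2
    linarith
  · have : ∑ j ∈ (range (max L0 L1)).filter (fun j => σ j = false),
        (if σ j then - xs1 j w' else xs0 j u') • weave x0 x1 σ j = u' := by
      refine Eq.trans ?_ (w11_eq x0 xs0 C hb0 u' (max L0 L1) (fun j hj => a0 j (by omega)))
      rw [sum_filter]
      refine sum_congr rfl fun j _ => ?_
      by_cases h : σ j = true
      · simp [h, c0 j (by simp [h])]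
      · simp [weave, h]
    rw [this]; exact hu1'

end helpers

theorem stmt11 (x0 x1 : ℕ → X) (xs0 xs1 : ℕ → X →L[ℝ] ℝ) (C : ℝ) (hC : 1 ≤ C)
    (hb0 : IsUncondBasisWith x0 xs0 C) (hb1 : IsUncondBasisWith x1 xs1 C)
    (hw : ∀ σ : ℕ → Bool, ∃ D : ℝ, 1 ≤ D ∧ IsSuppUncondBasicWith (weave x0 x1 σ) D) :
    ∃ D > (0 : ℝ), ∀ σ : ℕ → Bool,
      ∀ u ∈ sspan x0 {i | σ i = false}, ∀ w ∈ sspan x1 {i | σ i = true},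
        (‖u‖ = 1 ∨ ‖w‖ = 1) → D⁻¹ ≤ ‖u - w‖ := by
  by_contra! hcon
  have hx0 : ∀ j, 0 < ‖x0 j‖ := by
    intro j
    obtain ⟨D, -, h, -⟩ := hw (fun _ => false)
    simpa [weave] using h j
  have hx1 : ∀ j, 0 < ‖x1 j‖ := by
    intro j
    obtain ⟨D, -, h, -⟩ := hw (fun _ => true)
    simpa [weave] using h j
  have hδ : ∀ k : ℕ, (4 * ((k:ℝ) + 1))⁻¹ ≤ 1/4 := by
    intro k
    rw [inv_le_comm₀ (by positivity) (by norm_num)]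
    have : (0:ℝ) ≤ k := k.cast_nonneg
    norm_num
  have hstep : ∀ k : ℕ, ∃ (s : ℕ → Bool) (α : ℕ → ℝ) (L : ℕ), (∀ j, L ≤ j → α j = 0) ∧
      (∀ E : Finset ℕ, ‖∑ j ∈ E, α j • weave x0 x1 s j‖ ≤ 4 * C) ∧
      ‖∑ j ∈ Finset.range L, α j • weave x0 x1 s j‖ ≤ 3 * (4 * ((k:ℝ) + 1))⁻¹ ∧
      1/2 ≤ ‖∑ j ∈ (Finset.range L).filter (fun j => s j = false), α j • weave x0 x1 s j‖ := by
    intro k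
    obtain ⟨s, u, hu, w, hw', h1, h2⟩ := hcon (4 * ((k:ℝ) + 1)) (by positivity)
    exact ⟨s, w11_step x0 x1 xs0 xs1 C hC hb0 hb1 s u w hu hw' h1 _ (by positivity) (hδ k) h2⟩
  choose s α L hL hK hd hu using hstep
  let R : ℕ → ℝ := fun j => 4 * C / ‖x0 j‖ + 4 * C / ‖x1 j‖
  have hcomp : IsCompact (Set.univ.pi (fun j : ℕ => (Set.univ : Set Bool) ×ˢ Set.Icc (-R j) (R j))) :=
    isCompact_univ_pi (fun j => isCompact_univ.prod isCompact_Icc)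
  have hmem : ∀ k, (fun j => (s k j, α k j)) ∈
      Set.univ.pi (fun j : ℕ => (Set.univ : Set Bool) ×ˢ Set.Icc (-R j) (R j)) := by
    intro k j _
    refine ⟨Set.mem_univ _, ?_⟩
    have h := hK k {j}
    rw [Finset.sum_singleton, norm_smul, Real.norm_eq_abs] at h
    have p0 : 0 ≤ 4 * C / ‖x0 j‖ := by have := hx0 j; positivity
    have p1 : 0 ≤ 4 * C / ‖x1 j‖ := by have := hx1 j; positivity
    refine abs_le.1 ?_
    show |α k j| ≤ 4 * C / ‖x0 j‖ + 4 * C / ‖x1 j‖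
    by_cases hs : s k j = true
    · simp only [weave, hs, if_true] at h
      rw [← le_div_iff₀ (hx1 j)] at h
      linarith
    · simp only [weave, hs] at h
      rw [if_neg (by simp), ← le_div_iff₀ (hx0 j)] at h
      linarith
  obtain ⟨p, -, φ, hφ, hp⟩ := hcomp.tendsto_subseq hmem
  rw [tendsto_pi_nhds] at hp
  refine w11_core x0 x1 hw (4 * C) (fun k => s (φ k)) (fun k => α (φ k)) (fun k => L (φ k))
    (fun j => (p j).1) (fun j => (p j).2) ?_ (fun k => hL _) (fun k => hK _) ?_ (fun k => hu _)
  · intro j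
    have h := hp j
    have h1 : Tendsto (fun k => s (φ k) j) atTop (𝓝 (p j).1) := (continuous_fst.tendsto _).comp h
    have h2 : Tendsto (fun k => α (φ k) j) atTop (𝓝 (p j).2) := (continuous_snd.tendsto _).comp h
    rw [nhds_discrete, tendsto_pure] at h1
    refine (h2.smul_const (weave x0 x1 (fun j => (p j).1) j)).congr' ?_
    filter_upwards [h1] with k hk
    simp only [weave, hk]
  · have hlim : Tendsto (fun k : ℕ => 3 * (4 * ((k:ℝ) + 1))⁻¹) atTop (𝓝 0) := by
      have := (tendsto_one_div_add_atTop_nhds_zero_nat (𝕜 := ℝ)).const_mul (3/4)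
      rw [mul_zero] at this
      refine this.congr fun k => ?_
      rw [mul_inv, one_div]; ring
    exact squeeze_zero_norm (fun k => hd (φ k)) (hlim.comp hφ.tendsto_atTop)
end

section
/- Let (x⁰_i)_{i∈ℕ} and (x¹_i)_{i∈ℕ} be two C-unconditional Schauder bases for a Banach space X with biorthogonal functionals (x⁰*_i) and (x¹*_i). Suppose there exists D > 0 such that for every σ : ℕ → {0,1}, d([x⁰_i]_{i∈σ⁻¹(0)}, [x¹_i]_{i∈σ⁻¹(1)}) ≥ D⁻¹. Then there exists E > 0 such that for every σ : ℕ → {0,1}, letting P be the basis projection of (x⁰_i) onto [x⁰_i]_{i∈σ⁻¹(0)} and Q the basis projection of (x¹_i) onto [x¹_i]_{i∈σ⁻¹(0)}, the restrictions P|_{[x¹_i]_{i∈σ⁻¹(0)}} : [x¹_i]_{i∈σ⁻¹(0)} → [x⁰_i]_{i∈σ⁻¹(0)} and Q|_{[x⁰_i]_{i∈σ⁻¹(0)}} : [x⁰_i]_{i∈σ⁻¹(0)} → [x¹_i]_{i∈σ⁻¹(0)} are bijective with inverses of norm at most E. -/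
open Filter Topology

variable {X : Type*} [NormedAddCommGroup X] [NormedSpace ℝ X] [CompleteSpace X]

section Helpers

variable {x : ℕ → X} {xs : ℕ → X →L[ℝ] ℝ} {C : ℝ}

theorem ub_ext (hb : IsUncondBasisWith x xs C) {v w : X} (h : ∀ i, xs i v = xs i w) : v = w := by
  have h1 := hb.2.1 v
  have h2 := hb.2.1 w
  simp only [h] at h1
  exact h1.unique h2


open Classical in
theorem ub_coord (hb : IsUncondBasisWith x xs C) (Γ : Set ℕ) (v : X) (i : ℕ) :
    xs i (bproj x xs Γ v) = if i ∈ Γ then xs i v else 0 := by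
  have hs : Summable (fun j : Γ => xs (j : ℕ) v • x (j : ℕ)) := (hb.2.1 v).summable.subtype Γ
  unfold bproj
  rw [(xs i).map_tsum hs]
  simp only [map_smul, hb.1, smul_eq_mul, mul_ite, mul_one, mul_zero]
  by_cases hi : i ∈ Γ
  · rw [tsum_eq_single (⟨i, hi⟩ : Γ)]
    · simp [hi]
    · intro j hj
      rw [if_neg]
      intro h
      exact hj (Subtype.ext h.symm)
  · rw [if_neg hi]
    convert tsum_zero with j
    rw [if_neg]
    rintro rfl
    exact hi j.2

noncomputable def pr (hb : IsUncondBasisWith x xs C) (Γ : Set ℕ) : X →L[ℝ] X :=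
  LinearMap.mkContinuous
    { toFun := bproj x xs Γ
      map_add' := by
        classical
        intro v w
        apply ub_ext hb
        intro i
        simp only [map_add, ub_coord hb]
        split_ifs <;> simp
      map_smul' := by
        classical
        intro a v
        apply ub_ext hb
        intro i
        simp only [map_smul, ub_coord hb, RingHom.id_apply]
        split_ifs <;> simp } C (fun v => hb.2.2 v Γ)

theorem pr_eq (hb : IsUncondBasisWith x xs C) (Γ : Set ℕ) (v : X) :
    pr hb Γ v = bproj x xs Γ v := rfl

theorem pr_norm (hb : IsUncondBasisWith x xs C) (Γ : Set ℕ) (v : X) :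
    ‖pr hb Γ v‖ ≤ C * ‖v‖ := hb.2.2 v Γ

open Classical in
theorem pr_coord (hb : IsUncondBasisWith x xs C) (Γ : Set ℕ) (v : X) (i : ℕ) :
    xs i (pr hb Γ v) = if i ∈ Γ then xs i v else 0 := ub_coord hb Γ v i

theorem mem_sspan_iff (hb : IsUncondBasisWith x xs C) (Γ : Set ℕ) (v : X) :
    v ∈ sspan x Γ ↔ ∀ i, i ∉ Γ → xs i v = 0 := by
  constructor
  · intro hv i hi
    have : sspan x Γ ≤ LinearMap.ker (xs i : X →ₗ[ℝ] ℝ) := by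
      apply Submodule.topologicalClosure_minimal
      · rw [Submodule.span_le]
        rintro _ ⟨j, hj, rfl⟩
        have : i ≠ j := by rintro rfl; exact hi hj
        simp [hb.1, this]
      · exact (xs i).isClosed_ker
    exact this hv
  · intro h
    have hc : IsClosed (sspan x Γ : Set X) := Submodule.isClosed_topologicalClosure _
    refine hc.mem_of_tendsto (hb.2.1 v) (Eventually.of_forall fun s => ?_)
    refine Submodule.sum_mem _ fun i _ => ?_
    by_cases hi : i ∈ Γ
    · exact Submodule.smul_mem _ _
        (Submodule.le_topologicalClosure _ (Submodule.subset_span ⟨i, hi, rfl⟩))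
    · rw [h i hi, zero_smul]; exact Submodule.zero_mem _

theorem pr_mem (hb : IsUncondBasisWith x xs C) (Γ : Set ℕ) (v : X) :
    pr hb Γ v ∈ sspan x Γ := by
  classical
  rw [mem_sspan_iff hb]
  intro i hi
  rw [pr_coord, if_neg hi]

theorem pr_Iio (hb : IsUncondBasisWith x xs C) (m : ℕ) (v : X) :
    pr hb (Set.Iio m) v = ∑ j ∈ Finset.range m, xs j v • x j := by
  classical
  apply ub_ext hb
  intro i
  rw [pr_coord]
  simp [map_sum, hb.1]

theorem pr_tail (hb : IsUncondBasisWith x xs C) (v : X) :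
    Tendsto (fun m => v - pr hb (Set.Iio m) v) atTop (𝓝 0) := by
  simp only [pr_Iio]
  simpa using (hb.2.1 v).tendsto_sum_nat.const_sub v

end Helpers

/-- finite sections are onto -/
theorem finite_onto {x0 x1 : ℕ → X} {xs0 xs1 : ℕ → X →L[ℝ] ℝ} {C D : ℝ}
    (hb0 : IsUncondBasisWith x0 xs0 C) (hb1 : IsUncondBasisWith x1 xs1 C)
    (H : ∀ Γ : Set ℕ, ∀ u ∈ sspan x1 Γ, ‖u‖ ≤ D * ‖pr hb0 Γ u‖)
    (F : Set ℕ) (hF : F.Finite) (y : X) :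
    ∃ u ∈ sspan x1 F, ∀ i ∈ F, xs0 i u = xs0 i y := by
  classical
  have := hF.fintype
  let V : (F → ℝ) →ₗ[ℝ] X := Fintype.linearCombination ℝ (fun j : F => x1 j)
  have hV : ∀ a, V a = ∑ j : F, a j • x1 j := fun a => by
    simp [V, Fintype.linearCombination_apply]
  have hVm : ∀ a, V a ∈ sspan x1 F := by
    intro a
    rw [hV]
    exact Submodule.sum_mem _ fun j _ => Submodule.smul_mem _ _
      (Submodule.le_topologicalClosure _ (Submodule.subset_span ⟨j, j.2, rfl⟩))
  let T : (F → ℝ) →ₗ[ℝ] (F → ℝ) := LinearMap.pi fun i : F => (xs0 i : X →ₗ[ℝ] ℝ) ∘ₗ V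
  have hT : ∀ a i, T a i = xs0 i (V a) := fun a i => rfl
  have hinj : Function.Injective T := by
    rw [← LinearMap.ker_eq_bot, LinearMap.ker_eq_bot']
    intro a ha
    have h0 : pr hb0 F (V a) = 0 := by
      apply ub_ext hb0
      intro i
      rw [pr_coord]
      split_ifs with hi
      · have := congrFun ha ⟨i, hi⟩
        rw [hT] at this
        simpa using this
      · simp
    have h1 := H F (V a) (hVm a)
    rw [h0, norm_zero, mul_zero] at h1
    have h2 : V a = 0 := norm_le_zero_iff.1 h1
    funext i
    have h3 : xs1 i (V a) = 0 := by rw [h2, map_zero]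
    rw [hV, map_sum] at h3
    simp only [map_smul, hb1.1, smul_eq_mul, mul_ite, mul_one, mul_zero, Subtype.coe_inj] at h3
    simpa using h3
  have hsurj := LinearMap.injective_iff_surjective.1 hinj
  obtain ⟨a, ha⟩ := hsurj (fun i => xs0 i y)
  refine ⟨V a, hVm a, fun i hi => ?_⟩
  have := congrFun ha ⟨i, hi⟩
  rw [hT] at this
  exact this

theorem closed_gap {x0 x1 : ℕ → X} {xs0 : ℕ → X →L[ℝ] ℝ} {C D : ℝ} (hD : 0 < D)
    (hb0 : IsUncondBasisWith x0 xs0 C) (Γ : Set ℕ)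
    (H : ∀ u ∈ sspan x1 Γ, ‖u‖ ≤ D * ‖pr hb0 Γ u‖) (y : X)
    (hy : ¬ ∃ u ∈ sspan x1 Γ, pr hb0 Γ u = y) :
    ∃ δ > 0, ∀ u ∈ sspan x1 Γ, δ ≤ ‖pr hb0 Γ u - y‖ := by
  let T : sspan x1 Γ →L[ℝ] X := (pr hb0 Γ).comp (sspan x1 Γ).subtypeL
  have : CompleteSpace (sspan x1 Γ) :=
    (Submodule.isClosed_topologicalClosure _).completeSpace_coe
  have hanti : AntilipschitzWith ⟨D, hD.le⟩ T := by
    refine ContinuousLinearMap.antilipschitz_of_bound T (K := ⟨D, hD.le⟩) ?_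
    intro u
    exact H u u.2
  have hcl : IsClosed (Set.range T) := hanti.isClosed_range T.uniformContinuous
  have hyn : y ∈ (Set.range T)ᶜ := by
    rintro ⟨u, hu⟩
    exact hy ⟨u, u.2, hu⟩
  obtain ⟨δ, hδ, hball⟩ := Metric.isOpen_iff.1 hcl.isOpen_compl y hyn
  refine ⟨δ, hδ, fun u hu => ?_⟩
  by_contra hlt
  push Not at hlt
  have : pr hb0 Γ u ∈ Metric.ball y δ := by rwa [Metric.mem_ball, dist_eq_norm]
  exact hball this ⟨⟨u, hu⟩, rfl⟩

/-- choice of the sequences -/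
theorem exists_seq {x0 x1 : ℕ → X} {xs0 xs1 : ℕ → X →L[ℝ] ℝ} {C B : ℝ}
    (hb0 : IsUncondBasisWith x0 xs0 C) (hb1 : IsUncondBasisWith x1 xs1 C) (hC : 1 ≤ C)
    (u : ℕ → X) (hu : ∀ n, ‖u n‖ ≤ B) (y : X) (ε : ℝ) (hε : 0 < ε) :
    ∃ (p : ℕ → X) (c : ℕ → ℝ) (n M : ℕ → ℕ),
      (∀ m, ‖p m‖ ≤ C * B) ∧ (∀ m i, xs1 i (p m) = if i < m then c i else 0) ∧
      (∀ k, M k ≤ n k ∧ n k ≤ M (k+1)) ∧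
      (∀ k, ‖pr hb1 (Set.Iio (M k)) (u (n k)) - p (M k)‖ ≤ ε) ∧
      (∀ k, ‖(u (n k) - y) - pr hb0 (Set.Iio (M (k+1))) (u (n k) - y)‖ ≤ ε) := by
  classical
  have hlim : ∀ j, ∃ c : ℝ, Tendsto (fun k => xs1 j (u k)) (hyperfilter ℕ : Filter ℕ) (𝓝 c) := by
    intro j
    have hcomp : IsCompact (Metric.closedBall (0:ℝ) (‖xs1 j‖ * B)) := isCompact_closedBall _ _
    have hmem : ∀ k, xs1 j (u k) ∈ Metric.closedBall (0:ℝ) (‖xs1 j‖ * B) := by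
      intro k
      rw [mem_closedBall_zero_iff]
      exact ((xs1 j).le_opNorm _).trans (mul_le_mul_of_nonneg_left (hu k) (norm_nonneg _))
    obtain ⟨c, -, hc⟩ := hcomp.ultrafilter_le_nhds
      ((hyperfilter ℕ).map (fun k => xs1 j (u k)))
      (by
        rw [le_principal_iff]
        exact Filter.mem_map.2 (Filter.univ_mem' hmem))
    exact ⟨c, hc⟩
  choose c hc using hlim
  let p : ℕ → X := fun m => ∑ j ∈ Finset.range m, c j • x1 j
  have hp : ∀ m, Tendsto (fun k => pr hb1 (Set.Iio m) (u k)) (hyperfilter ℕ : Filter ℕ)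
      (𝓝 (p m)) := by
    intro m
    simp only [pr_Iio]
    exact tendsto_finsetSum _ fun j _ => (hc j).smul_const _
  have hstep : ∀ m, ∃ n m', (m ≤ n ∧ n ≤ m') ∧ ‖pr hb1 (Set.Iio m) (u n) - p m‖ ≤ ε ∧
      ‖(u n - y) - pr hb0 (Set.Iio m') (u n - y)‖ ≤ ε := by
    intro m
    have h1 : ∀ᶠ k in (hyperfilter ℕ : Filter ℕ), ‖pr hb1 (Set.Iio m) (u k) - p m‖ < ε := by
      have := (hp m).eventually (Metric.ball_mem_nhds _ hε)
      simpa only [Metric.mem_ball, dist_eq_norm] using this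
    have h2 : ∀ᶠ k in (hyperfilter ℕ : Filter ℕ), m ≤ k :=
      Nat.hyperfilter_le_atTop (eventually_ge_atTop m)
    obtain ⟨n, hn1, hn2⟩ := (h1.and h2).exists
    have h3 := (pr_tail hb0 (u n - y)).eventually (Metric.ball_mem_nhds _ hε)
    obtain ⟨m', h4, h5⟩ := (h3.and (eventually_ge_atTop n)).exists
    rw [dist_zero_right] at h4
    exact ⟨n, m', ⟨hn2, h5⟩, hn1.le, h4.le⟩
  choose n m' h1 h2 h3 using hstep
  let M : ℕ → ℕ := fun k => Nat.rec 0 (fun _ m => m' m) k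
  refine ⟨p, c, fun k => n (M k), M, ?_, ?_, fun k => h1 (M k), fun k => h2 (M k),
    fun k => h3 (M k)⟩
  · intro m
    refine le_of_tendsto (hp m).norm (Eventually.of_forall fun k => ?_)
    exact (pr_norm hb1 _ _).trans (mul_le_mul_of_nonneg_left (hu k) (by linarith))
  · intro m i
    simp [p, map_sum, hb1.1]

theorem main_onto {x0 x1 : ℕ → X} {xs0 xs1 : ℕ → X →L[ℝ] ℝ} {C D : ℝ} (hC : 1 ≤ C) (hD : 0 < D)
    (hb0 : IsUncondBasisWith x0 xs0 C) (hb1 : IsUncondBasisWith x1 xs1 C)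
    (H : ∀ Γ : Set ℕ, ∀ u ∈ sspan x1 Γ, ‖u‖ ≤ D * ‖pr hb0 Γ u‖)
    (Γ : Set ℕ) (y : X) (hy : y ∈ sspan x0 Γ) :
    ∃ u ∈ sspan x1 Γ, pr hb0 Γ u = y := by
  classical
  by_contra hcon
  obtain ⟨δ, hδ, hgap⟩ := closed_gap hD hb0 Γ (H Γ) y hcon
  have hC0 : 0 ≤ C := by linarith
  -- finite sections
  have hfin : ∀ n : ℕ, ∃ u ∈ sspan x1 (Γ ∩ Set.Iio n),
      ∀ i ∈ Γ ∩ Set.Iio n, xs0 i u = xs0 i y := fun n =>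
    finite_onto hb0 hb1 H _ ((Set.finite_Iio n).inter_of_right Γ) y
  choose v hvm hv using hfin
  let B := D * (C * ‖y‖)
  have hB0 : 0 ≤ B := by positivity
  have hvB : ∀ n, ‖v n‖ ≤ B := by
    intro n
    have h1 := H _ _ (hvm n)
    have h2 : pr hb0 (Γ ∩ Set.Iio n) (v n) = pr hb0 (Γ ∩ Set.Iio n) y := by
      apply ub_ext hb0
      intro i
      simp only [pr_coord]
      split_ifs with hi
      · exact hv n i hi
      · rfl
    rw [h2] at h1
    exact h1.trans (mul_le_mul_of_nonneg_left (pr_norm _ _ _) hD.le)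
  have hvΓ : ∀ n, v n ∈ sspan x1 Γ := by
    intro n
    rw [mem_sspan_iff hb1]
    intro i hi
    exact (mem_sspan_iff hb1 _ _).1 (hvm n) i (fun h => hi h.1)
  -- epsilon
  let K := 2*C + 2*C^2 + 2*D*C^2 + 2*D*C^3
  have hK : 0 < K := by positivity
  let ε := δ / (2 * K)
  have hε : 0 < ε := by positivity
  have hεK : ε * K = δ / 2 := by simp only [ε]; field_simp
  obtain ⟨p, c, n, M, hpB, hpc, hnM, hQ, hP⟩ := exists_seq hb0 hb1 hC v hvB y ε hε
  have hMmono : Monotone M := monotone_nat_of_le_succ fun k => (hnM k).1.trans (hnM k).2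
  let A' : ℕ → Set ℕ := fun k => {j | j ∈ Γ ∧ n k ≤ j ∧ j < M (k+1)}
  let A : Set ℕ := {j | ∃ k, j ∈ A' k}
  let O : Set ℕ := {j | ∃ l, j ∈ A' (2*l)}
  let F0 : Set ℕ := Γ \ A
  have hidx : ∀ i k j, j ∈ A' i → M k ≤ j → j < M (k+1) → i = k := by
    intro i k j hj h1 h2
    obtain ⟨-, h3, h4⟩ := hj
    have h5 := (hnM i).1
    rcases lt_trichotomy i k with h | h | h
    · have := hMmono (show i + 1 ≤ k from h); omega
    · exact h
    · have := hMmono (show k + 1 ≤ i from h); omega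
  have hidx' : ∀ i k j, j ∈ A' i → j ∈ A' k → i = k := by
    intro i k j hi hk
    exact hidx i k j hi ((hnM k).1.trans hk.2.1) hk.2.2
  have hOA : ∀ j, j ∈ O → j ∈ A := fun j ⟨l, hl⟩ => ⟨_, hl⟩
  have hAΓ : ∀ j, j ∈ A → j ∈ Γ := fun j ⟨l, hl⟩ => hl.1
  let u : ℕ → X := fun k => v (n k)
  let g : ℕ → X := fun k => u k - y
  -- coordinates of g
  have hg0 : ∀ k j, j ∈ Γ → j < n k → xs0 j (g k) = 0 := by
    intro k j hj hjn
    simp only [g, u, map_sub]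
    rw [hv (n k) j ⟨hj, hjn⟩, sub_self]
  have hS : ∀ k (S : Set ℕ), S ⊆ Γ → (∀ j ∈ S, j ∉ A' k) → ‖pr hb0 S (g k)‖ ≤ C * ε := by
    intro k S hSΓ hSA
    have : pr hb0 S (g k) = pr hb0 S (g k - pr hb0 (Set.Iio (M (k+1))) (g k)) := by
      apply ub_ext hb0
      intro j
      simp only [pr_coord, map_sub, Set.mem_Iio]
      split_ifs with h1 h2
      · rw [sub_self]
        apply hg0 k j (hSΓ h1)
        by_contra h3
        exact hSA j h1 ⟨hSΓ h1, not_lt.1 h3, h2⟩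
      · simp
      · simp
    rw [this]
    exact (pr_norm _ _ _).trans (mul_le_mul_of_nonneg_left (hP k) hC0)
  -- approximation on A
  let q : ℕ → X := fun k => pr hb1 A (p (M k))
  have hq : ∀ k, ‖pr hb1 A (u k) - q k‖ ≤ C * ε := by
    intro k
    have : pr hb1 A (u k) - q k = pr hb1 A (pr hb1 (Set.Iio (M k)) (u k) - p (M k)) := by
      rw [map_sub]
      congr 1
      apply ub_ext hb1
      intro j
      simp only [pr_coord, Set.mem_Iio]
      split_ifs with h1 h2
      · rfl
      · obtain ⟨i, hi⟩ := h1
        apply (mem_sspan_iff hb1 _ _).1 (hvm (n k)) j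
        rintro ⟨-, h3⟩
        have h3' : j < n k := h3
        have h4 : i = k := hidx i k j hi (not_lt.1 h2) (h3'.trans_le (hnM k).2)
        subst h4
        exact absurd hi.2.1 (not_le.2 h3')
      · rfl
    rw [this]
    exact (pr_norm _ _ _).trans (mul_le_mul_of_nonneg_left (hQ k) hC0)
  have hqstep : ∀ N, q (2*N+1) - q (2*N) =
      pr hb1 O (p (M (2*(N+1)))) - pr hb1 O (p (M (2*N))) := by
    intro N
    apply ub_ext hb1
    intro j
    have hm1 : M (2*N) ≤ M (2*N+1) := hMmono (by omega)
    have hm2 : M (2*N+1) ≤ M (2*(N+1)) := hMmono (by omega)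
    simp only [q, map_sub, pr_coord, hpc]
    by_cases hjA : j ∈ A
    · obtain ⟨i, hi⟩ := hjA
      have hjA : j ∈ A := ⟨i, hi⟩
      rw [if_pos hjA, if_pos hjA]
      by_cases h0 : j < M (2*N)
      · rw [if_pos h0, if_pos (h0.trans_le hm1), if_pos (h0.trans_le (hm1.trans hm2))]
        split_ifs <;> simp
      · by_cases h1 : j < M (2*N+1)
        · have : i = 2*N := hidx i _ j hi (not_lt.1 h0) h1
          have hO : j ∈ O := ⟨N, this ▸ hi⟩
          rw [if_pos hO, if_pos hO, if_pos h1, if_pos (h1.trans_le hm2)]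
        · by_cases h2 : j < M (2*(N+1))
          · have : i = 2*N+1 := hidx i _ j hi (not_lt.1 h1) h2
            have hO : j ∉ O := by
              rintro ⟨l, hl⟩
              have := hidx' _ _ j hi hl
              omega
            simp [hO, h0, h1]
          · simp [h0, h1, h2]
    · have hO : j ∉ O := fun h => hjA (hOA j h)
      simp [hjA, hO]
  -- the test vector
  let z : ℕ → X := fun N => ∑ l ∈ Finset.range N, (u (2*l) - u (2*l+1))
  have hsumq : ∀ N, ∑ l ∈ Finset.range N, (q (2*l+1) - q (2*l)) =
      pr hb1 O (p (M (2*N))) - pr hb1 O (p (M 0)) := by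
    intro N
    simp only [hqstep]
    rw [Finset.sum_range_sub (fun N => pr hb1 O (p (M (2*N))))]
  have hbound : ∀ (N : ℕ) (w : ℕ → X) (r : ℝ), (∀ l, ‖w l‖ ≤ r) →
      ‖∑ l ∈ Finset.range N, w l‖ ≤ N * r := by
    intro N w r hw
    refine (norm_sum_le_of_le _ fun l _ => hw l).trans ?_
    simp
  have hOp : ∀ m, ‖pr hb1 O (p m)‖ ≤ C * (C * B) := fun m =>
    (pr_norm _ _ _).trans (mul_le_mul_of_nonneg_left (hpB m) hC0)
  have hzA : ∀ N : ℕ, ‖pr hb1 A (z N)‖ ≤ N * (2 * (C * ε)) + 2 * (C * (C * B)) := by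
    intro N
    have e1 : pr hb1 A (z N) = ∑ l ∈ Finset.range N,
        ((pr hb1 A (u (2*l)) - q (2*l)) - (pr hb1 A (u (2*l+1)) - q (2*l+1)))
        - (pr hb1 O (p (M (2*N))) - pr hb1 O (p (M 0))) := by
      rw [← hsumq, ← Finset.sum_sub_distrib]
      simp only [z, map_sum, map_sub]
      refine Finset.sum_congr rfl fun l _ => ?_
      abel
    rw [e1]
    refine (norm_sub_le _ _).trans (add_le_add (hbound N _ _ fun l => ?_) ?_)
    · refine (norm_sub_le _ _).trans ?_
      linarith [hq (2*l), hq (2*l+1)]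
    · refine (norm_sub_le _ _).trans ?_
      linarith [hOp (M (2*N)), hOp (M 0)]
  have hug : ∀ l, u (2*l) - u (2*l+1) = g (2*l) - g (2*l+1) := by
    intro l; simp only [g]; abel
  have hzF : ∀ N : ℕ, ‖pr hb0 F0 (z N)‖ ≤ N * (2 * (C * ε)) := by
    intro N
    simp only [z, map_sum, hug, map_sub]
    refine hbound N _ _ fun l => ?_
    refine (norm_sub_le _ _).trans ?_
    have := fun k => hS k F0 (fun j hj => hj.1) (fun j hj h => hj.2 ⟨k, h⟩)
    linarith [this (2*l), this (2*l+1)]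
  have hzΓ : ∀ N, z N ∈ sspan x1 Γ := fun N =>
    Submodule.sum_mem _ fun l _ => Submodule.sub_mem _ (hvΓ _) (hvΓ _)
  have hzz : ∀ N, z N = pr hb1 A (z N) + pr hb1 F0 (z N) := by
    intro N
    apply ub_ext hb1
    intro j
    simp only [map_add, pr_coord]
    by_cases h1 : j ∈ A
    · simp [h1, F0]
    · by_cases h2 : j ∈ Γ
      · simp [h1, h2, F0]
      · simp [h1, h2, F0, (mem_sspan_iff hb1 _ _).1 (hzΓ N) j h2]
  have hzF1 : ∀ N, ‖pr hb1 F0 (z N)‖ ≤ D * (‖pr hb0 F0 (z N)‖ + C * ‖pr hb1 A (z N)‖) := by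
    intro N
    refine (H F0 _ (pr_mem hb1 F0 (z N))).trans (mul_le_mul_of_nonneg_left ?_ hD.le)
    have : pr hb1 F0 (z N) = z N - pr hb1 A (z N) := by
      rw [eq_sub_iff_add_eq, add_comm]; exact (hzz N).symm
    rw [this, map_sub]
    exact (norm_sub_le _ _).trans (add_le_add le_rfl (pr_norm _ _ _))
  have hlow : ∀ N : ℕ, 0 < N → N * δ ≤ ‖∑ l ∈ Finset.range N, pr hb0 Γ (g (2*l))‖ := by
    intro N hN
    have hN' : (0:ℝ) < N := by exact_mod_cast hN
    have hyΓ : pr hb0 Γ y = y := by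
      apply ub_ext hb0
      intro j
      rw [pr_coord]
      split_ifs with h
      · rfl
      · exact ((mem_sspan_iff hb0 _ _).1 hy j h).symm
    have e : ∑ l ∈ Finset.range N, pr hb0 Γ (g (2*l)) =
        (N:ℝ) • (pr hb0 Γ ((N:ℝ)⁻¹ • ∑ l ∈ Finset.range N, u (2*l)) - y) := by
      rw [map_smul, smul_sub, smul_smul, mul_inv_cancel₀ hN'.ne', one_smul, map_sum]
      simp only [g, map_sub, hyΓ, Finset.sum_sub_distrib]
      simp [← Nat.cast_smul_eq_nsmul ℝ]
    rw [e, norm_smul, Real.norm_of_nonneg hN'.le]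
    refine mul_le_mul_of_nonneg_left (hgap _ ?_) hN'.le
    exact Submodule.smul_mem _ _ (Submodule.sum_mem _ fun l _ => hvΓ _)
  have hzO : ∀ N : ℕ, ‖∑ l ∈ Finset.range N, pr hb0 Γ (g (2*l))‖ ≤
      C * ‖z N‖ + N * (2 * (C * ε)) := by
    intro N
    have e : ∑ l ∈ Finset.range N, pr hb0 Γ (g (2*l)) = pr hb0 O (z N) +
        ∑ l ∈ Finset.range N, (pr hb0 (Γ \ O) (g (2*l)) + pr hb0 O (g (2*l+1))) := by
      simp only [z, map_sum, hug, map_sub]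
      rw [← Finset.sum_add_distrib]
      refine Finset.sum_congr rfl fun l _ => ?_
      have : pr hb0 Γ (g (2*l)) = pr hb0 O (g (2*l)) + pr hb0 (Γ \ O) (g (2*l)) := by
        apply ub_ext hb0
        intro j
        simp only [map_add, pr_coord]
        by_cases h1 : j ∈ O
        · simp [h1, hAΓ j (hOA j h1)]
        · simp [h1]
      rw [this]
      abel
    rw [e]
    refine (norm_add_le _ _).trans (add_le_add (pr_norm _ _ _) (hbound N _ _ fun l => ?_))
    refine (norm_add_le _ _).trans ?_
    have h1 := hS (2*l) (Γ \ O) (fun j hj => hj.1) (fun j hj h => hj.2 ⟨l, h⟩)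
    have h2 := hS (2*l+1) O (fun j hj => hAΓ j (hOA j hj)) (fun j ⟨i, hi⟩ h => by
      have := hidx' _ _ j hi h
      omega)
    linarith
  -- conclusion
  let R := 2 * C^3 * B * (1 + D * C)
  obtain ⟨N, hN⟩ := exists_nat_gt (R / (δ / 2))
  have hR0 : 0 ≤ R := by positivity
  have hN' : (0:ℝ) < N := lt_of_le_of_lt (by positivity) hN
  have hN2 : R < N * (δ / 2) := by rwa [div_lt_iff₀ (by positivity)] at hN
  have hz1 : ‖z N‖ ≤ ‖pr hb1 A (z N)‖ + ‖pr hb1 F0 (z N)‖ := by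
    conv_lhs => rw [hzz N]
    exact norm_add_le _ _
  have hfinal := (hlow N (by exact_mod_cast hN')).trans (hzO N)
  let η := N * (2 * (C * ε)) + 2 * (C * (C * B))
  have hz2 : ‖z N‖ ≤ η + D * (N * (2 * (C * ε)) + C * η) := by
    have h1 : ‖pr hb0 F0 (z N)‖ + C * ‖pr hb1 A (z N)‖ ≤ N * (2 * (C * ε)) + C * η :=
      add_le_add (hzF N) (mul_le_mul_of_nonneg_left (hzA N) hC0)
    have h2 := mul_le_mul_of_nonneg_left h1 hD.le
    linarith [hzA N, hzF1 N]
  have hz3 := mul_le_mul_of_nonneg_left hz2 hC0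
  have e : C * (η + D * (N * (2 * (C * ε)) + C * η)) + N * (2 * (C * ε)) = N * (ε * K) + R := by
    simp only [η, K, R]; ring
  rw [hεK] at e
  linarith

theorem lower_bound {x0 x1 : ℕ → X} {xs0 : ℕ → X →L[ℝ] ℝ} {C D : ℝ} (hD : 0 < D)
    (hb0 : IsUncondBasisWith x0 xs0 C)
    (hd : ∀ Γ : Set ℕ, ∀ u ∈ sspan x0 Γᶜ, ∀ w ∈ sspan x1 Γ,
        ‖w‖ = 1 → D⁻¹ ≤ ‖u - w‖) (Γ : Set ℕ) (w : X) (hw : w ∈ sspan x1 Γ) :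
    ‖w‖ ≤ D * ‖pr hb0 Γ w‖ := by
  classical
  by_cases h0 : w = 0
  · simp [h0]
  have hn : 0 < ‖w‖ := norm_pos_iff.2 h0
  have hmem : w - pr hb0 Γ w ∈ sspan x0 Γᶜ := by
    rw [mem_sspan_iff hb0]
    intro i hi
    rw [Set.mem_compl_iff, not_not] at hi
    rw [map_sub, pr_coord, if_pos hi, sub_self]
  have := hd Γ (‖w‖⁻¹ • (w - pr hb0 Γ w)) (Submodule.smul_mem _ _ hmem) (‖w‖⁻¹ • w)
    (Submodule.smul_mem _ _ hw) (by rw [norm_smul, norm_inv, norm_norm, inv_mul_cancel₀ hn.ne'])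
  rw [← smul_sub, sub_sub_cancel_left, norm_smul, norm_neg, norm_inv, norm_norm] at this
  rw [inv_mul_eq_div, le_div_iff₀ hn, inv_mul_le_iff₀ hD] at this
  exact this

theorem stmt12 (x0 x1 : ℕ → X) (xs0 xs1 : ℕ → X →L[ℝ] ℝ) (C : ℝ) (hC : 1 ≤ C)
    (hb0 : IsUncondBasisWith x0 xs0 C) (hb1 : IsUncondBasisWith x1 xs1 C)
    (hd : ∃ D > (0 : ℝ), ∀ σ : ℕ → Bool,
      ∀ u ∈ sspan x0 {i | σ i = false}, ∀ w ∈ sspan x1 {i | σ i = true},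
        (‖u‖ = 1 ∨ ‖w‖ = 1) → D⁻¹ ≤ ‖u - w‖) :
    ∃ E > (0 : ℝ), ∀ σ : ℕ → Bool, RestrictionsInvertible x0 x1 xs0 xs1 σ E := by
  classical
  obtain ⟨D, hD, hd⟩ := hd
  have hset : ∀ Γ : Set ℕ, {i | decide (i ∈ Γ) = false} = Γᶜ ∧ {i | decide (i ∈ Γ) = true} = Γ := by
    intro Γ
    constructor <;> ext i <;> simp
  have hset' : ∀ Γ : Set ℕ, {i | decide (i ∉ Γ) = false} = Γ ∧ {i | decide (i ∉ Γ) = true} = Γᶜ := by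
    intro Γ
    constructor <;> ext i <;> simp
  have H0 : ∀ Γ : Set ℕ, ∀ u ∈ sspan x1 Γ, ‖u‖ ≤ D * ‖pr hb0 Γ u‖ := by
    apply lower_bound hD hb0
    intro Γ u hu w hw h
    have := hd (fun i => decide (i ∈ Γ)) u (by rw [(hset Γ).1]; exact hu) w
      (by rw [(hset Γ).2]; exact hw) (Or.inr h)
    exact this
  have H1 : ∀ Γ : Set ℕ, ∀ u ∈ sspan x0 Γ, ‖u‖ ≤ D * ‖pr hb1 Γ u‖ := by
    apply lower_bound hD hb1
    intro Γ u hu w hw h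
    have := hd (fun i => decide (i ∉ Γ)) w (by rw [(hset' Γ).1]; exact hw) u
      (by rw [(hset' Γ).2]; exact hu) (Or.inl h)
    rwa [norm_sub_rev]
  refine ⟨D, hD, fun σ => ⟨fun u hu => ⟨pr_mem hb0 _ u, H0 _ u hu⟩,
    fun y hy => main_onto hC hD hb0 hb1 H0 _ y hy,
    fun u hu => ⟨pr_mem hb1 _ u, H1 _ u hu⟩,
    fun y hy => main_onto hC hD hb1 hb0 H1 _ y hy⟩⟩
end

section
/- Let (x⁰_i)_{i∈ℕ} and (x¹_i)_{i∈ℕ} be two C-unconditional Schauder bases for a Banach space X with biorthogonal functionals (x⁰*_i) and (x¹*_i). Suppose there exists E > 0 such that for every σ : ℕ → {0,1}, letting P be the basis projection of (x⁰_i) onto [x⁰_i]_{i∈σ⁻¹(0)} and Q the basis projection of (x¹_i) onto [x¹_i]_{i∈σ⁻¹(0)}, the restrictions P|_{[x¹_i]_{i∈σ⁻¹(0)}} : [x¹_i]_{i∈σ⁻¹(0)} → [x⁰_i]_{i∈σ⁻¹(0)} and Q|_{[x⁰_i]_{i∈σ⁻¹(0)}} : [x⁰_i]_{i∈σ⁻¹(0)}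 → [x¹_i]_{i∈σ⁻¹(0)} are bijective with inverses of norm at most E. Then for every σ : ℕ → {0,1}, the weaving (x^{σ(i)}_i)_{i∈ℕ} is an unconditional Schauder basis for X. -/
open Filter Topology

variable {X : Type*} [NormedAddCommGroup X] [NormedSpace ℝ X] [CompleteSpace X]

theorem bproj_hasSum_aux {x : ℕ → X} {xs : ℕ → X →L[ℝ] ℝ} {C : ℝ}
    (h : IsUncondBasisWith x xs C) (Γ : Set ℕ) (v : X) :
    HasSum (fun i : Γ => xs (i : ℕ) v • x (i : ℕ)) (bproj x xs Γ v) :=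
  ((h.2.1 v).summable.subtype Γ).hasSum

theorem bproj_mem_aux {x : ℕ → X} {xs : ℕ → X →L[ℝ] ℝ} {C : ℝ}
    (h : IsUncondBasisWith x xs C) (Γ : Set ℕ) (v : X) :
    bproj x xs Γ v ∈ sspan x Γ := by
  have h1 := bproj_hasSum_aux h Γ v
  have hc : IsClosed ((sspan x Γ : Submodule ℝ X) : Set X) :=
    Submodule.isClosed_topologicalClosure _
  refine hc.mem_of_tendsto h1 (Eventually.of_forall fun s => ?_)
  refine Submodule.sum_mem _ fun i _ => Submodule.smul_mem _ _ ?_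
  exact Submodule.le_topologicalClosure _ (Submodule.subset_span ⟨i, i.2, rfl⟩)

theorem coef_bproj_aux {x : ℕ → X} {xs : ℕ → X →L[ℝ] ℝ} {C : ℝ}
    (h : IsUncondBasisWith x xs C) (Γ : Set ℕ) (v : X) (k : ℕ) (hk : k ∈ Γ) :
    xs k (bproj x xs Γ v) = xs k v := by
  have h1 := (bproj_hasSum_aux h Γ v).mapL (xs k)
  have h2 : HasSum (fun i : Γ => xs k (xs (i : ℕ) v • x (i : ℕ))) (xs k v) := by
    have := hasSum_single (f := fun i : Γ => xs k (xs (i : ℕ) v • x (i : ℕ))) ⟨k, hk⟩ (by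
      intro i hi
      have : k ≠ (i : ℕ) := fun e => hi (Subtype.ext e.symm)
      simp [h.1, this])
    simpa [h.1] using this
  exact h1.unique h2

theorem coef_zero_aux {x : ℕ → X} {xs : ℕ → X →L[ℝ] ℝ} {C : ℝ}
    (h : IsUncondBasisWith x xs C) (Γ : Set ℕ) (u : X) (hu : u ∈ sspan x Γ)
    (k : ℕ) (hk : k ∉ Γ) : xs k u = 0 := by
  have hle : sspan x Γ ≤ (xs k).ker := by
    refine Submodule.topologicalClosure_minimal _ ?_ (xs k).isClosed_ker
    rw [Submodule.span_le]
    rintro _ ⟨i, hi, rfl⟩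
    have : k ≠ i := fun e => hk (e ▸ hi)
    simp [h.1, this]
  exact hle hu

theorem weave_unique_aux (x0 x1 : ℕ → X) (xs0 xs1 : ℕ → X →L[ℝ] ℝ) (C E : ℝ) (hE0 : 0 < E)
    (hb0 : IsUncondBasisWith x0 xs0 C) (hb1 : IsUncondBasisWith x1 xs1 C)
    (hE : ∀ σ : ℕ → Bool, RestrictionsInvertible x0 x1 xs0 xs1 σ E)
    (σ : ℕ → Bool) (a : ℕ → ℝ)
    (ha : Tendsto (fun N => ∑ j ∈ Finset.range N, a j • weave x0 x1 σ j) atTop (𝓝 0)) :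
    a = 0 := by
  set Δ : Set ℕ := {i | (!σ i) = false} with hΔ
  have hR := (hE (fun i => !σ i)).1
  set s : ℕ → X := fun N => ∑ j ∈ Finset.range N, if σ j then a j • x1 j else 0 with hs
  set r : ℕ → X := fun N => ∑ j ∈ Finset.range N, if σ j then 0 else a j • x0 j with hr
  have ht : ∀ N, ∑ j ∈ Finset.range N, a j • weave x0 x1 σ j = r N + s N := by
    intro N
    simp only [hs, hr, ← Finset.sum_add_distrib]
    refine Finset.sum_congr rfl fun j _ => ?_
    cases hj : σ j <;> simp [weave, hj]
  have hsm : ∀ N, s N ∈ sspan x1 Δ := by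
    intro N
    refine Submodule.sum_mem _ fun j _ => ?_
    cases hj : σ j
    · simp
    · simp only [if_true]
      refine Submodule.smul_mem _ _ ?_
      exact Submodule.le_topologicalClosure _ (Submodule.subset_span ⟨j, by simp [hΔ, hj], rfl⟩)
  have hP : ∀ N, bproj x0 xs0 Δ (s N) = bproj x0 xs0 Δ (r N + s N) := by
    intro N
    unfold bproj
    refine tsum_congr fun i => ?_
    have : xs0 i (r N) = 0 := by
      simp only [hr, map_sum]
      refine Finset.sum_eq_zero fun j _ => ?_
      have hi : σ i = true := by simpa [hΔ] using i.2
      cases hj : σ j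
      · have : (i : ℕ) ≠ j := by rintro rfl; simp [hi] at hj
        simp [hb0.1, this]
      · simp
    rw [map_add, this, zero_add]
  simp only [ht] at ha
  have hsb : ∀ N, ‖s N‖ ≤ E * (C * ‖r N + s N‖) := by
    intro N
    refine (hR (s N) (hsm N)).2.trans ?_
    refine mul_le_mul_of_nonneg_left ?_ hE0.le
    have := hb0.2.2 (r N + s N) Δ
    change ‖bproj x0 xs0 Δ (s N)‖ ≤ _
    rw [hP]; exact this
  have hs0 : Tendsto s atTop (𝓝 0) := by
    refine squeeze_zero_norm hsb ?_
    simpa using (ha.norm.const_mul C).const_mul E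
  have hr0 : Tendsto r atTop (𝓝 0) := by
    simpa using ha.sub hs0
  funext k
  cases hk : σ k
  · have h1 : Tendsto (fun N => xs0 k (r N)) atTop (𝓝 0) := by
      simpa [Function.comp_def] using ((xs0 k).continuous.tendsto 0).comp hr0
    refine tendsto_nhds_unique (tendsto_const_nhds.congr' ?_) h1
    filter_upwards [eventually_gt_atTop k] with N hN
    simp only [hr, map_sum]
    rw [Finset.sum_eq_single k]
    · simp [hk, hb0.1]
    · intro j _ hj
      cases σ j <;> simp [hb0.1, hj.symm]
    · intro h; exact absurd (Finset.mem_range.2 hN) h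
  · have h1 : Tendsto (fun N => xs1 k (s N)) atTop (𝓝 0) := by
      simpa [Function.comp_def] using ((xs1 k).continuous.tendsto 0).comp hs0
    refine tendsto_nhds_unique (tendsto_const_nhds.congr' ?_) h1
    filter_upwards [eventually_gt_atTop k] with N hN
    simp only [hs, map_sum]
    rw [Finset.sum_eq_single k]
    · simp [hk, hb1.1]
    · intro j _ hj
      cases σ j <;> simp [hb1.1, hj.symm]
    · intro h; exact absurd (Finset.mem_range.2 hN) h

theorem weave_exists_aux (x0 x1 : ℕ → X) (xs0 xs1 : ℕ → X →L[ℝ] ℝ) (C E : ℝ)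
    (hb0 : IsUncondBasisWith x0 xs0 C) (hb1 : IsUncondBasisWith x1 xs1 C)
    (hE : ∀ σ : ℕ → Bool, RestrictionsInvertible x0 x1 xs0 xs1 σ E)
    (σ : ℕ → Bool) (v : X) :
    ∃ a : ℕ → ℝ, HasSum (fun j => a j • weave x0 x1 σ j) v := by
  obtain ⟨u, hu, huv⟩ := (hE (fun i => !σ i)).2.1 _ (bproj_mem_aux hb0 _ v)
  refine ⟨fun j => if σ j then xs1 j u else xs0 j (v - u), ?_⟩
  have h := (hb0.2.1 (v - u)).add (hb1.2.1 u)
  rw [sub_add_cancel] at h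
  convert h using 2 with j
  cases hj : σ j
  · have := coef_zero_aux hb1 _ u hu j (by simp [hj])
    simp [weave, hj, this]
  · have h1 := coef_bproj_aux hb0 {i | (!σ i) = false} u j (by simp [hj])
    rw [huv, coef_bproj_aux hb0 _ v j (by simp [hj])] at h1
    simp [weave, hj, h1]

theorem stmt13 (x0 x1 : ℕ → X) (xs0 xs1 : ℕ → X →L[ℝ] ℝ) (C : ℝ) (hC : 1 ≤ C)
    (hb0 : IsUncondBasisWith x0 xs0 C) (hb1 : IsUncondBasisWith x1 xs1 C)
    (hE : ∃ E > (0 : ℝ), ∀ σ : ℕ → Bool, RestrictionsInvertible x0 x1 xs0 xs1 σ E) :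
    ∀ σ : ℕ → Bool, IsUncondSchauderBasis (weave x0 x1 σ) := by
  obtain ⟨E, hE0, hE⟩ := hE
  intro σ
  have huniq : ∀ (v : X) (a b : ℕ → ℝ),
      Tendsto (fun N => ∑ j ∈ Finset.range N, a j • weave x0 x1 σ j) atTop (𝓝 v) →
      Tendsto (fun N => ∑ j ∈ Finset.range N, b j • weave x0 x1 σ j) atTop (𝓝 v) → a = b := by
    intro v a b ha hb
    rw [← sub_eq_zero]
    refine weave_unique_aux x0 x1 xs0 xs1 C E hE0 hb0 hb1 hE σ _ ?_
    simpa [sub_smul, Finset.sum_sub_distrib] using ha.sub hb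
  constructor
  · intro v
    obtain ⟨a, ha⟩ := weave_exists_aux x0 x1 xs0 xs1 C E hb0 hb1 hE σ v
    exact ⟨a, ha.tendsto_sum_nat, fun b hb => huniq v b a hb ha.tendsto_sum_nat⟩
  · intro v b hb
    obtain ⟨a, ha⟩ := weave_exists_aux x0 x1 xs0 xs1 C E hb0 hb1 hE σ v
    rw [huniq v b a hb ha.tendsto_sum_nat]
    exact ha
end
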